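/- Let N ≥ 2, 0 < R₀ < R₁, p ∈ (1,∞) and s ∈ (0, R₁ − R₀). Let u be a first eigenfunction of the p-Laplacian on Ω_s, and suppose the function t ↦ λ₁(p, Ω_t) is differentiable at s with derivative 0. Then there exists r₀ ∈ (R₀, R₁ − s) such that u(x) = u(2s − x₁, x₂, …, x_N) for every x = (x₁, …, x_N) with R₀ < ‖x − s e₁‖ < r₀ (symmetry with respect to the affine hyperplane {x₁ = s} passing through s e₁). -/

import Mathlib

open MeasureTheory Metric Set Filter
open scoped RealInnerProductSpace ENNReal Topology

/-- The first Dirichlet eigenvalue of the p-Laplacian on `Ω`, defined variationally as the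
infimum of Rayleigh quotients of smooth, not identically zero functions with compact
support contained in `Ω`. -/
noncomputable def lam1 {N : ℕ} (p : ℝ) (Ω : Set (EuclideanSpace ℝ (Fin N))) : ℝ :=
  sInf { r : ℝ | ∃ u : EuclideanSpace ℝ (Fin N) → ℝ,
    ContDiff ℝ (⊤ : ℕ∞) u ∧ u ≠ 0 ∧ HasCompactSupport u ∧ tsupport u ⊆ Ω ∧
    r = (∫ x in Ω, ‖gradient u x‖ ^ p) / (∫ x in Ω, |u x| ^ p) }

/-- The first standard basis vector `e₁` of `ℝ^N`. -/
noncomputable def e1 (N : ℕ) : EuclideanSpace ℝ (Fin N) :=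
  (WithLp.equiv 2 (Fin N → ℝ)).symm (fun i => if (i : ℕ) = 0 then 1 else 0)

/-- The eccentric annulus `Ω_s = B_{R₁}(0) \ closure (B_{R₀}(s e₁))`. -/
noncomputable def Om (N : ℕ) (R₀ R₁ s : ℝ) : Set (EuclideanSpace ℝ (Fin N)) :=
  ball 0 R₁ \ closure (ball (s • e1 N) R₀)

/-- `u` is a first eigenfunction of the p-Laplacian on `Ω` with eigenvalue `lam`:
C¹ on an open set containing the closure of `Ω`, positive in `Ω`, zero on `∂Ω`, and a weak
solution of `−Δ_p u = lam · u^{p−1}`. -/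
def IsFirstEigenfunction {N : ℕ} (p : ℝ) (Ω : Set (EuclideanSpace ℝ (Fin N)))
    (lam : ℝ) (u : EuclideanSpace ℝ (Fin N) → ℝ) : Prop :=
  (∃ V : Set (EuclideanSpace ℝ (Fin N)), IsOpen V ∧ closure Ω ⊆ V ∧ ContDiffOn ℝ 1 u V) ∧
  (∀ x ∈ Ω, 0 < u x) ∧
  (∀ x ∈ frontier Ω, u x = 0) ∧
  (∀ φ : EuclideanSpace ℝ (Fin N) → ℝ, ContDiff ℝ (⊤ : ℕ∞) φ → HasCompactSupport φ →
    tsupport φ ⊆ Ω →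
    ∫ x in Ω, ‖gradient u x‖ ^ (p - 2) * ⟪gradient u x, gradient φ x⟫ =
      lam * ∫ x in Ω, (u x) ^ (p - 1) * φ x)

section part1
open MeasureTheory Metric Set Filter
open scoped RealInnerProductSpace ENNReal Topology NNReal
namespace PL

/-- The `p`-flux `|a|^{p-2} a`. -/
noncomputable def flux {E : Type*} [NormedAddCommGroup E] [NormedSpace ℝ E] (p : ℝ) (a : E) : E :=
  ‖a‖ ^ (p - 2) • a

theorem young_nonneg {p x y : ℝ} (hp : 1 < p) (hx : 0 ≤ x) (hy : 0 ≤ y) :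
    0 ≤ x ^ p + (p - 1) * y ^ p - p * y ^ (p - 1) * x ∧
    (x ^ p + (p - 1) * y ^ p - p * y ^ (p - 1) * x = 0 → x = y) := by
  rcases hy.eq_or_lt with rfl | hy
  · rw [Real.zero_rpow (by linarith), Real.zero_rpow (by linarith)]
    constructor
    · have := Real.rpow_nonneg hx p
      linarith
    · intro h
      have : x ^ p = 0 := by linarith
      exact (Real.rpow_eq_zero hx (by linarith)).1 this
  · obtain ⟨t, rfl⟩ : ∃ t, x = t * y := ⟨x / y, by field_simp⟩
    have ht : 0 ≤ t := by
      by_contra h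
      push Not at h
      nlinarith
    have e1 : y ^ p = y ^ (p - 1) * y := by
      rw [← Real.rpow_add_one hy.ne']; ring_nf
    have e2 : (t * y) ^ p + (p - 1) * y ^ p - p * y ^ (p - 1) * (t * y)
        = y ^ p * (t ^ p - (1 + p * (t - 1))) := by
      rw [Real.mul_rpow ht hy.le, e1]; ring
    have hyp : 0 < y ^ p := Real.rpow_pos_of_pos hy p
    rw [e2]
    by_cases h1 : t = 1
    · subst h1
      simp
    · have := one_add_mul_self_lt_rpow_one_add (s := t - 1) (by linarith) (sub_ne_zero.2 h1) hp
      rw [show 1 + (t - 1) = t by ring] at this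
      have h3 : 0 < y ^ p * (t ^ p - (1 + p * (t - 1))) := mul_pos hyp (by linarith)
      exact ⟨h3.le, fun h => absurd h h3.ne'⟩

section vec
variable {E : Type*} [NormedAddCommGroup E] [InnerProductSpace ℝ E]

theorem norm_flux {p : ℝ} (hp : 1 < p) (a : E) : ‖flux p a‖ = ‖a‖ ^ (p - 1) := by
  unfold flux
  rw [norm_smul, Real.norm_of_nonneg (Real.rpow_nonneg (norm_nonneg _) _)]
  rcases (norm_nonneg a).eq_or_lt with h | h
  · rw [← h, Real.zero_rpow (by linarith : p - 1 ≠ 0), mul_zero]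
  · rw [← Real.rpow_add_one h.ne']; ring_nf

theorem inner_flux_self {p : ℝ} (hp : 1 < p) (a : E) : ⟪flux p a, a⟫ = ‖a‖ ^ p := by
  unfold flux
  rw [real_inner_smul_left, real_inner_self_eq_norm_sq]
  rcases (norm_nonneg a).eq_or_lt with h | h
  · rw [← h, Real.zero_rpow (by linarith : p ≠ 0)]; simp
  · rw [← Real.rpow_add_natCast h.ne']; norm_num

theorem flux_smul {p : ℝ} (hp : 1 < p) {t : ℝ} (ht : 0 ≤ t) (a : E) :
    flux p (t • a) = t ^ (p - 1) • flux p a := by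
  unfold flux
  rcases ht.eq_or_lt with rfl | ht
  · simp [Real.zero_rpow (by linarith : p - 1 ≠ 0)]
  · rw [norm_smul, Real.norm_of_nonneg ht.le, Real.mul_rpow ht.le (norm_nonneg _), smul_smul, smul_smul,
      show p - 1 = p - 2 + 1 by ring, Real.rpow_add_one ht.ne']
    ring_nf

theorem continuous_flux {p : ℝ} (hp : 1 < p) : Continuous (flux p : E → E) := by
  rw [continuous_iff_continuousAt]
  intro a
  by_cases ha : a = 0
  · subst ha
    rw [ContinuousAt, show flux p (0:E) = 0 by simp [flux], tendsto_zero_iff_norm_tendsto_zero]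
    simp_rw [norm_flux hp]
    have : Continuous (fun x : E => ‖x‖ ^ (p - 1)) :=
      continuous_norm.rpow_const (fun x => Or.inr (by linarith))
    have h := this.tendsto (0:E)
    simpa [Real.zero_rpow (by linarith : p - 1 ≠ 0)] using h
  · unfold flux
    exact (continuous_norm.continuousAt.rpow_const (Or.inl (norm_ne_zero_iff.2 ha))).smul
      continuousAt_id

/-- Picone / convexity inequality. -/
theorem picone {p : ℝ} (hp : 1 < p) (a b : E) :
    0 ≤ ‖a‖ ^ p + (p - 1) * ‖b‖ ^ p - p * ⟪flux p b, a⟫ ∧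
    (‖a‖ ^ p + (p - 1) * ‖b‖ ^ p - p * ⟪flux p b, a⟫ = 0 → a = b) := by
  have h1 : ⟪flux p b, a⟫ ≤ ‖b‖ ^ (p - 1) * ‖a‖ := by
    rw [← norm_flux hp]; exact real_inner_le_norm _ _
  obtain ⟨y1, y2⟩ := young_nonneg hp (norm_nonneg a) (norm_nonneg b)
  have hp0 : 0 < p := by linarith
  constructor
  · nlinarith
  · intro h
    have hab : ‖a‖ = ‖b‖ := y2 (le_antisymm (by nlinarith) y1)
    have h2 : ⟪flux p b, a⟫ = ‖b‖ ^ p := by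
      have : p * ⟪flux p b, a⟫ = p * ‖b‖ ^ p := by rw [hab] at h; linarith
      exact mul_left_cancel₀ hp0.ne' this
    by_cases hb : b = 0
    · subst hb; simpa using hab
    have hb' : 0 < ‖b‖ := norm_pos_iff.2 hb
    unfold flux at h2
    rw [real_inner_smul_left] at h2
    have h3 : ‖b‖ ^ p = ‖b‖ ^ (p-2) * ‖b‖ ^ 2 := by
      rw [← Real.rpow_add_natCast hb'.ne']; norm_num
    rw [h3] at h2
    have h4 : ⟪b, a⟫ = ‖b‖ ^ 2 := mul_left_cancel₀ (Real.rpow_pos_of_pos hb' _).ne' h2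
    have h5 : ‖a - b‖ ^ 2 = 0 := by
      rw [norm_sub_sq_real, real_inner_comm, h4, hab]; ring
    rw [← sub_eq_zero, ← norm_eq_zero]
    exact pow_eq_zero_iff (two_ne_zero) |>.1 h5

theorem flux_mono {p : ℝ} (hp : 1 < p) (a b : E) :
    0 ≤ ⟪flux p a - flux p b, a - b⟫ ∧ (⟪flux p a - flux p b, a - b⟫ = 0 → a = b) := by
  obtain ⟨h1, h2⟩ := picone hp a b
  obtain ⟨h3, h4⟩ := picone hp b a
  have e : p * ⟪flux p a - flux p b, a - b⟫ = (‖a‖ ^ p + (p - 1) * ‖b‖ ^ p - p * ⟪flux p b, a⟫)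
      + (‖b‖ ^ p + (p - 1) * ‖a‖ ^ p - p * ⟪flux p a, b⟫) := by
    rw [inner_sub_left, inner_sub_right, inner_sub_right, inner_flux_self hp, inner_flux_self hp]
    ring
  have hp0 : 0 < p := by linarith
  constructor
  · by_contra h
    push Not at h
    nlinarith
  · intro h
    rw [h] at e
    exact h2 (by linarith)

theorem rpow_between {q m M r : ℝ} (hm : 0 < m) (h1 : m ≤ r) (h2 : r ≤ M) :
    min (m ^ q) (M ^ q) ≤ r ^ q ∧ r ^ q ≤ max (m ^ q) (M ^ q) := by
  have hr : 0 < r := by linarith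
  rcases le_total 0 q with hq | hq
  · exact ⟨(min_le_left _ _).trans (Real.rpow_le_rpow hm.le h1 hq),
      (Real.rpow_le_rpow hr.le h2 hq).trans (le_max_right _ _)⟩
  · exact ⟨(min_le_right _ _).trans (Real.rpow_le_rpow_of_nonpos hr h2 hq),
      (Real.rpow_le_rpow_of_nonpos hm h1 hq).trans (le_max_left _ _)⟩

theorem flux_line_deriv {p : ℝ} (b d e : E) (t : ℝ) (h : b + t • d ≠ 0) :
    HasDerivAt (fun t : ℝ => ⟪flux p (b + t • d), e⟫)
      (‖b + t • d‖ ^ (p - 2) * (⟪d, e⟫ + (p - 2) * (⟪b + t • d, d⟫ * ⟪b + t • d, e⟫) / ‖b + t • d‖ ^ 2)) t := by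
  have hg : HasDerivAt (fun t : ℝ => b + t • d) d t := by
    simpa using ((hasDerivAt_id t).smul_const d).const_add b
  have hr : 0 < ‖b + t • d‖ := norm_pos_iff.2 h
  have h1 : HasDerivAt (fun t : ℝ => ‖b + t • d‖ ^ 2) (2 * ⟪b + t • d, d⟫) t := hg.norm_sq
  have h2 : HasDerivAt (fun t : ℝ => (‖b + t • d‖ ^ 2) ^ ((p - 2) / 2))
      (2 * ⟪b + t • d, d⟫ * ((p - 2) / 2) * (‖b + t • d‖ ^ 2) ^ ((p - 2) / 2 - 1)) t :=
    h1.rpow_const (Or.inl (by positivity))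
  have h3 : HasDerivAt (fun t : ℝ => ⟪b + t • d, e⟫) ⟪d, e⟫ t := by
    simpa using hg.inner ℝ (hasDerivAt_const t e)
  have h4 := h2.mul h3
  have e1 : ∀ r : ℝ, 0 ≤ r → (r ^ 2) ^ ((p - 2) / 2) = r ^ (p - 2) := by
    intro r hr
    rw [← Real.rpow_natCast, ← Real.rpow_mul hr]; congr 1; push_cast; ring
  have e2 : (‖b + t • d‖ ^ 2) ^ ((p - 2) / 2 - 1) = ‖b + t • d‖ ^ (p - 2) / ‖b + t • d‖ ^ 2 := by
    rw [Real.rpow_sub_one (by positivity), e1 _ hr.le]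
  rw [e2, e1 _ hr.le] at h4
  refine (h4.congr_deriv (by field_simp; ring)).congr_of_eventuallyEq ?_
  filter_upwards with x
  simp only [flux, Pi.mul_apply, real_inner_smul_left, e1 _ (norm_nonneg _)]

theorem ellip {p m M : ℝ} (hp : 1 < p) (hm : 0 < m) (hM : m ≤ M) :
    ∃ c C : ℝ, 0 < c ∧ 0 < C ∧ ∀ n a b : E, ‖n‖ = 1 → m ≤ ⟪a, n⟫ → m ≤ ⟪b, n⟫ → ‖a‖ ≤ M → ‖b‖ ≤ M →
      c * ‖a - b‖ ^ 2 ≤ ⟪flux p a - flux p b, a - b⟫ ∧ ‖flux p a - flux p b‖ ≤ C * ‖a - b‖ := by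
  have hM0 : 0 < M := by linarith
  set c0 := min (m ^ (p-2)) (M ^ (p-2)) with hc0
  set C0 := max (m ^ (p-2)) (M ^ (p-2)) with hC0
  have hc0p : 0 < c0 := lt_min (Real.rpow_pos_of_pos hm _) (Real.rpow_pos_of_pos hM0 _)
  have hC0p : 0 < C0 := lt_max_of_lt_left (Real.rpow_pos_of_pos hm _)
  refine ⟨c0 * min 1 (p - 1), C0 * (1 + |p - 2|), mul_pos hc0p (lt_min one_pos (by linarith)), by positivity, ?_⟩
  intro n a b hn ha hb haM hbM
  set d := a - b with hd
  have hseg : ∀ t ∈ Icc (0:ℝ) 1, m ≤ ‖b + t • d‖ ∧ ‖b + t • d‖ ≤ M := by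
    intro t ht
    have e : b + t • d = (1 - t) • b + t • a := by rw [hd]; module
    constructor
    · have h1 : m ≤ ⟪b + t • d, n⟫ := by
        rw [e, inner_add_left, real_inner_smul_left, real_inner_smul_left]
        nlinarith [ht.1, ht.2]
      have h2 := real_inner_le_norm (b + t • d) n
      rw [hn] at h2; linarith
    · rw [e]
      refine (norm_add_le _ _).trans ?_
      rw [norm_smul, norm_smul, Real.norm_of_nonneg ht.1, Real.norm_of_nonneg (by linarith [ht.2])]
      nlinarith [ht.1, ht.2]
  have hne : ∀ t ∈ Icc (0:ℝ) 1, b + t • d ≠ 0 := fun t ht h => by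
    have := (hseg t ht).1
    rw [h, norm_zero] at this; linarith
  have hmv : ∀ e : E, ∃ t ∈ Icc (0:ℝ) 1, ⟪flux p a - flux p b, e⟫ =
      ‖b + t • d‖ ^ (p - 2) * (⟪d, e⟫ + (p - 2) * (⟪b + t • d, d⟫ * ⟪b + t • d, e⟫) / ‖b + t • d‖ ^ 2) := by
    intro e
    obtain ⟨t, ht, h⟩ := exists_hasDerivAt_eq_slope (fun t : ℝ => ⟪flux p (b + t • d), e⟫) _ (zero_lt_one)
      (fun t ht => (flux_line_deriv (p := p) b d e t (hne t ht)).continuousAt.continuousWithinAt)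
      (fun t ht => flux_line_deriv (p := p) b d e t (hne t ⟨ht.1.le, ht.2.le⟩))
    refine ⟨t, ⟨ht.1.le, ht.2.le⟩, ?_⟩
    rw [h, inner_sub_left]
    simp [hd]
  constructor
  · obtain ⟨t, ht, h⟩ := hmv d
    rw [h]
    obtain ⟨s1, s2⟩ := hseg t ht
    obtain ⟨r1, r2⟩ := rpow_between (q := p - 2) hm s1 s2
    have hr : 0 < ‖b + t • d‖ := by linarith
    have hcs : ⟪b + t • d, d⟫ * ⟪b + t • d, d⟫ ≤ ‖b + t • d‖ ^ 2 * ‖d‖ ^ 2 := by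
      have := real_inner_mul_inner_self_le (b + t • d) d
      rw [real_inner_self_eq_norm_sq, real_inner_self_eq_norm_sq] at this
      exact this
    set X := ⟪b + t • d, d⟫ * ⟪b + t • d, d⟫ / ‖b + t • d‖ ^ 2 with hX
    have hX0 : 0 ≤ X := by rw [hX]; positivity [mul_self_nonneg ⟪b + t • d, d⟫]
    have hX1 : X ≤ ‖d‖ ^ 2 := by rw [hX, div_le_iff₀ (by positivity)]; linarith
    rw [real_inner_self_eq_norm_sq, mul_div_assoc, ← hX]
    have key : min 1 (p - 1) * ‖d‖ ^ 2 ≤ ‖d‖ ^ 2 + (p - 2) * X := by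
      rcases le_total 2 p with h2 | h2
      · have : min 1 (p-1) ≤ 1 := min_le_left _ _
        nlinarith [sq_nonneg ‖d‖]
      · have : min 1 (p-1) ≤ p - 1 := min_le_right _ _
        nlinarith [sq_nonneg ‖d‖]
    have hmin : 0 ≤ min 1 (p-1) * ‖d‖^2 := mul_nonneg (le_min zero_le_one (by linarith)) (sq_nonneg _)
    calc c0 * min 1 (p - 1) * ‖d‖ ^ 2 = c0 * (min 1 (p - 1) * ‖d‖ ^ 2) := by ring
      _ ≤ ‖b + t • d‖ ^ (p - 2) * (‖d‖ ^ 2 + (p - 2) * X) := mul_le_mul r1 key hmin (by positivity)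
  · set e := flux p a - flux p b with he
    obtain ⟨t, ht, h⟩ := hmv e
    obtain ⟨s1, s2⟩ := hseg t ht
    obtain ⟨r1, r2⟩ := rpow_between (q := p - 2) hm s1 s2
    have hr : 0 < ‖b + t • d‖ := by linarith
    rw [real_inner_self_eq_norm_sq] at h
    have h1 : |⟪d, e⟫| ≤ ‖d‖ * ‖e‖ := abs_real_inner_le_norm _ _
    have h2 : |⟪b + t • d, d⟫| ≤ ‖b + t • d‖ * ‖d‖ := abs_real_inner_le_norm _ _
    have h3 : |⟪b + t • d, e⟫| ≤ ‖b + t • d‖ * ‖e‖ := abs_real_inner_le_norm _ _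
    have h4 : |(p - 2) * (⟪b + t • d, d⟫ * ⟪b + t • d, e⟫) / ‖b + t • d‖ ^ 2| ≤ |p - 2| * (‖d‖ * ‖e‖) := by
      rw [abs_div, abs_mul, abs_mul, abs_of_pos (by positivity : 0 < ‖b + t • d‖ ^ 2), div_le_iff₀ (by positivity)]
      calc |p - 2| * (|⟪b + t • d, d⟫| * |⟪b + t • d, e⟫|) ≤ |p - 2| * ((‖b + t • d‖ * ‖d‖) * (‖b + t • d‖ * ‖e‖)) := by
            gcongr
        _ = _ := by ring
    have h5 : ⟪d, e⟫ + (p - 2) * (⟪b + t • d, d⟫ * ⟪b + t • d, e⟫) / ‖b + t • d‖ ^ 2 ≤ (1 + |p - 2|) * (‖d‖ * ‖e‖) := by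
      have := le_abs_self ⟪d, e⟫
      have := le_abs_self ((p - 2) * (⟪b + t • d, d⟫ * ⟪b + t • d, e⟫) / ‖b + t • d‖ ^ 2)
      linarith
    have h6 : ‖e‖ ^ 2 ≤ C0 * ((1 + |p - 2|) * (‖d‖ * ‖e‖)) := by
      rw [h]
      calc _ ≤ ‖b + t • d‖ ^ (p - 2) * ((1 + |p - 2|) * (‖d‖ * ‖e‖)) := by gcongr
        _ ≤ _ := by gcongr
    rcases (norm_nonneg e).eq_or_lt with h0 | h0
    · rw [← h0]; positivity
    · by_contra hcon
      push Not at hcon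
      nlinarith
end vec
end PL
end part1

section part2
open MeasureTheory Metric Set Filter
open scoped RealInnerProductSpace ENNReal Topology NNReal
namespace PL
section grad
variable {E : Type*} [NormedAddCommGroup E] [InnerProductSpace ℝ E] [CompleteSpace E]

theorem hg_add {f g : E → ℝ} {a b x : E} (hf : HasGradientAt f a x) (hg : HasGradientAt g b x) :
    HasGradientAt (fun y => f y + g y) (a + b) x := by
  rw [hasGradientAt_iff_hasFDerivAt] at *
  rw [map_add]; exact hf.add hg

theorem hg_sub {f g : E → ℝ} {a b x : E} (hf : HasGradientAt f a x) (hg : HasGradientAt g b x) :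
    HasGradientAt (fun y => f y - g y) (a - b) x := by
  rw [hasGradientAt_iff_hasFDerivAt] at *
  rw [map_sub]; exact hf.sub hg

theorem hg_mul {f g : E → ℝ} {a b x : E} (hf : HasGradientAt f a x) (hg : HasGradientAt g b x) :
    HasGradientAt (fun y => f y * g y) (f x • b + g x • a) x := by
  rw [hasGradientAt_iff_hasFDerivAt] at *
  rw [map_add, map_smulₛₗ, map_smulₛₗ]
  exact hf.mul hg

theorem hg_comp {f : E → ℝ} {a x : E} {h : ℝ → ℝ} {h' : ℝ} (hf : HasGradientAt f a x)
    (hh : HasDerivAt h h' (f x)) : HasGradientAt (fun y => h (f y)) (h' • a) x := by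
  rw [hasGradientAt_iff_hasFDerivAt] at *
  rw [map_smulₛₗ]
  exact hh.comp_hasFDerivAt x hf

theorem hg_const_sub {f : E → ℝ} {a x : E} (k : ℝ) (hf : HasGradientAt f a x) :
    HasGradientAt (fun y => k - f y) (-a) x := by
  simpa using hg_sub (hasGradientAt_const x k) hf

theorem hg_add_const {f : E → ℝ} {a x : E} (k : ℝ) (hf : HasGradientAt f a x) :
    HasGradientAt (fun y => f y + k) a x := by
  simpa using hg_add hf (hasGradientAt_const x k)

theorem hg_normsq (c x : E) : HasGradientAt (fun y => ‖y - c‖ ^ 2) ((2:ℝ) • (x - c)) x := by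
  rw [hasGradientAt_iff_hasFDerivAt]
  have h := ((hasFDerivAt_id x).sub_const c).norm_sq
  refine h.congr_fderiv ?_
  ext v
  simp [InnerProductSpace.toDual_apply_apply]

theorem hg_inner (e x : E) (k : ℝ) : HasGradientAt (fun y => ⟪e, y⟫ - k) e x := by
  rw [hasGradientAt_iff_hasFDerivAt]
  exact ((InnerProductSpace.toDual ℝ E e).hasFDerivAt).sub_const k

theorem hg_line {f : E → ℝ} {a x v : E} {t : ℝ} (hf : HasGradientAt f a (x + t • v)) :
    HasDerivAt (fun t : ℝ => f (x + t • v)) ⟪a, v⟫ t := by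
  rw [hasGradientAt_iff_hasFDerivAt] at hf
  have hg : HasDerivAt (fun t : ℝ => x + t • v) v t := by
    simpa using ((hasDerivAt_id t).smul_const v).const_add x
  exact hf.comp_hasDerivAt t hg

theorem hg_min {f : E → ℝ} {a x : E} (hf : HasGradientAt f a x) (hm : IsLocalMin f x) : a = 0 := by
  rw [hasGradientAt_iff_hasFDerivAt] at hf
  have := hm.hasFDerivAt_eq_zero hf
  simpa using this

theorem continuous_gradient {f : E → ℝ} (hf : ContDiff ℝ 1 f) : Continuous (gradient f) := by
  unfold gradient
  exact (InnerProductSpace.toDual ℝ E).symm.continuous.comp (hf.continuous_fderiv one_ne_zero)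

theorem norm_gradient (f : E → ℝ) (x : E) : ‖gradient f x‖ = ‖fderiv ℝ f x‖ := by
  unfold gradient; simp

theorem hg_of_contDiff {f : E → ℝ} (hf : ContDiff ℝ 1 f) (x : E) :
    HasGradientAt f (gradient f x) x :=
  (hf.differentiable one_ne_zero x).hasGradientAt

theorem norm_gradient_le {f : E → ℝ} {K : ℝ≥0} (hf : LipschitzWith K f) (x : E) : ‖gradient f x‖ ≤ K := by
  rw [norm_gradient]; exact norm_fderiv_le_of_lipschitz ℝ hf
end grad

section lip
variable {E : Type*} [NormedAddCommGroup E] [NormedSpace ℝ E]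

theorem lip_aux {O : Set E} (hO : IsOpen O) {f : E → ℝ} {K : ℝ≥0} (hc : ContinuousOn f (closure O))
    (hz : ∀ x ∈ frontier O, f x = 0) (hd : ∀ x ∈ O, DifferentiableAt ℝ f x)
    (hK : ∀ x ∈ O, ‖fderiv ℝ f x‖ ≤ K) {x y : E} (hx : x ∈ O) (hy : y ∉ O) : ‖f x‖ ≤ K * ‖y - x‖ := by
  set γ : ℝ → E := fun t => x + t • (y - x) with hγ
  have hγc : Continuous γ := by fun_prop
  set T : Set ℝ := Icc 0 1 ∩ γ ⁻¹' Oᶜ with hT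
  have hTc : IsCompact T := isCompact_Icc.inter_right (hO.isClosed_compl.preimage hγc)
  have hTn : T.Nonempty := ⟨1, by simp [hT, hγ, hy]⟩
  set t1 := sInf T with ht1
  have hmem : t1 ∈ T := hTc.sInf_mem hTn
  have hlt : ∀ t ∈ Ico 0 t1, γ t ∈ O := by
    intro t ht
    by_contra h
    have : t ∈ T := ⟨⟨ht.1, ht.2.le.trans hmem.1.2⟩, h⟩
    exact absurd (csInf_le hTc.bddBelow this) (not_le.2 ht.2)
  have ht1pos : 0 < t1 := by
    refine lt_of_le_of_ne hmem.1.1 fun h => hmem.2 ?_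
    rw [← h]; simpa [hγ] using hx
  have hcl : γ t1 ∈ closure O := by
    have h1 : t1 ∈ closure (Ico 0 t1) := by rw [closure_Ico ht1pos.ne]; exact ⟨ht1pos.le, le_rfl⟩
    exact map_mem_closure hγc h1 hlt
  have hfr : γ t1 ∈ frontier O := by
    rw [frontier, hO.interior_eq]; exact ⟨hcl, hmem.2⟩
  have hder : ∀ t ∈ Ico 0 t1, HasDerivAt (fun t => f (γ t)) (fderiv ℝ f (γ t) (y - x)) t := by
    intro t ht
    have hg : HasDerivAt γ (y - x) t := by
      have e : (1:ℝ) • (y - x) = y - x := one_smul _ _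
      rw [← e]
      exact ((hasDerivAt_id t).smul_const (y - x)).const_add x
    exact (hd _ (hlt t ht)).hasFDerivAt.comp_hasDerivAt t hg
  have := norm_image_sub_le_of_norm_deriv_right_le_segment (f := fun t => f (γ t)) (a := 0) (b := t1)
    (f' := fun t => fderiv ℝ f (γ t) (y - x)) (C := K * ‖y - x‖) ?_ (fun t ht => (hder t ht).hasDerivWithinAt) ?_ t1 ⟨ht1pos.le, le_rfl⟩
  · rw [hz _ hfr, zero_sub, norm_neg] at this
    simp only [hγ, zero_smul, add_zero, sub_zero] at this
    refine this.trans ?_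
    have := hmem.1.2
    have h0 : 0 ≤ K * ‖y - x‖ := by positivity
    nlinarith
  · refine hc.comp hγc.continuousOn ?_
    intro t ht
    rcases ht.2.eq_or_lt with h | h
    · rw [h]; exact hcl
    · exact subset_closure (hlt t ⟨ht.1, h⟩)
  · intro t ht
    exact (ContinuousLinearMap.le_opNorm _ _).trans (by gcongr; exact hK _ (hlt t ht))

theorem lip_indicator {O : Set E} (hO : IsOpen O) {f : E → ℝ} {K : ℝ≥0} (hc : ContinuousOn f (closure O))
    (hz : ∀ x ∈ frontier O, f x = 0) (hd : ∀ x ∈ O, DifferentiableAt ℝ f x)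
    (hK : ∀ x ∈ O, ‖fderiv ℝ f x‖ ≤ K) : LipschitzWith K (O.indicator f) := by
  refine LipschitzWith.of_dist_le_mul fun x y => ?_
  rw [dist_eq_norm, dist_eq_norm]
  by_cases hx : x ∈ O <;> by_cases hy : y ∈ O
  · rw [indicator_of_mem hx, indicator_of_mem hy]
    by_cases hs : segment ℝ x y ⊆ O
    · rw [← norm_neg, neg_sub, norm_sub_rev x y]
      exact Convex.norm_image_sub_le_of_norm_fderiv_le (s := segment ℝ x y) (fun z hz => hd z (hs hz)) (fun z hz => hK z (hs hz))
        (convex_segment x y) (left_mem_segment ℝ x y) (right_mem_segment ℝ x y)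
    · obtain ⟨z, hz1, hz2⟩ := not_subset.1 hs
      have a1 := lip_aux hO hc hz hd hK hx hz2
      have a2 := lip_aux hO hc hz hd hK hy hz2
      have := dist_add_dist_of_mem_segment hz1
      rw [dist_eq_norm, dist_eq_norm, dist_eq_norm, norm_sub_rev x z] at this
      refine (norm_sub_le _ _).trans ?_
      rw [← this]; linarith
  · rw [indicator_of_mem hx, indicator_of_notMem hy, sub_zero, norm_sub_rev]
    exact lip_aux hO hc hz hd hK hx hy
  · rw [indicator_of_mem hy, indicator_of_notMem hx, zero_sub, norm_neg]
    exact lip_aux hO hc hz hd hK hy hx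
  · rw [indicator_of_notMem hx, indicator_of_notMem hy]; simp; positivity

theorem lip_indicator' [FiniteDimensional ℝ E] {O V : Set E} (hO : IsOpen O) (hb : Bornology.IsBounded O) (hV : IsOpen V) (hOV : closure O ⊆ V)
    {f : E → ℝ} (hf : ContDiffOn ℝ 1 f V) (hz : ∀ x ∈ frontier O, f x = 0) :
    ∃ K : ℝ≥0, LipschitzWith K (O.indicator f) := by
  have : ProperSpace E := FiniteDimensional.proper ℝ E
  have hcomp : IsCompact (closure O) := hb.isCompact_closure
  have h1 : ContinuousOn (fderiv ℝ f) V := hf.continuousOn_fderiv_of_isOpen hV le_rfl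
  obtain ⟨K, hK⟩ := hcomp.exists_bound_of_continuousOn (h1.mono hOV)
  refine ⟨K.toNNReal, lip_indicator hO (hf.continuousOn.mono hOV) hz
    (fun x hx => (hf.differentiableOn one_ne_zero).differentiableAt (hV.mem_nhds (hOV (subset_closure hx)))) ?_⟩
  intro x hx
  exact (hK x (subset_closure hx)).trans (Real.le_coe_toNNReal K)
end lip

/-- one-dimensional propagation. -/
theorem ray {h : ℝ → ℝ} {α β t0 : ℝ} (ht0 : t0 ∈ Ioo α β) (hc : ContinuousOn h (Icc α β)) (h0 : 0 < h t0)
    (hd : ∀ t ∈ Ioo α β, 0 < h t → HasDerivAt h 0 t) : h α = h t0 ∧ h β = h t0 := by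
  set m := h t0 with hm
  set k : ℝ → ℝ := fun t => max (h t) (m / 2) with hk
  have hkc : ContinuousOn k (Icc α β) := hc.sup continuousOn_const
  have hkd : ∀ t ∈ Ioo α β, HasDerivAt k 0 t := by
    intro t ht
    have hca : ContinuousAt h t := hc.continuousAt (Icc_mem_nhds ht.1 ht.2)
    rcases lt_or_ge (h t) (m/2) with h1 | h1
    · have : k =ᶠ[𝓝 t] fun _ => m/2 := by
        filter_upwards [hca.eventually_lt continuousAt_const h1] with s hs
        exact max_eq_right hs.le
      exact (hasDerivAt_const t _).congr_of_eventuallyEq this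
    · have hdt := hd t ht (by linarith)
      have hd2 := hdt
      rw [hasDerivAt_iff_isLittleO] at hd2 ⊢
      refine Asymptotics.IsLittleO.of_bound fun c hcpos => ?_
      filter_upwards [hd2.bound hcpos] with s hs
      refine le_trans ?_ hs
      simp only [smul_zero, sub_zero, hk, Real.norm_eq_abs]
      exact abs_max_sub_max_le_abs _ _ _
  have hconst : ∀ t ∈ Icc α β, k t = k α := by
    intro t ht
    rcases ht.1.eq_or_lt with h1 | h1
    · rw [h1]
    have := constant_of_has_deriv_right_zero (f := k) (a := α) (b := β) hkc
    by_contra hne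
    obtain ⟨s, hs, hs'⟩ := exists_hasDerivAt_eq_slope k (fun _ => 0) h1 (hkc.mono (Icc_subset_Icc_right ht.2))
      (fun s hs => hkd s ⟨hs.1, hs.2.trans_le ht.2⟩)
    have h2 : t - α ≠ 0 := (sub_pos.2 h1).ne'
    rw [eq_div_iff h2] at hs'
    exact hne (by linarith)
  have hαβ : α ≤ β := (ht0.1.trans ht0.2).le
  have e0 : k t0 = m := max_eq_left (by linarith)
  have eα : k α = m := by rw [← hconst t0 ⟨ht0.1.le, ht0.2.le⟩, e0]
  have hall : ∀ t ∈ Icc α β, h t = m := by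
    intro t ht
    have : k t = m := by rw [hconst t ht, eα]
    rcases max_choice (h t) (m/2) with h1 | h1
    · simp only [hk] at this; rw [h1] at this; exact this
    · simp only [hk] at this; rw [h1] at this; linarith
  exact ⟨hall α ⟨le_rfl, hαβ⟩, hall β ⟨hαβ, le_rfl⟩⟩

section ae
variable {E : Type*} [NormedAddCommGroup E] [InnerProductSpace ℝ E] [FiniteDimensional ℝ E] [MeasurableSpace E] [BorelSpace E]

theorem ae_hg {W : E → ℝ} {K : ℝ≥0} (hW : LipschitzWith K W) :
    ∀ᵐ x ∂(volume : Measure E), HasGradientAt W (gradient W x) x := by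
  filter_upwards [hW.ae_differentiableAt (μ := volume)] with x hx using hx.hasGradientAt

theorem measurable_gradient (W : E → ℝ) : Measurable (gradient W) := by
  unfold gradient
  exact (InnerProductSpace.toDual ℝ E).symm.continuous.measurable.comp (measurable_fderiv ℝ W)

theorem ae_grad_ind {O : Set E} (hO : IsOpen O) {f : E → ℝ} {K : ℝ≥0} (hL : LipschitzWith K (O.indicator f))
    (hf : ∀ x ∈ O, 0 ≤ f x) :
    ∀ᵐ x ∂(volume : Measure E), gradient (O.indicator f) x = O.indicator (gradient f) x := by
  filter_upwards [ae_hg hL] with x hx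
  by_cases h : x ∈ O
  · rw [indicator_of_mem h]
    apply Filter.EventuallyEq.gradient_eq
    filter_upwards [hO.mem_nhds h] with y hy using indicator_of_mem hy f
  · rw [indicator_of_notMem h]
    refine hg_min hx (Eventually.of_forall fun y => ?_)
    rw [indicator_of_notMem h]
    exact indicator_nonneg hf y

theorem ae_grad_trunc {W : E → ℝ} {K : ℝ≥0} (hW : LipschitzWith K W) (ε : ℝ) :
    ∀ᵐ x ∂(volume : Measure E), gradient (fun y => max (W y - ε) 0) x = {y | ε < W y}.indicator (gradient W) x := by
  have hL : LipschitzWith K (fun y => max (W y - ε) 0) := by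
    have := (hW.sub (LipschitzWith.const ε)).max_const 0
    simpa using this
  have e : (fun y => max (W y - ε) 0) = {y | ε < W y}.indicator (fun y => W y - ε) := by
    ext y
    by_cases h : ε < W y
    · rw [indicator_of_mem (by exact h), max_eq_left (by linarith)]
    · rw [indicator_of_notMem (by exact h), max_eq_right (by linarith [not_lt.1 h])]
  have hO : IsOpen {y | ε < W y} := isOpen_lt continuous_const hW.continuous
  rw [e] at hL ⊢
  filter_upwards [ae_grad_ind hO hL (fun x hx => by have : ε < W x := hx; linarith), ae_hg hW] with x h1 h2
  rw [h1]
  by_cases h : x ∈ {y | ε < W y}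
  · rw [indicator_of_mem h, indicator_of_mem h]
    have := hg_add_const (-ε) h2
    simpa [sub_eq_add_neg] using this.gradient
  · rw [indicator_of_notMem h, indicator_of_notMem h]
end ae
end PL
end part2

section part3
open MeasureTheory Metric Set Filter
open scoped RealInnerProductSpace ENNReal Topology NNReal Convolution
namespace PL
section moll
variable {E : Type*} [NormedAddCommGroup E] [InnerProductSpace ℝ E] [FiniteDimensional ℝ E] [MeasurableSpace E] [BorelSpace E]

theorem mollify {W : E → ℝ} {K : ℝ≥0} (hW : LipschitzWith K W) (hcs : HasCompactSupport W) {Ω : Set E}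
    (hΩ : IsOpen Ω) (hs : tsupport W ⊆ Ω) :
    ∃ φ : ℕ → E → ℝ, (∀ n, ContDiff ℝ (⊤ : ℕ∞) (φ n) ∧ HasCompactSupport (φ n) ∧ tsupport (φ n) ⊆ Ω ∧
      LipschitzWith K (φ n)) ∧ (∃ C, ∀ n x, ‖φ n x‖ ≤ C) ∧
      (∀ x, Tendsto (fun n => φ n x) atTop (𝓝 (W x))) ∧
      ∀ᵐ x ∂(volume : Measure E), Tendsto (fun n => gradient (φ n) x) atTop (𝓝 (gradient W x)) := by
  obtain ⟨δ, hδ, hδs⟩ := IsCompact.exists_cthickening_subset_open hcs hΩ hs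
  let b : ℕ → ContDiffBump (0 : E) := fun n =>
    ⟨δ / (2 * (n + 1)), δ / (n + 1), by positivity, by
      apply div_lt_div_of_pos_left hδ (by positivity)
      have : (0:ℝ) ≤ n := Nat.cast_nonneg n
      linarith⟩
  have hbr : ∀ n, (b n).rOut = δ / (n + 1) := fun n => rfl
  have hbi : ∀ n, (b n).rIn = δ / (2 * (n + 1)) := fun n => rfl
  have hb0 : Tendsto (fun n => (b n).rOut) atTop (𝓝 0) := by
    simp_rw [hbr]
    exact tendsto_const_div_atTop_nhds_zero_nat δ |>.comp (tendsto_add_atTop_nat 1) |>.congr (fun n => by simp)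
  have hbK : ∀ᶠ n in atTop, (b n).rOut ≤ 2 * (b n).rIn := by
    filter_upwards with n
    rw [hbr, hbi]
    apply le_of_eq; field_simp
  obtain ⟨C, hC⟩ : ∃ C, ∀ x, ‖W x‖ ≤ C := hcs.exists_bound_of_continuous hW.continuous
  have hWli : LocallyIntegrable W (volume : Measure E) := hW.continuous.locallyIntegrable
  let φ : ℕ → E → ℝ := fun n => ((b n).normed volume ⋆[ContinuousLinearMap.lsmul ℝ ℝ, volume] W)
  have hφ : ∀ n x, φ n x = ∫ y, (b n).normed volume y * W (x - y) := by
    intro n x; rfl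
  have hρc : ∀ n, Continuous ((b n).normed (volume : Measure E)) := fun n => ((b n).contDiff_normed (n := 0)).continuous
  have hρi : ∀ n, Integrable ((b n).normed (volume : Measure E)) := fun n => (b n).integrable_normed
  have hρ0 : ∀ n x, 0 ≤ (b n).normed (volume : Measure E) x := fun n x => (b n).nonneg_normed x
  have hρ1 : ∀ n, ∫ x, (b n).normed (volume : Measure E) x = 1 := fun n => (b n).integral_normed
  have hmeasW : ∀ x : E, AEStronglyMeasurable (fun y => W (x - y)) (volume : Measure E) := fun x =>
    (hW.continuous.comp (by fun_prop : Continuous fun y => x - y)).aestronglyMeasurable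
  have hintg : ∀ n x, Integrable (fun y => (b n).normed (volume : Measure E) y * W (x - y)) := by
    intro n x
    exact (hρi n).mul_bdd (hmeasW x) (Eventually.of_forall fun y => hC _)
  have hLip : ∀ n, LipschitzWith K (φ n) := by
    intro n
    refine LipschitzWith.of_dist_le_mul fun x x' => ?_
    rw [dist_eq_norm, hφ, hφ, ← integral_sub (hintg n x) (hintg n x')]
    refine (norm_integral_le_of_norm_le (g := fun y => (b n).normed (volume : Measure E) y * (K * dist x x'))
      ((hρi n).mul_const _) (Eventually.of_forall fun y => ?_)).trans ?_
    · rw [← mul_sub, norm_mul, Real.norm_of_nonneg (hρ0 n y)]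
      refine mul_le_mul_of_nonneg_left ?_ (hρ0 n y)
      have := hW.dist_le_mul (x - y) (x' - y)
      rwa [dist_eq_norm, dist_sub_right] at this
    · rw [integral_mul_const, hρ1, one_mul]
  have hfd : ∀ n x, HasFDerivAt (φ n) (∫ y, (b n).normed (volume : Measure E) y • fderiv ℝ W (x - y)) x := by
    intro n x
    have := hasFDerivAt_integral_of_dominated_loc_of_lip' (𝕜 := ℝ) (μ := (volume : Measure E))
      (F := fun x y => (b n).normed (volume : Measure E) y * W (x - y)) (x₀ := x)
      (bound := fun y => (b n).normed (volume : Measure E) y * K) (s := univ)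
      (F' := fun y => (b n).normed (volume : Measure E) y • fderiv ℝ W (x - y)) univ_mem
      (fun x _ => (hintg n x).aestronglyMeasurable) (hintg n x) ?_ ?_ ((hρi n).mul_const _) ?_
    · exact this.2
    · exact (hρc n).aestronglyMeasurable.smul
        ((measurable_fderiv ℝ W).comp (by fun_prop : Measurable fun y => x - y)).aestronglyMeasurable
    · filter_upwards with y z _
      rw [← mul_sub, norm_mul, Real.norm_of_nonneg (hρ0 n y), mul_assoc]
      refine mul_le_mul_of_nonneg_left ?_ (hρ0 n y)
      have := hW.dist_le_mul (z - y) (x - y)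
      rwa [dist_sub_right, dist_eq_norm, dist_eq_norm] at this
    · have h1 := (Measure.measurePreserving_sub_left (volume : Measure E) x).quasiMeasurePreserving.ae
        (hW.ae_differentiableAt (μ := (volume : Measure E)))
      filter_upwards [h1] with y hy
      have h2 : HasFDerivAt (fun z => W (z - y)) (fderiv ℝ W (x - y)) x := by
        have := HasFDerivAt.comp x (g := W) (f := fun z => z - y) hy.hasFDerivAt ((hasFDerivAt_id x).sub_const y)
        rwa [ContinuousLinearMap.comp_id] at this
      exact h2.const_mul _
  refine ⟨φ, fun n => ⟨?_, ?_, ?_, hLip n⟩, ⟨C, ?_⟩, ?_, ?_⟩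
  · exact (b n).hasCompactSupport_normed.contDiff_convolution_left _ (b n).contDiff_normed hWli
  · exact (b n).hasCompactSupport_normed.convolution _ hcs
  · refine (closure_minimal ?_ isClosed_cthickening).trans hδs
    intro x hx
    have := support_convolution_subset (L := ContinuousLinearMap.lsmul ℝ ℝ) (μ := volume) (f := (b n).normed volume) (g := W) hx
    obtain ⟨y, hy, z, hz, rfl⟩ := this
    rw [(b n).support_normed_eq, mem_ball_zero_iff, hbr] at hy
    refine mem_cthickening_of_dist_le _ z _ _ (subset_tsupport _ hz) ?_
    simp only [dist_eq_norm, add_sub_cancel_right]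
    refine hy.le.trans (div_le_self hδ.le ?_)
    have : (0:ℝ) ≤ n := Nat.cast_nonneg n
    linarith
  · intro n x
    rw [hφ]
    refine (norm_integral_le_of_norm_le (g := fun y => (b n).normed (volume : Measure E) y * C)
      ((hρi n).mul_const _) (Eventually.of_forall fun y => ?_)).trans ?_
    · rw [norm_mul, Real.norm_of_nonneg (hρ0 n y)]
      exact mul_le_mul_of_nonneg_left (hC _) (hρ0 n y)
    · rw [integral_mul_const, hρ1, one_mul]
  · intro x
    exact ContDiffBump.convolution_tendsto_right_of_continuous hb0 hW.continuous x
  · have hli : LocallyIntegrable (fderiv ℝ W) (volume : Measure E) := by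
      refine LocallyIntegrable.mono (f := fun _ => (K : ℝ)) (locallyIntegrable_const _)
        (measurable_fderiv ℝ W).aestronglyMeasurable (Eventually.of_forall fun x => ?_)
      exact (norm_fderiv_le_of_lipschitz ℝ hW).trans (le_abs_self _)
    filter_upwards [ContDiffBump.ae_convolution_tendsto_right_of_locallyIntegrable hb0 hbK hli] with x hx
    have h3 : ∀ n, gradient (φ n) x = (InnerProductSpace.toDual ℝ E).symm
        (((b n).normed volume ⋆[ContinuousLinearMap.lsmul ℝ ℝ, volume] (fderiv ℝ W)) x) := by
      intro n
      unfold gradient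
      rw [(hfd n x).fderiv]; rfl
    simp_rw [h3]
    exact ((InnerProductSpace.toDual ℝ E).symm.continuous.tendsto _).comp hx
end moll
end PL
end part3

section part4
open MeasureTheory Metric Set Filter
open scoped RealInnerProductSpace ENNReal Topology NNReal
namespace PL
section ab
variable {E : Type*} [NormedAddCommGroup E] [InnerProductSpace ℝ E] [FiniteDimensional ℝ E] [MeasurableSpace E] [BorelSpace E]

theorem integ_bdd {F : Type*} [NormedAddCommGroup F] {f : E → F} (hm : AEStronglyMeasurable f (volume : Measure E)) {C : ℝ}
    (hb : ∀ x, ‖f x‖ ≤ C) {S : Set E} (hS : Bornology.IsBounded S) (hz : ∀ x, x ∉ S → f x = 0) : Integrable f := by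
  have h1 : IntegrableOn f (closure S) := by
    refine Measure.integrableOn_of_bounded (M := C) hS.isCompact_closure.measure_lt_top.ne hm ?_
    exact Eventually.of_forall hb
  refine (integrableOn_iff_integrable_of_support_subset ?_).1 h1
  intro x hx
  by_contra h
  exact hx (hz x fun h' => h (subset_closure h'))

theorem dct_bdd {ι : Type*} {l : Filter ι} [l.IsCountablyGenerated] {F : ι → E → ℝ} {f : E → ℝ}
    {S : Set E} (hS : Bornology.IsBounded S) (C : ℝ)
    (hm : ∀ᶠ n in l, AEStronglyMeasurable (F n) (volume : Measure E))
    (hb : ∀ᶠ n in l, ∀ x, ‖F n x‖ ≤ C) (hz : ∀ᶠ n in l, ∀ x, x ∉ S → F n x = 0)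
    (hl : ∀ᵐ x ∂(volume : Measure E), Tendsto (fun n => F n x) l (𝓝 (f x))) :
    Tendsto (fun n => ∫ x, F n x) l (𝓝 (∫ x, f x)) := by
  refine tendsto_integral_filter_of_dominated_convergence ((closure S).indicator fun _ => |C|) hm ?_ ?_ hl
  · filter_upwards [hb, hz] with n h1 h2
    refine Eventually.of_forall fun x => ?_
    by_cases h : x ∈ closure S
    · rw [indicator_of_mem h]; exact (h1 x).trans (le_abs_self C)
    · rw [indicator_of_notMem h, h2 x fun h' => h (subset_closure h')]; simp
  · rw [integrable_indicator_iff isClosed_closure.measurableSet]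
    exact integrableOn_const (hS.isCompact_closure.measure_lt_top.ne)

theorem lip_bdd {W : E → ℝ} {K : ℝ≥0} (hW : LipschitzWith K W) {Ω : Set E} (hb : Bornology.IsBounded Ω)
    (hz : ∀ x, x ∉ Ω → W x = 0) : ∃ C, ∀ x, ‖W x‖ ≤ C := by
  have : HasCompactSupport W := HasCompactSupport.intro hb.isCompact_closure
    (fun x hx => hz x fun h => hx (subset_closure h))
  exact this.exists_bound_of_continuous hW.continuous

theorem grad_zero_off {W : E → ℝ} {Ω : Set E} (hz : ∀ x, x ∉ Ω → W x = 0) {x : E} (hx : x ∉ closure Ω) :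
    gradient W x = 0 := by
  have : W =ᶠ[𝓝 x] fun _ => 0 := by
    filter_upwards [isClosed_closure.isOpen_compl.mem_nhds hx] with y hy
    exact hz y fun h => hy (subset_closure h)
  rw [this.gradient_eq]
  exact gradient_const x 0

theorem approx_induct {Ω : Set E} (hΩ : IsOpen Ω) (hb : Bornology.IsBounded Ω) (P : (E → ℝ) → Prop)
    (hP0 : ∀ φ : E → ℝ, ContDiff ℝ (⊤ : ℕ∞) φ → HasCompactSupport φ → tsupport φ ⊆ Ω → P φ)
    (hcl : ∀ (F : ℕ → E → ℝ) (W : E → ℝ) (K : ℝ≥0) (C : ℝ), (∀ n, LipschitzWith K (F n)) →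
      (∀ n x, ‖F n x‖ ≤ C) → (∀ n x, x ∉ Ω → F n x = 0) → LipschitzWith K W →
      (∀ x, x ∉ Ω → W x = 0) → (∀ x, Tendsto (fun n => F n x) atTop (𝓝 (W x))) →
      (∀ᵐ x ∂(volume : Measure E), Tendsto (fun n => gradient (F n) x) atTop (𝓝 (gradient W x))) →
      (∀ n, P (F n)) → P W)
    {W : E → ℝ} {K : ℝ≥0} (hW : LipschitzWith K W) (h0 : ∀ x, 0 ≤ W x) (hz : ∀ x, x ∉ Ω → W x = 0) : P W := by
  have hcs : HasCompactSupport W := HasCompactSupport.intro hb.isCompact_closure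
    (fun x hx => hz x fun h => hx (subset_closure h))
  obtain ⟨C, hC⟩ := lip_bdd hW hb hz
  set ε : ℕ → ℝ := fun n => 1 / ((n : ℝ) + 1) with hε
  have hε0 : ∀ n, 0 < ε n := fun n => by positivity
  have hεt : Tendsto ε atTop (𝓝 0) := tendsto_one_div_add_atTop_nhds_zero_nat
  set T : ℕ → E → ℝ := fun n y => max (W y - ε n) 0 with hT
  have hTL : ∀ n, LipschitzWith K (T n) := by
    intro n
    have := (hW.sub (LipschitzWith.const (ε n))).max_const 0
    simpa using this
  have hT0 : ∀ n x, x ∉ Ω → T n x = 0 := by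
    intro n x hx
    simp only [hT, hz x hx]
    exact max_eq_right (by linarith [hε0 n])
  have hTs : ∀ n, tsupport (T n) ⊆ Ω := by
    intro n
    have : tsupport (T n) ⊆ {x | ε n ≤ W x} := by
      refine closure_minimal ?_ (isClosed_le continuous_const hW.continuous)
      intro x hx
      by_contra h
      apply hx
      simp only [mem_setOf_eq, not_le] at h
      exact max_eq_right (by linarith)
    refine this.trans fun x hx => ?_
    by_contra h
    have := hz x h
    simp only [mem_setOf_eq] at hx
    linarith [hε0 n]
  have hTc : ∀ n, HasCompactSupport (T n) := fun n => HasCompactSupport.intro hb.isCompact_closure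
    (fun x hx => hT0 n x fun h => hx (subset_closure h))
  refine hcl T W K C hTL ?_ hT0 hW hz ?_ ?_ ?_
  · intro n x
    refine le_trans ?_ (hC x)
    rw [Real.norm_of_nonneg (le_max_right _ _), Real.norm_of_nonneg (h0 x)]
    exact max_le (by linarith [hε0 n]) (h0 x)
  · intro x
    have : Tendsto (fun n => max (W x - ε n) 0) atTop (𝓝 (max (W x - 0) 0)) :=
      (tendsto_const_nhds.sub hεt).max tendsto_const_nhds
    simpa [max_eq_left (h0 x)] using this
  · have h1 : ∀ᵐ x ∂(volume : Measure E), ∀ n, gradient (T n) x = {y | ε n < W y}.indicator (gradient W) x :=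
      ae_all_iff.2 fun n => ae_grad_trunc hW (ε n)
    filter_upwards [h1, ae_hg hW] with x hx hg
    simp_rw [hx]
    rcases (h0 x).eq_or_lt with h | h
    · have : gradient W x = 0 := hg_min hg (Eventually.of_forall fun y => by rw [← h]; exact h0 y)
      rw [this]
      refine tendsto_const_nhds.congr fun n => ?_
      by_cases hh : x ∈ {y | ε n < W y} <;> simp [hh, this]
    · refine tendsto_const_nhds.congr' ?_
      filter_upwards [hεt.eventually_lt_const h] with n hn
      rw [indicator_of_mem]; exact hn
  · intro n
    obtain ⟨φ, h1, ⟨C', hC'⟩, h3, h4⟩ := mollify (hTL n) (hTc n) hΩ (hTs n)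
    refine hcl φ (T n) K C' (fun n => (h1 n).2.2.2) hC' ?_ (hTL n) (hT0 n) h3 h4 ?_
    · intro m x hx
      by_contra h
      exact hx ((h1 m).2.2.1 (subset_tsupport _ h))
    · intro m
      exact hP0 _ (h1 m).1 (h1 m).2.1 (h1 m).2.2.1

end ab

section AB
variable {N : ℕ}

theorem lam1_nonneg {p : ℝ} (Ω : Set (EuclideanSpace ℝ (Fin N))) : 0 ≤ lam1 p Ω := by
  apply Real.sInf_nonneg
  rintro r ⟨u, -, -, -, -, rfl⟩
  apply div_nonneg
  · exact integral_nonneg fun x => Real.rpow_nonneg (norm_nonneg _) _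
  · exact integral_nonneg fun x => Real.rpow_nonneg (abs_nonneg _) _

theorem lemA {p : ℝ} (hp : 1 < p) {Ω : Set (EuclideanSpace ℝ (Fin N))} (hΩ : IsOpen Ω) (hb : Bornology.IsBounded Ω)
    {W : (EuclideanSpace ℝ (Fin N)) → ℝ} {K : ℝ≥0} (hW : LipschitzWith K W) (h0 : ∀ x, 0 ≤ W x) (hz : ∀ x, x ∉ Ω → W x = 0) :
    lam1 p Ω * ∫ x, |W x| ^ p ≤ ∫ x, ‖gradient W x‖ ^ p := by
  have hp0 : 0 ≤ p := by linarith
  have hp1 : p ≠ 0 := by linarith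
  refine approx_induct hΩ hb (fun W => lam1 p Ω * ∫ x, |W x| ^ p ≤ ∫ x, ‖gradient W x‖ ^ p) ?_ ?_ hW h0 hz
  · intro φ h1 h2 h3
    have hz1 : ∀ x, x ∉ Ω → φ x = 0 := fun x hx => by
      by_contra h; exact hx (h3 (subset_tsupport _ h))
    have hz2 : ∀ x, x ∉ Ω → gradient φ x = 0 := fun x hx =>
      grad_zero_off (Ω := Function.support φ) (fun y hy => by simpa using hy) (fun h => hx (h3 h))
    have e1 : ∫ x in Ω, ‖gradient φ x‖ ^ p = ∫ x, ‖gradient φ x‖ ^ p :=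
      setIntegral_eq_integral_of_forall_compl_eq_zero fun x hx => by simp [hz2 x hx, hp1]
    have e2 : ∫ x in Ω, |φ x| ^ p = ∫ x, |φ x| ^ p :=
      setIntegral_eq_integral_of_forall_compl_eq_zero fun x hx => by simp [hz1 x hx, hp1]
    have hA : 0 ≤ ∫ x, ‖gradient φ x‖ ^ p := integral_nonneg fun x => Real.rpow_nonneg (norm_nonneg _) _
    have hB : 0 ≤ ∫ x, |φ x| ^ p := integral_nonneg fun x => Real.rpow_nonneg (abs_nonneg _) _
    by_cases hφ : φ = 0
    · subst hφ
      simpa [hp1] using hA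
    have : lam1 p Ω ≤ (∫ x, ‖gradient φ x‖ ^ p) / (∫ x, |φ x| ^ p) := by
      rw [← e1, ← e2]
      refine csInf_le ⟨0, ?_⟩ ⟨φ, h1, hφ, h2, h3, rfl⟩
      rintro r ⟨u, -, -, -, -, rfl⟩
      apply div_nonneg
      · exact integral_nonneg fun x => Real.rpow_nonneg (norm_nonneg _) _
      · exact integral_nonneg fun x => Real.rpow_nonneg (abs_nonneg _) _
    rcases hB.eq_or_lt with h | h
    · rw [← h]; simpa using hA
    · exact (le_div_iff₀ h).1 this
  · intro F W K C hF hC hFz hW hWz ht hg hP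
    have t1 : Tendsto (fun n => ∫ x, |F n x| ^ p) atTop (𝓝 (∫ x, |W x| ^ p)) := by
      refine dct_bdd hb (C ^ p) ?_ ?_ ?_ ?_
      · exact Eventually.of_forall fun n =>
          ((hF n).continuous.abs.rpow_const fun x => Or.inr hp0).aestronglyMeasurable
      · refine Eventually.of_forall fun n x => ?_
        rw [Real.norm_of_nonneg (by positivity)]
        exact Real.rpow_le_rpow (abs_nonneg _) (hC n x) hp0
      · exact Eventually.of_forall fun n x hx => by simp [hFz n x hx, hp1]
      · exact Eventually.of_forall fun x => ((ht x).abs).rpow_const (Or.inr hp0)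
    have t2 : Tendsto (fun n => ∫ x, ‖gradient (F n) x‖ ^ p) atTop (𝓝 (∫ x, ‖gradient W x‖ ^ p)) := by
      refine dct_bdd hb.closure ((K : ℝ) ^ p) ?_ ?_ ?_ ?_
      · exact Eventually.of_forall fun n =>
          ((measurable_gradient (F n)).norm.pow_const p).aestronglyMeasurable
      · refine Eventually.of_forall fun n x => ?_
        rw [Real.norm_of_nonneg (by positivity)]
        exact Real.rpow_le_rpow (norm_nonneg _) (norm_gradient_le (hF n) x) hp0
      · exact Eventually.of_forall fun n x hx => by simp [grad_zero_off (hFz n) hx, hp1]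
      · filter_upwards [hg] with x hx using hx.norm.rpow_const (Or.inr hp0)
    exact le_of_tendsto_of_tendsto' (t1.const_mul _) t2 hP

theorem lemB {p : ℝ} (hp : 1 < p) {Ω : Set (EuclideanSpace ℝ (Fin N))} (hΩ : IsOpen Ω) (hb : Bornology.IsBounded Ω) {lam : ℝ}
    {u : (EuclideanSpace ℝ (Fin N)) → ℝ} (hu : ContDiff ℝ 1 u)
    (hw : ∀ φ : (EuclideanSpace ℝ (Fin N)) → ℝ, ContDiff ℝ (⊤ : ℕ∞) φ → HasCompactSupport φ → tsupport φ ⊆ Ω →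
      ∫ x in Ω, ‖gradient u x‖ ^ (p - 2) * ⟪gradient u x, gradient φ x⟫ =
      lam * ∫ x in Ω, (u x) ^ (p - 1) * φ x)
    {W : (EuclideanSpace ℝ (Fin N)) → ℝ} {K : ℝ≥0} (hW : LipschitzWith K W) (h0 : ∀ x, 0 ≤ W x) (hz : ∀ x, x ∉ Ω → W x = 0) :
    ∫ x, ⟪flux p (gradient u x), gradient W x⟫ = lam * ∫ x, (u x) ^ (p - 1) * W x := by
  have hp0 : 0 ≤ p - 1 := by linarith
  have hAc : Continuous fun x => flux p (gradient u x) := (continuous_flux hp).comp (continuous_gradient hu)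
  have huc : Continuous fun x => (u x) ^ (p - 1) := hu.continuous.rpow_const fun x => Or.inr hp0
  obtain ⟨M1, hM1⟩ := hb.isCompact_closure.exists_bound_of_continuousOn hAc.continuousOn
  obtain ⟨M2, hM2⟩ := hb.isCompact_closure.exists_bound_of_continuousOn huc.continuousOn
  refine approx_induct hΩ hb (fun W => ∫ x, ⟪flux p (gradient u x), gradient W x⟫ = lam * ∫ x, (u x) ^ (p - 1) * W x)
    ?_ ?_ hW h0 hz
  · intro φ h1 h2 h3
    have hz1 : ∀ x, x ∉ Ω → φ x = 0 := fun x hx => by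
      by_contra h; exact hx (h3 (subset_tsupport _ h))
    have hz2 : ∀ x, x ∉ Ω → gradient φ x = 0 := fun x hx =>
      grad_zero_off (Ω := Function.support φ) (fun y hy => by simpa using hy) (fun h => hx (h3 h))
    have := hw φ h1 h2 h3
    rw [setIntegral_eq_integral_of_forall_compl_eq_zero fun x hx => by simp [hz2 x hx],
      setIntegral_eq_integral_of_forall_compl_eq_zero fun x hx => by simp [hz1 x hx]] at this
    rw [← this]
    congr 1; ext x
    rw [flux, real_inner_smul_left]
  · intro F W K C hF hC hFz hW hWz ht hg hP
    have t1 : Tendsto (fun n => ∫ x, (u x) ^ (p - 1) * F n x) atTop (𝓝 (∫ x, (u x) ^ (p - 1) * W x)) := by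
      refine dct_bdd hb (|M2| * |C|) ?_ ?_ ?_ ?_
      · exact Eventually.of_forall fun n => (huc.mul (hF n).continuous).aestronglyMeasurable
      · refine Eventually.of_forall fun n x => ?_
        by_cases hx : x ∈ closure Ω
        · rw [norm_mul]
          exact mul_le_mul ((hM2 x hx).trans (le_abs_self _)) ((hC n x).trans (le_abs_self _)) (norm_nonneg _) (abs_nonneg _)
        · rw [hFz n x fun h => hx (subset_closure h)]; simp; positivity
      · exact Eventually.of_forall fun n x hx => by simp [hFz n x hx]
      · exact Eventually.of_forall fun x => (ht x).const_mul _
    have t2 : Tendsto (fun n => ∫ x, ⟪flux p (gradient u x), gradient (F n) x⟫) atTop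
        (𝓝 (∫ x, ⟪flux p (gradient u x), gradient W x⟫)) := by
      refine dct_bdd hb.closure (|M1| * K) ?_ ?_ ?_ ?_
      · exact Eventually.of_forall fun n =>
          (hAc.aestronglyMeasurable.inner (measurable_gradient (F n)).aestronglyMeasurable)
      · refine Eventually.of_forall fun n x => ?_
        by_cases hx : x ∈ closure Ω
        · refine (norm_inner_le_norm _ _).trans ?_
          exact mul_le_mul ((hM1 x hx).trans (le_abs_self _)) (norm_gradient_le (hF n) x) (norm_nonneg _) (abs_nonneg _)
        · rw [grad_zero_off (hFz n) hx]; simp; positivity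
      · exact Eventually.of_forall fun n x hx => by simp [grad_zero_off (hFz n) hx]
      · filter_upwards [hg] with x hx using tendsto_const_nhds.inner hx
    have := t1.const_mul lam
    simp_rw [← hP] at this
    exact tendsto_nhds_unique t2 this

end AB
end PL
end part4

section part5
open MeasureTheory Metric Set Filter
open scoped RealInnerProductSpace ENNReal Topology NNReal
namespace PL
section eul
variable {E : Type*} [NormedAddCommGroup E] [InnerProductSpace ℝ E] [FiniteDimensional ℝ E] [MeasurableSpace E] [BorelSpace E]

theorem euler_lip {W : E → ℝ} {K : ℝ≥0} (hW : LipschitzWith K W) {Ω : Set E} (hb : Bornology.IsBounded Ω)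
    (hz : ∀ x, x ∉ Ω → W x = 0) (c : E) :
    ∫ x, ⟪gradient W x, x - c⟫ = - (Module.finrank ℝ E : ℝ) * ∫ x, W x := by
  have hcs : HasCompactSupport W := HasCompactSupport.intro hb.isCompact_closure
    (fun x hx => hz x fun h => hx (subset_closure h))
  set b := stdOrthonormalBasis ℝ E with hbdef
  have hWi : Integrable W := hW.continuous.integrable_of_hasCompactSupport hcs
  have h1 : ∀ i, ∫ x, W x = - ∫ x, ⟪gradient W x, b i⟫ * ⟪b i, x - c⟫ := by
    intro i
    have hL : LipschitzWith 1 (fun x => ⟪b i, x - c⟫) := by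
      refine LipschitzWith.of_dist_le_mul fun x y => ?_
      rw [Real.dist_eq, ← inner_sub_right, sub_sub_sub_cancel_right, dist_eq_norm]
      refine (abs_real_inner_le_norm _ _).trans ?_
      simp
    have := LipschitzWith.integral_lineDeriv_mul_eq (μ := (volume : Measure E)) hL hW hcs (b i)
    have e1 : ∀ x, lineDeriv ℝ (fun x => ⟪b i, x - c⟫) x (b i) = 1 := by
      intro x
      have h : HasGradientAt (fun x => ⟪b i, x - c⟫) (b i) x := by
        have := hg_inner (b i) x ⟪b i, c⟫
        simpa only [← inner_sub_right] using this
      rw [h.differentiableAt.lineDeriv_eq_fderiv, h.hasFDerivAt.fderiv]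
      simp
    simp_rw [e1, one_mul] at this
    rw [this, ← integral_neg]
    refine integral_congr_ae ?_
    filter_upwards [ae_hg hW] with x hx
    rw [hx.differentiableAt.lineDeriv_eq_fderiv, hx.hasFDerivAt.fderiv]
    simp
  have hgi : ∀ i, Integrable (fun x => ⟪gradient W x, b i⟫ * ⟪b i, x - c⟫) := by
    intro i
    obtain ⟨M, hM⟩ := hb.isCompact_closure.exists_bound_of_continuousOn
      (f := fun x => ⟪b i, x - c⟫) (by fun_prop)
    refine integ_bdd (C := K * |M|) ?_ ?_ hb.closure ?_
    · exact ((measurable_gradient W).aestronglyMeasurable.inner_const).mul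
        (by fun_prop : Continuous fun x => ⟪b i, x - c⟫).aestronglyMeasurable
    · intro x
      by_cases hx : x ∈ closure Ω
      · rw [norm_mul]
        refine mul_le_mul ?_ ((hM x hx).trans (le_abs_self _)) (norm_nonneg _) (by positivity)
        refine (norm_inner_le_norm _ _).trans ?_
        simpa using norm_gradient_le hW x
      · rw [grad_zero_off hz hx]; simp; positivity
    · intro x hx; rw [grad_zero_off hz hx]; simp
  have h2 : ∫ x, ⟪gradient W x, x - c⟫ = ∑ i, ∫ x, ⟪gradient W x, b i⟫ * ⟪b i, x - c⟫ := by
    rw [← integral_finsetSum _ fun i _ => hgi i]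
    congr 1; ext x
    exact (b.sum_inner_mul_inner _ _).symm
  rw [h2]
  have : ∀ i, ∫ x, ⟪gradient W x, b i⟫ * ⟪b i, x - c⟫ = - ∫ x, W x := fun i => by rw [h1 i]; simp
  simp_rw [this]
  simp

theorem setInt_eq {O : Set E} (hO : IsOpen O) (f : E → ℝ) : ∫ x in O, f x = ∫ x, O.indicator f x :=
  (integral_indicator hO.measurableSet).symm

/-- Euler identity for functions vanishing on the boundary. -/
theorem euler {O V : Set E} (hO : IsOpen O) (hb : Bornology.IsBounded O) (hV : IsOpen V) (hOV : closure O ⊆ V)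
    {f : E → ℝ} (hf : ContDiffOn ℝ 1 f V) (hz : ∀ x ∈ frontier O, f x = 0) (h0 : ∀ x ∈ O, 0 ≤ f x) (c : E) :
    ∫ x in O, ⟪gradient f x, x - c⟫ = - (Module.finrank ℝ E : ℝ) * ∫ x in O, f x := by
  obtain ⟨K, hK⟩ := lip_indicator' hO hb hV hOV hf hz
  have := euler_lip hK hb (fun x hx => indicator_of_notMem hx f) c
  rw [setInt_eq hO, setInt_eq hO, ← this]
  refine integral_congr_ae ?_
  filter_upwards [ae_grad_ind hO hK h0] with x hx
  rw [hx]
  by_cases h : x ∈ O <;> simp [h]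

/-- Global weak supersolution identity. -/
structure Eig (p lam : ℝ) (Ω : Set E) (u : E → ℝ) : Prop where
  c1 : ContDiff ℝ 1 u
  weak : ∀ (W : E → ℝ) (K : ℝ≥0), LipschitzWith K W → (∀ x, 0 ≤ W x) → (∀ x, x ∉ Ω → W x = 0) →
    ∫ x, ⟪flux p (gradient u x), gradient W x⟫ = lam * ∫ x, (u x) ^ (p - 1) * W x

theorem Eig.test {p lam : ℝ} {Ω : Set E} {u : E → ℝ} (hu : Eig p lam Ω u)
    {O V : Set E} (hO : IsOpen O) (hOΩ : O ⊆ Ω) (hb : Bornology.IsBounded O) (hV : IsOpen V) (hOV : closure O ⊆ V)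
    {f : E → ℝ} (hf : ContDiffOn ℝ 1 f V) (hz : ∀ x ∈ frontier O, f x = 0) (h0 : ∀ x ∈ O, 0 ≤ f x) :
    ∫ x in O, ⟪flux p (gradient u x), gradient f x⟫ = lam * ∫ x in O, (u x) ^ (p - 1) * f x := by
  obtain ⟨K, hK⟩ := lip_indicator' hO hb hV hOV hf hz
  have := hu.weak _ K hK (indicator_nonneg h0) (fun x hx => indicator_of_notMem (fun h => hx (hOΩ h)) f)
  rw [setInt_eq hO, setInt_eq hO]
  have e1 : ∀ x, O.indicator (fun x => u x ^ (p - 1) * f x) x = u x ^ (p - 1) * O.indicator f x := by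
    intro x; by_cases h : x ∈ O <;> simp [h]
  simp_rw [e1]
  rw [← this]
  refine integral_congr_ae ?_
  filter_upwards [ae_grad_ind hO hK h0] with x hx
  rw [hx]
  by_cases h : x ∈ O <;> simp [h]

/-- Linear reflection. -/
noncomputable def Rf (e v : E) : E := v - (2 * ⟪e, v⟫) • e
/-- Affine reflection. -/
noncomputable def sg (e : E) (s : ℝ) (x : E) : E := x - (2 * (⟪e, x⟫ - s)) • e

end eul

section refl
variable {E : Type*} [NormedAddCommGroup E] [InnerProductSpace ℝ E]

theorem ee {e : E} (he : ‖e‖ = 1) : ⟪e, e⟫ = 1 := by rw [real_inner_self_eq_norm_sq, he]; norm_num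

theorem Rf_inner {e : E} (he : ‖e‖ = 1) (a b : E) : ⟪Rf e a, Rf e b⟫ = ⟪a, b⟫ := by
  simp only [Rf, inner_sub_left, inner_sub_right, real_inner_smul_left, real_inner_smul_right, ee he,
    real_inner_comm e a]
  ring

theorem Rf_norm {e : E} (he : ‖e‖ = 1) (a : E) : ‖Rf e a‖ = ‖a‖ := by
  rw [norm_eq_sqrt_real_inner, Rf_inner he, ← norm_eq_sqrt_real_inner]

theorem Rf_Rf {e : E} (he : ‖e‖ = 1) (a : E) : Rf e (Rf e a) = a := by
  simp only [Rf, inner_sub_right, real_inner_smul_right, ee he]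
  module

theorem Rf_smul (e : E) (t : ℝ) (a : E) : Rf e (t • a) = t • Rf e a := by
  simp only [Rf, real_inner_smul_right]; module

theorem Rf_symm {e : E} (he : ‖e‖ = 1) (a b : E) : ⟪Rf e a, b⟫ = ⟪a, Rf e b⟫ := by
  conv_lhs => rw [← Rf_Rf he b]
  exact Rf_inner he _ _

theorem inner_Rf {e : E} (he : ‖e‖ = 1) (a : E) : ⟪e, Rf e a⟫ = - ⟪e, a⟫ := by
  simp only [Rf, inner_sub_right, real_inner_smul_right, ee he]; ring

theorem flux_Rf {e : E} (he : ‖e‖ = 1) (p : ℝ) (a : E) : flux p (Rf e a) = Rf e (flux p a) := by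
  rw [flux, flux, Rf_smul, Rf_norm he]

theorem sg_sub {e : E} (he : ‖e‖ = 1) (s : ℝ) (x : E) : sg e s x - s • e = Rf e (x - s • e) := by
  simp only [sg, Rf, inner_sub_right, real_inner_smul_right, ee he]; module

theorem norm_sg_sub {e : E} (he : ‖e‖ = 1) (s : ℝ) (x : E) : ‖sg e s x - s • e‖ = ‖x - s • e‖ := by
  rw [sg_sub he, Rf_norm he]

theorem sg_sg {e : E} (he : ‖e‖ = 1) (s : ℝ) (x : E) : sg e s (sg e s x) = x := by
  simp only [sg, inner_sub_right, real_inner_smul_right, ee he]; module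

theorem inner_sg {e : E} (he : ‖e‖ = 1) (s : ℝ) (x : E) : ⟪e, sg e s x⟫ - s = - (⟪e, x⟫ - s) := by
  simp only [sg, inner_sub_right, real_inner_smul_right, ee he]; ring

theorem norm_sg_sq {e : E} (he : ‖e‖ = 1) (s : ℝ) (x : E) :
    ‖sg e s x‖ ^ 2 = ‖x‖ ^ 2 - 4 * (⟪e, x⟫ - s) * s := by
  rw [← real_inner_self_eq_norm_sq, ← real_inner_self_eq_norm_sq]
  simp only [sg, inner_sub_left, inner_sub_right, real_inner_smul_left, real_inner_smul_right, ee he,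
    real_inner_comm e x]
  ring

theorem contDiff_sg (e : E) (s : ℝ) : ContDiff ℝ 1 (sg e s) := by
  unfold sg
  have : ContDiff ℝ 1 (fun x : E => ⟪e, x⟫) := contDiff_const.inner ℝ contDiff_id
  fun_prop

theorem dist_sg {e : E} (he : ‖e‖ = 1) (s : ℝ) (x y : E) : dist (sg e s x) (sg e s y) = dist x y := by
  rw [dist_eq_norm, dist_eq_norm, ← Rf_norm he (x - y)]
  congr 1
  simp only [sg, Rf, inner_sub_right]; module
end refl

section refl2
variable {E : Type*} [NormedAddCommGroup E] [InnerProductSpace ℝ E] [FiniteDimensional ℝ E] [MeasurableSpace E] [BorelSpace E]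

theorem hg_sg {e : E} (he : ‖e‖ = 1) (s : ℝ) {f : E → ℝ} {a x : E} (hf : HasGradientAt f a (sg e s x)) :
    HasGradientAt (fun y => f (sg e s y)) (Rf e a) x := by
  rw [hasGradientAt_iff_hasFDerivAt] at *
  have h1 : HasFDerivAt (sg e s) (ContinuousLinearMap.id ℝ E - ((2 : ℝ) • (innerSL ℝ e)).smulRight e) x := by
    have h := (((innerSL ℝ e).hasFDerivAt (x := x)).sub_const s).const_mul 2
    exact (hasFDerivAt_id x).sub (h.smul_const e)
  have := HasFDerivAt.comp x (g := f) (f := sg e s) hf h1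
  refine this.congr_fderiv ?_
  ext v
  simp [Rf, real_inner_comm e a, inner_sub_left, inner_sub_right, real_inner_smul_left, real_inner_smul_right]
  ring

theorem grad_sg {e : E} (he : ‖e‖ = 1) (s : ℝ) (f : E → ℝ) (x : E) :
    gradient (fun y => f (sg e s y)) x = Rf e (gradient f (sg e s x)) := by
  by_cases h : DifferentiableAt ℝ f (sg e s x)
  · exact (hg_sg he s h.hasGradientAt).gradient
  · have h2 : ¬ DifferentiableAt ℝ (fun y => f (sg e s y)) x := by
      intro h2
      apply h
      have : DifferentiableAt ℝ (fun y => f (sg e s y)) (sg e s (sg e s x)) := by rwa [sg_sg he]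
      have := (hg_sg he s this.hasGradientAt).differentiableAt
      simpa only [sg_sg he] using this
    rw [gradient, gradient, fderiv_zero_of_not_differentiableAt h, fderiv_zero_of_not_differentiableAt h2]
    simp [Rf]

theorem sg_mp {e : E} (he : ‖e‖ = 1) (s : ℝ) : MeasurePreserving (sg e s) (volume : Measure E) volume := by
  let I : E ≃ₗᵢ[ℝ] E :=
    { toFun := Rf e, invFun := Rf e, left_inv := Rf_Rf he, right_inv := Rf_Rf he,
      map_add' := fun a b => by simp only [Rf, inner_add_right]; module
      map_smul' := fun t a => Rf_smul e t a
      norm_map' := Rf_norm he }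
  have h1 := (measurePreserving_add_right (volume : Measure E) ((2 * s) • e)).comp I.measurePreserving
  have h2 : sg e s = (fun x => x + (2 * s) • e) ∘ ⇑I := by
    funext x
    change sg e s x = Rf e x + (2 * s) • e
    simp only [sg, Rf]; module
  rw [h2]
  exact h1

theorem int_sg {e : E} (he : ‖e‖ = 1) (s : ℝ) (f : E → ℝ) : ∫ x, f (sg e s x) = ∫ x, f x := by
  let H : E ≃ₜ E := ⟨⟨sg e s, sg e s, sg_sg he s, sg_sg he s⟩, (contDiff_sg e s).continuous, (contDiff_sg e s).continuous⟩
  exact (sg_mp he s).integral_comp H.measurableEmbedding f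

theorem Eig.refl {p lam : ℝ} {Ω : Set E} {u : E → ℝ} (hu : Eig p lam Ω u) {e : E} (he : ‖e‖ = 1) (s : ℝ) :
    Eig p lam (sg e s ⁻¹' Ω) (fun x => u (sg e s x)) := by
  refine ⟨hu.c1.comp (contDiff_sg e s), ?_⟩
  intro W K hW h0 hz
  have hW' : LipschitzWith K (fun x => W (sg e s x)) := by
    refine LipschitzWith.of_dist_le_mul fun x y => ?_
    rw [← dist_sg he s x y]
    exact hW.dist_le_mul _ _
  have := hu.weak (fun x => W (sg e s x)) K hW' (fun x => h0 _)
    (fun x hx => hz _ (by simpa [sg_sg he] using hx))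
  rw [← int_sg he s, ← int_sg he s (fun x => u x ^ (p - 1) * _)] at this
  simp_rw [sg_sg he, grad_sg he] at this
  rw [← this]
  congr 1; ext x
  rw [grad_sg he, flux_Rf he, Rf_symm he, sg_sg he]
end refl2
end PL
end part5

section part6
open MeasureTheory Metric Set Filter
open scoped RealInnerProductSpace ENNReal Topology NNReal
namespace PL
section tools
variable {E : Type*} [NormedAddCommGroup E] [InnerProductSpace ℝ E] [FiniteDimensional ℝ E] [MeasurableSpace E] [BorelSpace E]

theorem dct_on {ι : Type*} {l : Filter ι} [l.IsCountablyGenerated] {F : ι → E → ℝ} {f : E → ℝ}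
    {O : Set E} (hO : IsOpen O) (hb : Bornology.IsBounded O) (C : ℝ)
    (hm : ∀ᶠ n in l, ContinuousOn (F n) O)
    (hC : ∀ᶠ n in l, ∀ x ∈ O, ‖F n x‖ ≤ C)
    (hl : ∀ x ∈ O, Tendsto (fun n => F n x) l (𝓝 (f x))) :
    Tendsto (fun n => ∫ x in O, F n x) l (𝓝 (∫ x in O, f x)) := by
  refine tendsto_integral_filter_of_dominated_convergence (fun _ => C) ?_ ?_ ?_ ?_
  · filter_upwards [hm] with n hn using hn.aestronglyMeasurable hO.measurableSet
  · filter_upwards [hC] with n hn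
    exact (ae_restrict_iff' hO.measurableSet).2 (Eventually.of_forall hn)
  · exact integrableOn_const (hb.measure_lt_top.ne)
  · exact (ae_restrict_iff' hO.measurableSet).2 (Eventually.of_forall hl)

theorem int_on {F : Type*} [NormedAddCommGroup F] {O : Set E} (hb : Bornology.IsBounded O) {g : E → F} (hg : ContinuousOn g (closure O)) :
    IntegrableOn g O :=
  (hg.integrableOn_compact hb.isCompact_closure).mono_set subset_closure

theorem int_on_bdd {O : Set E} (hO : IsOpen O) (hb : Bornology.IsBounded O) {g : E → ℝ} (hg : ContinuousOn g O) {C : ℝ}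
    (hC : ∀ x ∈ O, ‖g x‖ ≤ C) : IntegrableOn g O := by
  refine Integrable.mono' (g := fun _ => C) (integrableOn_const hb.measure_lt_top.ne)
    (hg.aestronglyMeasurable hO.measurableSet) ?_
  exact (ae_restrict_iff' hO.measurableSet).2 (Eventually.of_forall hC)

theorem zero_of_int {O : Set E} (hO : IsOpen O) {g : E → ℝ} (hg : ContinuousOn g O) (h0 : ∀ x ∈ O, 0 ≤ g x)
    (hi : IntegrableOn g O) (hz : ∫ x in O, g x ≤ 0) : ∀ x ∈ O, g x = 0 := by
  have h1 : 0 ≤ᵐ[volume.restrict O] g := (ae_restrict_iff' hO.measurableSet).2 (Eventually.of_forall h0)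
  have h2 : ∫ x in O, g x = 0 := le_antisymm hz (integral_nonneg_of_ae h1)
  have h3 := (integral_eq_zero_iff_of_nonneg_ae h1 hi).1 h2
  exact Measure.eqOn_open_of_ae_eq h3 hO hg continuousOn_const

theorem grad_contOn {V : Set E} (hV : IsOpen V) {f : E → ℝ} (hf : ContDiffOn ℝ 1 f V) : ContinuousOn (gradient f) V := by
  unfold gradient
  exact (InnerProductSpace.toDual ℝ E).symm.continuous.comp_continuousOn (hf.continuousOn_fderiv_of_isOpen hV le_rfl)

theorem picone_expand {p : ℝ} (hp : 1 < p) {t : ℝ} (ht : 0 ≤ t) (a b : E) :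
    0 ≤ ‖a‖ ^ p + (p - 1) * (t ^ p * ‖b‖ ^ p) - p * (t ^ (p - 1) * ⟪flux p b, a⟫) ∧
    (‖a‖ ^ p + (p - 1) * (t ^ p * ‖b‖ ^ p) - p * (t ^ (p - 1) * ⟪flux p b, a⟫) = 0 → a = t • b) := by
  have := picone hp a (t • b)
  rw [flux_smul hp ht, real_inner_smul_left, norm_smul, Real.norm_of_nonneg ht, Real.mul_rpow ht (norm_nonneg _)] at this
  exact this

theorem compare {p lam : ℝ} (hp : 1 < p) {U₁ U₂ O : Set E} {u v : E → ℝ} (hu : Eig p lam U₁ u) (hv : Eig p lam U₂ v)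
    (hO : IsOpen O) (hb : Bornology.IsBounded O) (h1 : O ⊆ U₁) (h2 : O ⊆ U₂)
    (hv0 : ∀ x ∈ O, 0 < v x) (huv : ∀ x ∈ O, v x < u x) (hfr : ∀ x ∈ frontier O, u x = v x) :
    ∀ x ∈ O, gradient v x = (v x / u x) • gradient u x := by
  have hp0 : 0 < p := by linarith
  have hp1 : 0 < p - 1 := by linarith
  have huc := hu.c1.continuous
  have hvc := hv.c1.continuous
  have hgu := continuous_gradient hu.c1
  have hgv := continuous_gradient hv.c1
  have hAu : Continuous fun x => flux p (gradient u x) := (continuous_flux hp).comp hgu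
  have hAv : Continuous fun x => flux p (gradient v x) := (continuous_flux hp).comp hgv
  have hclv : ∀ x ∈ closure O, 0 ≤ v x := fun x hx =>
    closure_minimal (fun y hy => (hv0 y hy).le) (isClosed_le continuous_const hvc) hx
  have hcluv : ∀ x ∈ closure O, v x ≤ u x := fun x hx =>
    closure_minimal (fun y hy => (huv y hy).le) (isClosed_le hvc huc) hx
  obtain ⟨M, hM⟩ := hb.isCompact_closure.exists_bound_of_continuousOn huc.continuousOn
  obtain ⟨B, hB⟩ := hb.isCompact_closure.exists_bound_of_continuousOn
    (f := fun x => ‖gradient v x‖ ^ p + (p - 1) * ‖gradient u x‖ ^ p + p * (‖flux p (gradient u x)‖ * ‖gradient v x‖))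
    (by
      have a1 := hgu.norm.rpow_const fun x => Or.inr hp0.le
      have a2 := hgv.norm.rpow_const fun x => Or.inr hp0.le
      have a3 := hAu.norm
      have a4 := hgv.norm
      exact Continuous.continuousOn (by fun_prop))
  set P : ℝ → E → ℝ := fun ε x => ‖gradient v x‖ ^ p + (p - 1) * (((v x + ε) / (u x + ε)) ^ p * ‖gradient u x‖ ^ p)
    - p * (((v x + ε) / (u x + ε)) ^ (p - 1) * ⟪flux p (gradient u x), gradient v x⟫) with hP
  set H : ℝ → E → ℝ := fun ε x => (u x) ^ (p - 1) * (u x + ε - (v x + ε) ^ p * (u x + ε) ^ (1 - p))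
    - (v x) ^ (p - 1) * ((u x + ε) ^ p * (v x + ε) ^ (1 - p) - (v x + ε)) with hH
  have hPc : ∀ ε, 0 ≤ ε → ContinuousOn (P ε) O := by
    intro ε hε
    have hne : ∀ x ∈ O, u x + ε ≠ 0 := fun x hx => by linarith [hv0 x hx, huv x hx]
    have ht : ContinuousOn (fun x => (v x + ε) / (u x + ε)) O :=
      ((hvc.add continuous_const).continuousOn).div ((huc.add continuous_const).continuousOn) hne
    have a1 := hgu.norm.rpow_const fun x => Or.inr hp0.le
    have a2 := hgv.norm.rpow_const fun x => Or.inr hp0.le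
    have a3 : Continuous fun x => ⟪flux p (gradient u x), gradient v x⟫ := hAu.inner hgv
    have t1 := ht.rpow_const (p := p) fun x _ => Or.inr hp0.le
    have t2 := ht.rpow_const (p := p - 1) fun x _ => Or.inr hp1.le
    exact (a2.continuousOn.add (continuousOn_const.mul (t1.mul a1.continuousOn))).sub
      (continuousOn_const.mul (t2.mul a3.continuousOn))
  have hPn : ∀ ε, 0 ≤ ε → ∀ x ∈ O, 0 ≤ P ε x := fun ε hε x hx =>
    (picone_expand hp (div_nonneg (by linarith [hv0 x hx]) (by linarith [hv0 x hx, huv x hx])) _ _).1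
  have hPb : ∀ ε, 0 ≤ ε → ∀ x ∈ O, ‖P ε x‖ ≤ B := by
    intro ε hε x hx
    have ht0 : 0 ≤ (v x + ε) / (u x + ε) := div_nonneg (by linarith [hv0 x hx]) (by linarith [hv0 x hx, huv x hx])
    have ht1 : (v x + ε) / (u x + ε) ≤ 1 := by
      rw [div_le_one (by linarith [hv0 x hx, huv x hx])]; linarith [huv x hx]
    rw [Real.norm_of_nonneg (hPn ε hε x hx)]
    refine le_trans ?_ ((le_abs_self _).trans (hB x (subset_closure hx)))
    have b1 : ((v x + ε) / (u x + ε)) ^ p * ‖gradient u x‖ ^ p ≤ 1 * ‖gradient u x‖ ^ p :=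
      mul_le_mul_of_nonneg_right (Real.rpow_le_one ht0 ht1 hp0.le) (by positivity)
    have b2 : -(‖flux p (gradient u x)‖ * ‖gradient v x‖) ≤
        ((v x + ε) / (u x + ε)) ^ (p - 1) * ⟪flux p (gradient u x), gradient v x⟫ := by
      have c1 : ((v x + ε) / (u x + ε)) ^ (p - 1) ≤ 1 := Real.rpow_le_one ht0 ht1 hp1.le
      have c0 : 0 ≤ ((v x + ε) / (u x + ε)) ^ (p - 1) := by positivity
      have c2 := neg_le_of_abs_le (abs_real_inner_le_norm (flux p (gradient u x)) (gradient v x))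
      have c3 : 0 ≤ ‖flux p (gradient u x)‖ * ‖gradient v x‖ := by positivity
      nlinarith
    simp only [hP]
    nlinarith
  have key : ∀ ε, 0 < ε → ∫ x in O, P ε x ≤ lam * ∫ x in O, H ε x := by
    intro ε hε
    set V : Set E := {x | -ε < u x} ∩ {x | -ε < v x} with hVdef
    have hV : IsOpen V := (isOpen_lt continuous_const huc).inter (isOpen_lt continuous_const hvc)
    have hOV : closure O ⊆ V := fun x hx => ⟨by
      have := hclv x hx; have := hcluv x hx; simp only [mem_setOf_eq]; linarith, by
      have := hclv x hx; simp only [mem_setOf_eq]; linarith⟩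
    have hVu : ∀ x ∈ V, 0 < u x + ε := fun x hx => by have : -ε < u x := hx.1; linarith
    have hVv : ∀ x ∈ V, 0 < v x + ε := fun x hx => by have : -ε < v x := hx.2; linarith
    have cu : ContDiffOn ℝ 1 (fun x => u x + ε) V := (hu.c1.add contDiff_const).contDiffOn
    have cv : ContDiffOn ℝ 1 (fun x => v x + ε) V := (hv.c1.add contDiff_const).contDiffOn
    have cf1 : ContDiffOn ℝ 1 (fun x => u x + ε - (v x + ε) ^ p * (u x + ε) ^ (1 - p)) V :=
      cu.sub ((cv.rpow_const_of_ne fun x hx => (hVv x hx).ne').mul (cu.rpow_const_of_ne fun x hx => (hVu x hx).ne'))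
    have cf2 : ContDiffOn ℝ 1 (fun x => (u x + ε) ^ p * (v x + ε) ^ (1 - p) - (v x + ε)) V :=
      ((cu.rpow_const_of_ne fun x hx => (hVu x hx).ne').mul (cv.rpow_const_of_ne fun x hx => (hVv x hx).ne')).sub cv
    have hpp : ∀ a : ℝ, 0 < a → a ^ p * a ^ (1 - p) = a := fun a ha => by
      rw [← Real.rpow_add ha]; simp
    have z1 : ∀ x ∈ frontier O, u x + ε - (v x + ε) ^ p * (u x + ε) ^ (1 - p) = 0 := by
      intro x hx
      rw [hfr x hx, hpp _ (hVv x (hOV (frontier_subset_closure hx)))]; ring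
    have z2 : ∀ x ∈ frontier O, (u x + ε) ^ p * (v x + ε) ^ (1 - p) - (v x + ε) = 0 := by
      intro x hx
      rw [hfr x hx, hpp _ (hVv x (hOV (frontier_subset_closure hx)))]; ring
    have n1 : ∀ x ∈ O, 0 ≤ u x + ε - (v x + ε) ^ p * (u x + ε) ^ (1 - p) := by
      intro x hx
      have hu' := hVu x (hOV (subset_closure hx))
      have hv' := hVv x (hOV (subset_closure hx))
      have : (v x + ε) ^ p * (u x + ε) ^ (1 - p) ≤ (u x + ε) ^ p * (u x + ε) ^ (1 - p) :=
        mul_le_mul_of_nonneg_right (Real.rpow_le_rpow hv'.le (by linarith [huv x hx]) hp0.le) (by positivity)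
      rw [hpp _ hu'] at this
      linarith
    have n2 : ∀ x ∈ O, 0 ≤ (u x + ε) ^ p * (v x + ε) ^ (1 - p) - (v x + ε) := by
      intro x hx
      have hu' := hVu x (hOV (subset_closure hx))
      have hv' := hVv x (hOV (subset_closure hx))
      have : (v x + ε) ^ p * (v x + ε) ^ (1 - p) ≤ (u x + ε) ^ p * (v x + ε) ^ (1 - p) :=
        mul_le_mul_of_nonneg_right (Real.rpow_le_rpow hv'.le (by linarith [huv x hx]) hp0.le) (by positivity)
      rw [hpp _ hv'] at this
      linarith
    have i1 := hu.test hO h1 hb hV hOV cf1 z1 n1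
    have i2 := hv.test hO h2 hb hV hOV cf2 z2 n2
    have g1 := (grad_contOn hV cf1).mono hOV
    have g2 := (grad_contOn hV cf2).mono hOV
    have j1 := int_on hb (hAu.continuousOn.inner (𝕜 := ℝ) g1)
    have j2 := int_on hb (hAv.continuousOn.inner (𝕜 := ℝ) g2)
    have k1 := int_on hb (((huc.rpow_const (p := p - 1) fun x => Or.inr hp1.le).continuousOn).mul (cf1.continuousOn.mono hOV))
    have k2 := int_on hb (((hvc.rpow_const (p := p - 1) fun x => Or.inr hp1.le).continuousOn).mul (cf2.continuousOn.mono hOV))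
    have e1 : lam * ∫ x in O, H ε x = ∫ x in O, (⟪flux p (gradient u x), gradient (fun x => u x + ε - (v x + ε) ^ p * (u x + ε) ^ (1 - p)) x⟫
       - ⟪flux p (gradient v x), gradient (fun x => (u x + ε) ^ p * (v x + ε) ^ (1 - p) - (v x + ε)) x⟫) := by
      rw [integral_sub j1 j2, i1, i2, ← mul_sub]
      congr 1
      exact integral_sub k1 k2
    rw [e1]
    refine setIntegral_mono_on ?_ (j1.sub j2) hO.measurableSet ?_
    · exact int_on_bdd hO hb (hPc ε hε.le) (hPb ε hε.le)
    · intro x hx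
      have hu' := hVu x (hOV (subset_closure hx))
      have hv' := hVv x (hOV (subset_closure hx))
      have du : HasGradientAt (fun x => u x + ε) (gradient u x) x := hg_add_const ε (hg_of_contDiff hu.c1 x)
      have dv : HasGradientAt (fun x => v x + ε) (gradient v x) x := hg_add_const ε (hg_of_contDiff hv.c1 x)
      have dup := hg_comp du (Real.hasDerivAt_rpow_const (x := u x + ε) (p := p) (Or.inl hu'.ne'))
      have dum := hg_comp du (Real.hasDerivAt_rpow_const (x := u x + ε) (p := 1 - p) (Or.inl hu'.ne'))
      have dvp := hg_comp dv (Real.hasDerivAt_rpow_const (x := v x + ε) (p := p) (Or.inl hv'.ne'))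
      have dvm := hg_comp dv (Real.hasDerivAt_rpow_const (x := v x + ε) (p := 1 - p) (Or.inl hv'.ne'))
      have D1 := (hg_sub du (hg_mul dvp dum)).gradient
      have D2 := (hg_sub (hg_mul dup dvm) dv).gradient
      rw [D1, D2]
      set a := u x + ε
      set b := v x + ε
      have q1 : b ^ p * ((1 - p) * a ^ (1 - p - 1)) = -((p - 1) * (b / a) ^ p) := by
        rw [Real.div_rpow hv'.le hu'.le, show 1 - p - 1 = - p by ring, Real.rpow_neg hu'.le]
        field_simp; ring
      have q2 : a ^ (1 - p) * (p * b ^ (p - 1)) = p * (b / a) ^ (p - 1) := by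
        rw [Real.div_rpow hv'.le hu'.le, show 1 - p = - (p - 1) by ring, Real.rpow_neg hu'.le]
        field_simp
      have q3 : a ^ p * ((1 - p) * b ^ (1 - p - 1)) = -((p - 1) * (a / b) ^ p) := by
        rw [Real.div_rpow hu'.le hv'.le, show 1 - p - 1 = - p by ring, Real.rpow_neg hv'.le]
        field_simp; ring
      have q4 : b ^ (1 - p) * (p * a ^ (p - 1)) = p * (a / b) ^ (p - 1) := by
        rw [Real.div_rpow hu'.le hv'.le, show 1 - p = - (p - 1) by ring, Real.rpow_neg hv'.le]
        field_simp
      have Q := (picone_expand hp (div_nonneg hu'.le hv'.le) (gradient u x) (gradient v x)).1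
      simp only [hP, smul_smul, inner_sub_right, inner_add_right, real_inner_smul_right, q1, q2, q3, q4, inner_flux_self hp]
      linarith
  have tP : Tendsto (fun ε => ∫ x in O, P ε x) (𝓝[>] 0) (𝓝 (∫ x in O, P 0 x)) := by
    refine dct_on hO hb B ?_ ?_ ?_
    · filter_upwards [self_mem_nhdsWithin] with ε hε using hPc ε (le_of_lt hε)
    · filter_upwards [self_mem_nhdsWithin] with ε hε using hPb ε (le_of_lt hε)
    · intro x hx
      have hne : u x + 0 ≠ 0 := by linarith [hv0 x hx, huv x hx]
      have ht : Tendsto (fun ε : ℝ => (v x + ε) / (u x + ε)) (𝓝[>] 0) (𝓝 ((v x + 0) / (u x + 0))) := by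
        refine Tendsto.div ?_ ?_ hne
        · exact tendsto_const_nhds.add (tendsto_nhdsWithin_of_tendsto_nhds tendsto_id)
        · exact tendsto_const_nhds.add (tendsto_nhdsWithin_of_tendsto_nhds tendsto_id)
      have t1 := ht.rpow_const (p := p) (Or.inr hp0.le)
      have t2 := ht.rpow_const (p := p - 1) (Or.inr hp1.le)
      exact (tendsto_const_nhds.add ((t1.mul_const _).const_mul _)).sub ((t2.mul_const _).const_mul _)
  have hHeq : ∀ ε, 0 < ε → ∀ x ∈ O, H ε x = ((u x + ε) ^ p - (v x + ε) ^ p) *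
      ((u x / (u x + ε)) ^ (p - 1) - (v x / (v x + ε)) ^ (p - 1)) := by
    intro ε hε x hx
    have hv' : 0 < v x + ε := by linarith [hv0 x hx]
    have hu' : 0 < u x + ε := by linarith [hv0 x hx, huv x hx]
    have hpp : ∀ a : ℝ, 0 < a → a ^ p = a * a ^ (p - 1) := fun a ha => by
      nth_rw 2 [← Real.rpow_one a]
      rw [← Real.rpow_add ha]; simp
    simp only [hH]
    rw [Real.div_rpow (by linarith [hv0 x hx, huv x hx]) hu'.le, Real.div_rpow (hv0 x hx).le hv'.le,
      show 1 - p = - (p - 1) by ring, Real.rpow_neg hu'.le, Real.rpow_neg hv'.le, hpp _ hu', hpp _ hv']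
    have := Real.rpow_pos_of_pos hu' (p - 1)
    have := Real.rpow_pos_of_pos hv' (p - 1)
    field_simp
  have tH : Tendsto (fun ε => ∫ x in O, H ε x) (𝓝[>] 0) (𝓝 (∫ x in O, (0 : ℝ))) := by
    refine dct_on hO hb ((M + 1) ^ p) ?_ ?_ ?_
    · filter_upwards [self_mem_nhdsWithin] with ε hε
      have hε : 0 < ε := hε
      have cu : Continuous fun x => u x + ε := huc.add (continuous_const (y := ε))
      have cv : Continuous fun x => v x + ε := hvc.add (continuous_const (y := ε))
      have r1 := (huc.rpow_const (p := p - 1) fun x => Or.inr hp1.le)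
      have r2 := (hvc.rpow_const (p := p - 1) fun x => Or.inr hp1.le)
      have r3 := cu.rpow_const (p := p) fun x => Or.inr hp0.le
      have r4 := cv.rpow_const (p := p) fun x => Or.inr hp0.le
      have r5 : ContinuousOn (fun x => (u x + ε) ^ (1 - p)) O :=
        cu.continuousOn.rpow_const fun x hx => Or.inl (by linarith [hv0 x hx, huv x hx])
      have r6 : ContinuousOn (fun x => (v x + ε) ^ (1 - p)) O :=
        cv.continuousOn.rpow_const fun x hx => Or.inl (by linarith [hv0 x hx])
      exact (r1.continuousOn.mul (cu.continuousOn.sub (r4.continuousOn.mul r5))).sub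
        (r2.continuousOn.mul ((r3.continuousOn.mul r6).sub cv.continuousOn))
    · filter_upwards [Ioo_mem_nhdsGT (zero_lt_one (α := ℝ))] with ε hε x hx
      have hε : 0 < ε ∧ ε < 1 := hε
      have hvx := hv0 x hx
      have hux := huv x hx
      rw [hHeq ε hε.1 x hx, norm_mul]
      have b1 : ‖(u x + ε) ^ p - (v x + ε) ^ p‖ ≤ (M + 1) ^ p := by
        have m1 : (v x + ε) ^ p ≤ (u x + ε) ^ p := Real.rpow_le_rpow (by linarith) (by linarith) hp0.le
        have m2 : 0 ≤ (v x + ε) ^ p := Real.rpow_nonneg (by linarith) _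
        have m3 : (u x + ε) ^ p ≤ (M + 1) ^ p := by
          refine Real.rpow_le_rpow (by linarith) ?_ hp0.le
          have := (le_abs_self _).trans (hM x (subset_closure hx))
          linarith
        rw [Real.norm_of_nonneg (by linarith)]; linarith
      have b2 : ‖(u x / (u x + ε)) ^ (p - 1) - (v x / (v x + ε)) ^ (p - 1)‖ ≤ 1 := by
        have m1 : (u x / (u x + ε)) ^ (p - 1) ≤ 1 := Real.rpow_le_one (div_nonneg (by linarith) (by linarith))
          ((div_le_one (by linarith)).2 (by linarith)) hp1.le
        have m2 : (v x / (v x + ε)) ^ (p - 1) ≤ 1 := Real.rpow_le_one (div_nonneg (by linarith) (by linarith))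
          ((div_le_one (by linarith)).2 (by linarith)) hp1.le
        have m3 : 0 ≤ (u x / (u x + ε)) ^ (p - 1) := Real.rpow_nonneg (div_nonneg (by linarith) (by linarith)) _
        have m4 : 0 ≤ (v x / (v x + ε)) ^ (p - 1) := Real.rpow_nonneg (div_nonneg (by linarith) (by linarith)) _
        rw [Real.norm_eq_abs, abs_le]; constructor <;> linarith
      calc _ ≤ (M + 1) ^ p * 1 := mul_le_mul b1 b2 (norm_nonneg _) ((norm_nonneg _).trans b1)
        _ = _ := mul_one _
    · intro x hx
      have hvx := hv0 x hx
      have hux := huv x hx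
      have tid : Tendsto (fun ε : ℝ => ε) (𝓝[>] 0) (𝓝 0) := tendsto_nhdsWithin_of_tendsto_nhds tendsto_id
      have hq : ∀ a : ℝ, 0 < a → Tendsto (fun ε : ℝ => (a / (a + ε)) ^ (p - 1)) (𝓝[>] 0) (𝓝 1) := by
        intro a ha
        have := (Tendsto.div (tendsto_const_nhds (x := a)) ((tendsto_const_nhds (x := a)).add tid) (by linarith)).rpow_const (p := p - 1) (Or.inr hp1.le)
        simpa [ha.ne'] using this
      have t1 : Tendsto (fun ε : ℝ => (u x + ε) ^ p - (v x + ε) ^ p) (𝓝[>] 0) (𝓝 ((u x + 0) ^ p - (v x + 0) ^ p)) :=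
        ((tendsto_const_nhds.add tid).rpow_const (Or.inr hp0.le)).sub ((tendsto_const_nhds.add tid).rpow_const (Or.inr hp0.le))
      have := t1.mul ((hq (u x) (by linarith)).sub (hq (v x) hvx))
      rw [sub_self, mul_zero] at this
      refine this.congr' ?_
      filter_upwards [self_mem_nhdsWithin] with ε hε using (hHeq ε hε x hx).symm
  have hle : ∫ x in O, P 0 x ≤ 0 := by
    have := tH.const_mul lam
    rw [integral_zero, mul_zero] at this
    refine le_of_tendsto_of_tendsto tP this ?_
    filter_upwards [self_mem_nhdsWithin] with ε hε using key ε hε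
  have hz := zero_of_int hO (hPc 0 le_rfl) (hPn 0 le_rfl)
    (int_on_bdd hO hb (hPc 0 le_rfl) (hPb 0 le_rfl)) hle
  intro x hx
  have := (picone_expand hp (div_nonneg (by linarith [hv0 x hx]) (by linarith [hv0 x hx, huv x hx]) :
    0 ≤ (v x + 0) / (u x + 0)) (gradient v x) (gradient u x)).2 (hz x hx)
  simpa using this
end tools
end PL
end part6

section part7
open MeasureTheory Metric Set Filter
open scoped RealInnerProductSpace ENNReal Topology NNReal
namespace PL
section dat
variable {E : Type*} [NormedAddCommGroup E] [InnerProductSpace ℝ E] [FiniteDimensional ℝ E] [MeasurableSpace E] [BorelSpace E]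

/-- Eccentric annulus. -/
def An (e : E) (R₀ R₁ s : ℝ) : Set E := {x | ‖x‖ < R₁ ∧ R₀ < ‖x - s • e‖}

/-- The standing assumptions. -/
structure Dat (p lam R₀ R₁ s : ℝ) (e : E) (u : E → ℝ) : Prop where
  hp : 1 < p
  hl : 0 ≤ lam
  h0 : 0 < R₀
  hs : 0 < s
  hs' : s < R₁ - R₀
  he : ‖e‖ = 1
  eig : Eig p lam (An e R₀ R₁ s) u
  pos : ∀ x ∈ An e R₀ R₁ s, 0 < u x
  zin : ∀ x, ‖x - s • e‖ = R₀ → u x = 0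
  zout : ∀ x, ‖x‖ = R₁ → u x = 0

variable {p lam R₀ R₁ s : ℝ} {e : E} {u : E → ℝ}

theorem isOpen_An : IsOpen (An e R₀ R₁ s) :=
  (isOpen_lt continuous_norm continuous_const).inter (isOpen_lt continuous_const (by fun_prop : Continuous fun x : E => ‖x - s • e‖))

theorem bdd_An : Bornology.IsBounded (An e R₀ R₁ s) :=
  isBounded_ball.subset (fun x (hx : _ ∧ _) => by simpa using hx.1 : An e R₀ R₁ s ⊆ ball 0 R₁)

theorem inner_sub_c (he : ‖e‖ = 1) (x : E) : ⟪e, x - s • e⟫ = ⟪e, x⟫ - s := by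
  rw [inner_sub_right, real_inner_smul_right, ee he, mul_one]

theorem Dat.mem_shell (h : Dat p lam R₀ R₁ s e u) {x : E} (h1 : R₀ < ‖x - s • e‖) (h2 : ‖x - s • e‖ < R₁ - s) :
    x ∈ An e R₀ R₁ s := by
  refine ⟨?_, h1⟩
  have := norm_add_le (x - s • e) (s • e)
  rw [sub_add_cancel, norm_smul, h.he, Real.norm_of_nonneg h.hs.le] at this
  linarith

theorem Dat.sg_mem (h : Dat p lam R₀ R₁ s e u) {x : E} (h1 : R₀ < ‖x - s • e‖) (h2 : ‖x‖ ≤ R₁) (h3 : s < ⟪e, x⟫) :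
    sg e s x ∈ An e R₀ R₁ s := by
  refine ⟨?_, by rwa [norm_sg_sub h.he]⟩
  have h4 := norm_sg_sq h.he s x
  have h5 : 0 < 4 * (⟪e, x⟫ - s) * s := by have := h.hs; have : 0 < ⟪e, x⟫ - s := by linarith
                                           positivity
  have h6 : ‖x‖ ^ 2 ≤ R₁ ^ 2 := pow_le_pow_left₀ (norm_nonneg _) h2 2
  exact lt_of_pow_lt_pow_left₀ 2 (by linarith [h.h0, h.hs, h.hs']) (by linarith)

theorem Dat.cmp (h : Dat p lam R₀ R₁ s e u) {x : E} (h1 : R₀ < ‖x - s • e‖) (h2 : ‖x‖ < R₁) (h3 : s < ⟪e, x⟫) :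
    u x ≤ u (sg e s x) := by
  have he := h.he
  set v : E → ℝ := fun x => u (sg e s x) with hv
  have hvE := h.eig.refl h.he s
  have huc := h.eig.c1.continuous
  have hvc : Continuous v := hvE.c1.continuous
  set O : Set E := An e R₀ R₁ s ∩ {x | s < ⟪e, x⟫} ∩ {x | v x < u x} with hOdef
  have hin : Continuous fun x : E => ⟪e, x⟫ := by fun_prop
  have hO : IsOpen O := (isOpen_An.inter (isOpen_lt continuous_const hin)).inter (isOpen_lt hvc huc)
  have hb : Bornology.IsBounded O := bdd_An.subset fun x hx => hx.1.1
  have hO2 : O ⊆ sg e s ⁻¹' An e R₀ R₁ s := fun x hx => h.sg_mem hx.1.1.2 (le_of_lt hx.1.1.1) hx.1.2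
  have hfr : ∀ x ∈ frontier O, u x = v x := by
    intro x hx
    rw [hO.frontier_eq] at hx
    obtain ⟨hx1, hx2⟩ := hx
    have c1 : ‖x‖ ≤ R₁ := closure_minimal (fun y hy => le_of_lt hy.1.1.1)
      (isClosed_le continuous_norm continuous_const) hx1
    have c2 : R₀ ≤ ‖x - s • e‖ := closure_minimal (fun y hy => le_of_lt hy.1.1.2)
      (isClosed_le continuous_const (by fun_prop : Continuous fun x : E => ‖x - s • e‖)) hx1
    have c3 : s ≤ ⟪e, x⟫ := closure_minimal (fun y hy => le_of_lt hy.1.2) (isClosed_le continuous_const hin) hx1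
    have c4 : v x ≤ u x := closure_minimal (fun y hy => le_of_lt hy.2) (isClosed_le hvc huc) hx1
    rcases c3.eq_or_lt with e3 | l3
    · simp [hv, sg, ← e3]
    rcases c2.eq_or_lt with e2 | l2
    · rw [h.zin x e2.symm]
      exact (h.zin _ (by rw [norm_sg_sub he, ← e2])).symm
    rcases c1.eq_or_lt with e1 | l1
    · have := h.pos _ (h.sg_mem l2 e1.le l3)
      rw [h.zout x e1] at c4
      exact absurd this (not_lt.2 c4)
    · by_contra hne
      exact hx2 ⟨⟨⟨l1, l2⟩, l3⟩, lt_of_le_of_ne c4 (Ne.symm hne)⟩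
  have hcomp := compare h.hp h.eig hvE hO hb (fun x hx => hx.1.1) hO2 (fun x hx => h.pos _ (hO2 hx)) (fun x hx => hx.2) hfr
  by_contra hcon
  push Not at hcon
  set c := s • e with hc
  set y := x - c with hy
  have hr : 0 < ‖y‖ := h.h0.trans h1
  have hey : 0 < ⟪e, y⟫ := by rw [hy, hc, inner_sub_c he]; linarith
  have hq : ∀ t : ℝ, ‖c + t • y‖ ^ 2 = s ^ 2 + 2 * t * s * ⟪e, y⟫ + t ^ 2 * ‖y‖ ^ 2 := by
    intro t
    rw [norm_add_sq_real, norm_smul, norm_smul, he, hc, real_inner_smul_left, real_inner_smul_right,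
      mul_pow, Real.norm_eq_abs, Real.norm_eq_abs, sq_abs, mul_pow |t|, sq_abs]; ring
  have hR1 : 0 < R₁ := by linarith [h.h0, h.hs, h.hs']
  have hx1 : c + (1:ℝ) • y = x := by simp [hy]
  obtain ⟨β, hβ1, hβ⟩ : ∃ β : ℝ, 1 < β ∧ ‖c + β • y‖ = R₁ := by
    have hcont : ContinuousOn (fun t : ℝ => ‖c + t • y‖) (Icc 1 (1 + R₁ / ‖y‖)) := by fun_prop
    have hlow : ‖c + (1:ℝ) • y‖ ≤ R₁ := by rw [hx1]; exact h2.le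
    have hup : R₁ ≤ ‖c + (1 + R₁ / ‖y‖) • y‖ := by
      refine le_of_sq_le_sq ?_ (norm_nonneg _) |> fun h => h
      rw [hq]
      have : (1 + R₁ / ‖y‖) ^ 2 * ‖y‖ ^ 2 = (‖y‖ + R₁) ^ 2 := by field_simp
      rw [this]
      have := h.hs
      have : 0 ≤ 2 * (1 + R₁ / ‖y‖) * s * ⟪e, y⟫ := by positivity
      nlinarith
    obtain ⟨β, hβ, hβ'⟩ := intermediate_value_Icc (by have := div_pos hR1 hr; linarith) hcont ⟨hlow, hup⟩
    refine ⟨β, lt_of_le_of_ne hβ.1 ?_, hβ'⟩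
    rintro rfl
    simp only [hx1] at hβ'
    linarith
  set α := (R₀ / ‖y‖ + 1) / 2 with hα
  have hα1 : R₀ / ‖y‖ < 1 := (div_lt_one hr).2 h1
  have hα0 : 0 < R₀ / ‖y‖ := div_pos h.h0 hr
  have hpt : ∀ t ∈ Icc α β, R₀ < ‖(c + t • y) - c‖ ∧ ‖c + t • y‖ ≤ R₁ ∧ s < ⟪e, c + t • y⟫ ∧ (t < β → ‖c + t • y‖ < R₁) := by
    intro t ht
    have ht0 : 0 < t := by linarith [ht.1]
    have hsq : ‖c + t • y‖ ^ 2 ≤ ‖c + β • y‖ ^ 2 := by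
      rw [hq, hq]
      have := h.hs
      have := ht.2
      gcongr
    refine ⟨?_, ?_, ?_, ?_⟩
    · rw [add_sub_cancel_left, norm_smul, Real.norm_of_nonneg ht0.le]
      have : R₀ / ‖y‖ < t := by linarith [ht.1]
      exact (div_lt_iff₀ hr).1 this
    · rw [← hβ]; exact le_of_sq_le_sq hsq (norm_nonneg _)
    · rw [inner_add_right, hc, real_inner_smul_right, real_inner_smul_right, ee he]
      have := mul_pos ht0 hey
      linarith
    · intro hlt
      rw [← hβ]
      refine lt_of_pow_lt_pow_left₀ 2 (norm_nonneg _) ?_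
      rw [hq, hq]
      have := h.hs
      have : t ^ 2 * ‖y‖ ^ 2 < β ^ 2 * ‖y‖ ^ 2 := by gcongr
      have : 2 * t * s * ⟪e, y⟫ ≤ 2 * β * s * ⟪e, y⟫ := by gcongr
      linarith
  have hvpos : ∀ t ∈ Icc α β, 0 < v (c + t • y) := fun t ht =>
    h.pos _ (h.sg_mem (hpt t ht).1 (hpt t ht).2.1 (hpt t ht).2.2.1)
  have h1β : (1:ℝ) ∈ Ioo α β := ⟨by linarith, hβ1⟩
  have hray := ray (h := fun t => u (c + t • y) / v (c + t • y) - 1) h1β ?_ ?_ ?_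
  · have h2 := hray.2
    simp only [h.zout _ hβ, hx1, zero_div] at h2
    have h3 : u x / v x = 0 := by linarith
    have hvx : 0 < v x := by have := hvpos 1 ⟨h1β.1.le, h1β.2.le⟩; rwa [hx1] at this
    have := div_pos (hvx.trans hcon) hvx
    linarith
  · refine ContinuousOn.sub (ContinuousOn.div ?_ ?_ fun t ht => (hvpos t ht).ne') continuousOn_const
    · exact (huc.comp (by fun_prop)).continuousOn
    · exact (hvc.comp (by fun_prop)).continuousOn
  · have hvx : 0 < v x := by have := hvpos 1 ⟨h1β.1.le, h1β.2.le⟩; rwa [hx1] at this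
    simp only [hx1]
    rw [sub_pos, one_lt_div hvx]; exact hcon
  · intro t ht htp
    have htI : t ∈ Icc α β := ⟨ht.1.le, ht.2.le⟩
    have hvp := hvpos t htI
    rw [sub_pos, one_lt_div hvp] at htp
    have hmem : c + t • y ∈ O := ⟨⟨⟨(hpt t htI).2.2.2 ht.2, (hpt t htI).1⟩, (hpt t htI).2.2.1⟩, htp⟩
    have hg := hcomp _ hmem
    have du := hg_line (hg_of_contDiff h.eig.c1 (c + t • y))
    have dv := hg_line (hg_of_contDiff hvE.c1 (c + t • y))
    rw [hg] at dv
    have hup : 0 < u (c + t • y) := hvp.trans htp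
    have := (du.div dv hvp.ne').sub_const 1
    refine this.congr_deriv ?_
    rw [real_inner_smul_left]
    field_simp
    ring

theorem deriv_nonneg_right {h : ℝ → ℝ} {d a b : ℝ} (hab : a < b) (hd : HasDerivAt h d a) (h0 : h a = 0)
    (hn : ∀ t ∈ Ioo a b, 0 ≤ h t) : 0 ≤ d := by
  have : Tendsto (slope h a) (𝓝[>] a) (𝓝 d) := hd.tendsto_slope.mono_left
    (nhdsWithin_mono a (show Ioi a ⊆ {a}ᶜ from fun x hx => ne_of_gt hx))
  refine ge_of_tendsto this ?_
  filter_upwards [Ioo_mem_nhdsGT hab] with t ht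
  rw [slope_def_field, h0, sub_zero]
  exact div_nonneg (hn t ht) (by linarith [ht.1])

theorem Dat.nonneg (h : Dat p lam R₀ R₁ s e u) {x : E} (h1 : R₀ ≤ ‖x - s • e‖) (h2 : ‖x - s • e‖ < R₁ - s) :
    0 ≤ u x := by
  rcases h1.eq_or_lt with e1 | l1
  · rw [h.zin x e1.symm]
  · exact (h.pos x (h.mem_shell l1 h2)).le

/-- Normal direction of the gradient on the inner sphere. -/
theorem Dat.grad_in (h : Dat p lam R₀ R₁ s e u) {z : E} (hz : ‖z - s • e‖ = R₀) :
    gradient u z = (⟪gradient u z, z - s • e⟫ / R₀ ^ 2) • (z - s • e) := by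
  set a := gradient u z with ha
  set y := z - s • e with hy
  set w := a - (⟪a, y⟫ / R₀ ^ 2) • y with hw
  have hR := h.h0
  have hwy : ⟪w, y⟫ = 0 := by
    rw [hw, inner_sub_left, real_inner_smul_left, real_inner_self_eq_norm_sq, hz]
    field_simp; ring
  have hmin : IsLocalMin (fun t : ℝ => u (z + t • w)) 0 := by
    have hc : Continuous fun t : ℝ => ‖z + t • w - s • e‖ := by fun_prop
    have : ∀ᶠ t in 𝓝 (0:ℝ), ‖z + t • w - s • e‖ < R₁ - s := by
      refine hc.continuousAt.eventually_lt continuousAt_const ?_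
      simp only [zero_smul, add_zero]
      rw [← hy, hz]; linarith [h.hs']
    filter_upwards [this] with t ht
    simp only [zero_smul, add_zero, h.zin z hz]
    refine h.nonneg ?_ ht
    refine le_of_sq_le_sq ?_ (norm_nonneg _)
    rw [show z + t • w - s • e = y + t • w by rw [hy]; module, norm_add_sq_real, hz, real_inner_smul_right,
      real_inner_comm, hwy]
    nlinarith [sq_nonneg ‖t • w‖]
  have hd := hg_line (f := u) (x := z) (v := w) (t := 0) (a := a) (by
    simp only [zero_smul, add_zero]; exact hg_of_contDiff h.eig.c1 z)
  have h0 := hmin.hasDerivAt_eq_zero hd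
  have : ⟪w, w⟫ = 0 := by
    conv_lhs => rw [hw]
    rw [inner_sub_left, ← hw, h0, real_inner_smul_left, (real_inner_comm w y), hwy]; ring
  have := inner_self_eq_zero.1 this
  exact sub_eq_zero.1 this

/-- Hopf lemma on the inner sphere. -/
theorem Dat.hopf (h : Dat p lam R₀ R₁ s e u) :
    ∃ m, 0 < m ∧ ∀ z, ‖z - s • e‖ = R₀ → m ≤ ⟪gradient u z, z - s • e⟫ := by
  have hp := h.hp
  have hR := h.h0
  have hs' := h.hs'
  have huc := h.eig.c1.continuous
  set c := s • e with hc
  set r₁ := (R₀ + (R₁ - s)) / 2 with hr₁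
  have h01 : R₀ < r₁ := by linarith
  have h12 : r₁ < R₁ - s := by linarith
  obtain ⟨μ, hμ, hμu⟩ : ∃ μ, 0 < μ ∧ ∀ x ∈ sphere c r₁, μ ≤ u x := by
    refine (isCompact_sphere c r₁).exists_forall_le' huc.continuousOn (a := 0) ?_
    intro x hx
    rw [mem_sphere, dist_eq_norm] at hx
    exact h.pos x (h.mem_shell (by rw [← hc, hx]; exact h01) (by rw [← hc, hx]; exact h12))
  have hd2 : 0 < r₁ ^ 2 - R₀ ^ 2 := by nlinarith
  set k := 2 * μ / (r₁ ^ 2 - R₀ ^ 2) with hk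
  have hk0 : 0 < k := by positivity
  set g : E → ℝ := fun x => k / 2 * ‖x - c‖ ^ 2 - k / 2 * R₀ ^ 2 with hg
  have hgd : ∀ x, HasGradientAt g (k • (x - c)) x := by
    intro x
    have := hg_add_const (-(k / 2 * R₀ ^ 2)) (hg_mul (hasGradientAt_const x (k / 2)) (hg_normsq c x))
    convert this using 1
    · funext x; simp only [hg]; ring
    rw [smul_zero, add_zero, smul_smul]; congr 1; ring
  have hns : ContDiff ℝ 1 (fun x : E => ‖x - c‖ ^ 2) := (contDiff_id.sub contDiff_const).norm_sq ℝ
  have hgC : ContDiff ℝ 1 g := (contDiff_const.mul hns).sub contDiff_const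
  have hgr : ∀ x, ‖x - c‖ = r₁ → g x = μ := by
    intro x hx
    simp only [hg, hx, hk]; field_simp
  have hgR : ∀ x, ‖x - c‖ = R₀ → g x = 0 := by
    intro x hx
    simp only [hg, hx]; ring
  have hnc : Continuous fun x : E => ‖x - c‖ := by fun_prop
  set O : Set E := {x | R₀ < ‖x - c‖} ∩ {x | ‖x - c‖ < r₁} ∩ {x | u x < g x} with hOdef
  have hO : IsOpen O := ((isOpen_lt continuous_const hnc).inter (isOpen_lt hnc continuous_const)).inter
    (isOpen_lt huc hgC.continuous)
  have hOA : O ⊆ An e R₀ R₁ s := fun x hx => h.mem_shell hx.1.1 (lt_trans hx.1.2 h12)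
  have hb : Bornology.IsBounded O := bdd_An.subset hOA
  have hclO : ∀ x ∈ closure O, R₀ ≤ ‖x - c‖ := fun x hx =>
    closure_minimal (fun y hy => le_of_lt hy.1.1) (isClosed_le continuous_const hnc) hx
  have hfr : ∀ x ∈ frontier O, g x - u x = 0 := by
    intro x hx
    rw [hO.frontier_eq] at hx
    obtain ⟨hx1, hx2⟩ := hx
    have c1 := hclO x hx1
    have c2 : ‖x - c‖ ≤ r₁ := closure_minimal (fun y hy => le_of_lt hy.1.2) (isClosed_le hnc continuous_const) hx1
    have c3 : u x ≤ g x := closure_minimal (fun y hy => le_of_lt hy.2) (isClosed_le huc hgC.continuous) hx1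
    rcases c1.eq_or_lt with e1 | l1
    · rw [h.zin x e1.symm, hgR x e1.symm, sub_zero]
    rcases c2.eq_or_lt with e2 | l2
    · have a1 := hμu x (by rw [mem_sphere, dist_eq_norm, e2])
      have a2 := hgr x e2
      linarith
    · by_contra hne
      exact hx2 ⟨⟨l1, l2⟩, lt_of_le_of_ne c3 fun h => hne (by rw [h, sub_self])⟩
  have hfC : ContDiff ℝ 1 (fun x => g x - u x) := hgC.sub h.eig.c1
  have hfn : ∀ x ∈ O, 0 ≤ g x - u x := fun x hx => by have : u x < g x := hx.2; linarith
  have hgradf : ∀ x, gradient (fun x => g x - u x) x = k • (x - c) - gradient u x := fun x =>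
    (hg_sub (hgd x) (hg_of_contDiff h.eig.c1 x)).gradient
  have t1 := h.eig.test hO hOA hb isOpen_univ (subset_univ _) hfC.contDiffOn hfr hfn
  have t1' : 0 ≤ ∫ x in O, ⟪flux p (gradient u x), gradient (fun x => g x - u x) x⟫ := by
    rw [t1]
    refine mul_nonneg h.hl (setIntegral_nonneg hO.measurableSet fun x hx => ?_)
    exact mul_nonneg (Real.rpow_nonneg (h.pos x (hOA hx)).le _) (hfn x hx)
  set V : Set E := {x | 0 < ‖x - c‖} with hVdef
  have hV : IsOpen V := isOpen_lt continuous_const hnc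
  have hOV : closure O ⊆ V := fun x hx => lt_of_lt_of_le hR (hclO x hx)
  have hrp : ContDiffOn ℝ 1 (fun x : E => (‖x - c‖ ^ 2) ^ ((p - 2) / 2)) V :=
    hns.contDiffOn.rpow_const_of_ne fun x hx => by have : 0 < ‖x - c‖ := hx; positivity
  have hFC : ContDiffOn ℝ 1 (fun x : E => (‖x - c‖ ^ 2) ^ ((p - 2) / 2) * (g x - u x)) V := hrp.mul hfC.contDiffOn
  have eul := euler hO hb hV hOV hFC (fun x hx => by rw [hfr x hx, mul_zero])
    (fun x hx => mul_nonneg (by positivity) (hfn x hx)) c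
  have hsq : ∀ x : E, (‖x - c‖ ^ 2) ^ ((p - 2) / 2) = ‖x - c‖ ^ (p - 2) := by
    intro x
    rw [← Real.rpow_natCast, ← Real.rpow_mul (norm_nonneg _)]
    congr 1; push_cast; ring
  have hfin : (1:ℝ) ≤ Module.finrank ℝ E := by
    have : Nontrivial E := ⟨e, 0, fun h' => by have := h.he; rw [h', norm_zero] at this; norm_num at this⟩
    exact_mod_cast Module.finrank_pos (R := ℝ) (M := E)
  have hFg : ∀ x ∈ O, ⟪gradient (fun x : E => (‖x - c‖ ^ 2) ^ ((p - 2) / 2) * (g x - u x)) x, x - c⟫ =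
      (‖x - c‖ ^ 2) ^ ((p - 2) / 2) * ⟪k • (x - c) - gradient u x, x - c⟫ +
      (p - 2) * ((‖x - c‖ ^ 2) ^ ((p - 2) / 2) * (g x - u x)) := by
    intro x hx
    have hx0 : 0 < ‖x - c‖ := hOV (subset_closure hx)
    have hx2 : 0 < ‖x - c‖ ^ 2 := by positivity
    have d1 := hg_comp (hg_normsq c x) (Real.hasDerivAt_rpow_const (x := ‖x - c‖ ^ 2) (p := (p - 2) / 2) (Or.inl hx2.ne'))
    have d2 := (hg_mul d1 (hg_sub (hgd x) (hg_of_contDiff h.eig.c1 x))).gradient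
    rw [d2, inner_add_left, real_inner_smul_left, real_inner_smul_left, real_inner_smul_left, real_inner_smul_left,
      real_inner_self_eq_norm_sq, Real.rpow_sub_one hx2.ne']
    field_simp
  have t2 : ∫ x in O, ⟪flux p (k • (x - c)), gradient (fun x => g x - u x) x⟫ ≤ 0 := by
    have e1 : ∀ x ∈ O, ⟪flux p (k • (x - c)), gradient (fun x => g x - u x) x⟫ =
        k ^ (p - 1) * (⟪gradient (fun x : E => (‖x - c‖ ^ 2) ^ ((p - 2) / 2) * (g x - u x)) x, x - c⟫ -
         (p - 2) * ((‖x - c‖ ^ 2) ^ ((p - 2) / 2) * (g x - u x))) := by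
      intro x hx
      rw [hFg x hx, hgradf, flux_smul hp hk0.le, flux, real_inner_smul_left, real_inner_smul_left, hsq,
        real_inner_comm (k • (x - c) - gradient u x)]
      ring
    rw [setIntegral_congr_fun hO.measurableSet e1, integral_const_mul, integral_sub, integral_const_mul, eul]
    · have : 0 ≤ ∫ x in O, (‖x - c‖ ^ 2) ^ ((p - 2) / 2) * (g x - u x) :=
        setIntegral_nonneg hO.measurableSet fun x hx => mul_nonneg (by positivity) (hfn x hx)
      refine mul_nonpos_of_nonneg_of_nonpos (by positivity) ?_
      nlinarith
    · exact int_on hb (((grad_contOn hV hFC).mono hOV).inner (𝕜 := ℝ) (by fun_prop))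
    · exact (int_on hb (hFC.continuousOn.mono hOV)).const_mul _
  have hAu : Continuous fun x => flux p (gradient u x) := (continuous_flux hp).comp (continuous_gradient h.eig.c1)
  have hAg : Continuous fun x => flux p (k • (x - c)) := (continuous_flux hp).comp (by fun_prop)
  have hgf := continuous_gradient hfC
  have i1 : IntegrableOn (fun x => ⟪flux p (gradient u x), gradient (fun x => g x - u x) x⟫) O :=
    int_on hb (hAu.inner hgf).continuousOn
  have i2 : IntegrableOn (fun x => ⟪flux p (k • (x - c)), gradient (fun x => g x - u x) x⟫) O :=
    int_on hb (hAg.inner hgf).continuousOn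
  have hz := zero_of_int (g := fun x => ⟪flux p (k • (x - c)), gradient (fun x => g x - u x) x⟫ -
      ⟪flux p (gradient u x), gradient (fun x => g x - u x) x⟫) hO
    ((hAg.inner hgf).sub (hAu.inner hgf)).continuousOn
    (fun x _ => by
      rw [← inner_sub_left, hgradf]
      exact (flux_mono hp _ _).1) (i2.sub i1) (by rw [integral_sub i2 i1]; linarith)
  have heq : ∀ x ∈ O, k • (x - c) = gradient u x := by
    intro x hx
    have := hz x hx
    simp only [← inner_sub_left, hgradf] at this
    exact (flux_mono hp _ _).2 this
  have hge : ∀ x, R₀ < ‖x - c‖ → ‖x - c‖ < r₁ → g x ≤ u x := by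
    intro x hx1 hx2
    by_contra hcon
    push Not at hcon
    set y := x - c with hy
    have hr : 0 < ‖y‖ := hR.trans hx1
    have hnt : ∀ t : ℝ, 0 ≤ t → ‖c + t • y - c‖ = t * ‖y‖ := fun t ht => by
      rw [add_sub_cancel_left, norm_smul, Real.norm_of_nonneg ht]
    have hx1' : c + (1:ℝ) • y = x := by simp [hy]
    have hα0 : 0 < R₀ / ‖y‖ := by positivity
    have hray := ray (h := fun t => g (c + t • y) - u (c + t • y)) (α := R₀ / ‖y‖) (β := r₁ / ‖y‖) (t0 := 1)
      ⟨(div_lt_one hr).2 hx1, (one_lt_div hr).2 hx2⟩ (hfC.continuous.comp (by fun_prop)).continuousOn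
      (by simp only [hx1']; linarith) ?_
    · have h1 := hray.1
      have h2 : ‖c + (R₀ / ‖y‖) • y - c‖ = R₀ := by rw [hnt _ hα0.le]; field_simp
      simp only [hgR _ h2, h.zin _ h2, hx1'] at h1
      linarith
    · intro t ht htp
      have ht0 : 0 < t := hα0.trans ht.1
      have hmem : c + t • y ∈ O := ⟨⟨by
        change R₀ < ‖c + t • y - c‖
        rw [hnt t ht0.le]; exact (div_lt_iff₀ hr).1 ht.1, by
        change ‖c + t • y - c‖ < r₁
        rw [hnt t ht0.le]; exact (lt_div_iff₀ hr).1 ht.2⟩, by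
        change u (c + t • y) < g (c + t • y)
        linarith⟩
      have := hg_line (hg_sub (hgd (c + t • y)) (hg_of_contDiff h.eig.c1 (c + t • y)))
      rwa [heq _ hmem, sub_self, inner_zero_left] at this
  refine ⟨k * R₀ ^ 2, by positivity, fun z hz => ?_⟩
  set y := z - c with hy
  have hz1 : c + (1:ℝ) • y = z := by simp [hy]
  have hd := hg_line (x := c) (v := y) (t := 1) (hg_sub (hg_of_contDiff h.eig.c1 (c + (1:ℝ) • y)) (hgd (c + (1:ℝ) • y)))
  have := deriv_nonneg_right (b := r₁ / R₀) ((one_lt_div hR).2 h01) hd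
    (by rw [hz1, h.zin z hz, hgR z hz, sub_zero]) (fun t ht => by
      have ht0 : 0 < t := zero_lt_one.trans ht.1
      have hnt : ‖c + t • y - c‖ = t * R₀ := by
        rw [add_sub_cancel_left, norm_smul, Real.norm_of_nonneg ht0.le, hz]
      have := hge (c + t • y) (by rw [hnt]; nlinarith [ht.1]) (by rw [hnt]; exact (lt_div_iff₀ hR).1 ht.2)
      linarith)
  rw [hz1, inner_sub_left, real_inner_smul_left, ← hy, real_inner_self_eq_norm_sq, hz] at this
  linarith
end dat
end PL
end part7

section part8
open MeasureTheory Metric Set Filter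
open scoped RealInnerProductSpace ENNReal Topology NNReal
namespace PL
section shape
variable {E : Type*} [NormedAddCommGroup E] [InnerProductSpace ℝ E] [FiniteDimensional ℝ E] [MeasurableSpace E] [BorelSpace E]

theorem deriv_int {F : ℝ → E → ℝ} {f : E → ℝ} {S : Set E} (hS : Bornology.IsBounded S) (C : ℝ)
    (hm : ∀ t, AEStronglyMeasurable (F t) (volume : Measure E))
    (hb : ∀ t x, |F t x| ≤ C * |t|) (hz : ∀ t x, x ∉ S → F t x = 0)
    (hl : ∀ x, Tendsto (fun t => F t x / t) (𝓝[≠] 0) (𝓝 (f x))) :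
    HasDerivAt (fun t => ∫ x, F t x) (∫ x, f x) 0 := by
  have hF0 : ∀ x, F 0 x = 0 := fun x => by
    have := hb 0 x
    rw [abs_zero, mul_zero] at this
    exact abs_nonpos_iff.1 this
  have hC : 0 ≤ C := by
    have := (abs_nonneg _).trans (hb 1 (0:E))
    simpa using this
  rw [hasDerivAt_iff_tendsto_slope]
  have h1 : Tendsto (fun t => ∫ x, F t x / t) (𝓝[≠] 0) (𝓝 (∫ x, f x)) := by
    refine dct_bdd hS C (Eventually.of_forall fun t => by
      simpa only [div_eq_mul_inv] using (hm t).mul_const t⁻¹) ?_ ?_ (Eventually.of_forall hl)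
    · refine Eventually.of_forall fun t x => ?_
      rw [norm_div, Real.norm_eq_abs, Real.norm_eq_abs]
      rcases eq_or_ne t 0 with rfl | ht
      · simpa using hC
      · rw [div_le_iff₀ (abs_pos.2 ht)]; exact hb t x
    · refine Eventually.of_forall fun t x hx => ?_
      rw [hz t x hx, zero_div]
  refine h1.congr fun t => ?_
  rw [slope_def_field, integral_div]
  simp [hF0]

theorem tendsto_shift {f : E → ℝ} {a x : E} (v : E) (hf : HasGradientAt f a x) :
    Tendsto (fun t : ℝ => (f (x + t • v) - f x) / t) (𝓝[≠] 0) (𝓝 ⟪a, v⟫) := by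
  have h := hg_line (f := f) (a := a) (x := x) (v := v) (t := 0) (by simpa using hf)
  rw [hasDerivAt_iff_tendsto_slope] at h
  refine h.congr fun t => ?_
  rw [slope_def_field]; simp

variable {p lam R₀ R₁ s : ℝ} {e : E} {u : E → ℝ}

theorem Dat.zero_frontier (h : Dat p lam R₀ R₁ s e u) : ∀ x ∈ frontier (An e R₀ R₁ s), u x = 0 := by
  intro x hx
  rw [isOpen_An.frontier_eq] at hx
  obtain ⟨hx1, hx2⟩ := hx
  have c1 : ‖x‖ ≤ R₁ := closure_minimal (fun y (hy : _ ∧ _) => le_of_lt hy.1)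
      (isClosed_le continuous_norm continuous_const) hx1
  have c2 : R₀ ≤ ‖x - s • e‖ := closure_minimal (fun y (hy : _ ∧ _) => le_of_lt hy.2)
      (isClosed_le continuous_const (by fun_prop : Continuous fun x : E => ‖x - s • e‖)) hx1
  rcases c1.eq_or_lt with e1 | l1
  · exact h.zout x e1
  rcases c2.eq_or_lt with e2 | l2
  · exact h.zin x e2.symm
  exact absurd ⟨l1, l2⟩ hx2

theorem pw_num {p : ℝ} (hp : 1 < p) {θ : ℝ} (h0 : 0 ≤ θ) (h1 : θ ≤ 1) (a b d : E) :
    ‖(1 - θ) • a + θ • b + d‖ ^ p ≤ (1 - θ) * ‖a‖ ^ p + θ * ‖b‖ ^ p + p * ⟪flux p ((1 - θ) • a + θ • b + d), d⟫ := by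
  set m := (1 - θ) • a + θ • b + d with hm
  have pa := (picone hp a m).1
  have pb := (picone hp b m).1
  have key : ‖m‖ ^ p = (1 - θ) * ⟪flux p m, a⟫ + θ * ⟪flux p m, b⟫ + ⟪flux p m, d⟫ := by
    rw [← inner_flux_self hp m]
    conv_lhs => rw [hm, inner_add_right, inner_add_right, ← hm, real_inner_smul_right, real_inner_smul_right]
  have q1 := mul_nonneg (sub_nonneg.2 h1) pa
  have q2 := mul_nonneg h0 pb
  nlinarith

theorem pw_den {p : ℝ} (hp : 1 < p) {θ a b : ℝ} (h0 : 0 ≤ θ) (h1 : θ ≤ 1) (ha : 0 ≤ a) (hb : 0 ≤ b) :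
    (1 - θ) * a ^ p + θ * b ^ p - p * (θ * (1 - θ) * (b ^ (p - 1) - a ^ (p - 1)) * (b - a)) ≤ ((1 - θ) * a + θ * b) ^ p := by
  have hm : 0 ≤ (1 - θ) * a + θ * b := add_nonneg (mul_nonneg (sub_nonneg.2 h1) ha) (mul_nonneg h0 hb)
  have pa := (young_nonneg hp hm ha).1
  have pb := (young_nonneg hp hm hb).1
  have q1 := mul_nonneg (sub_nonneg.2 h1) pa
  have q2 := mul_nonneg h0 pb
  have ea : a ^ p = a ^ (p - 1) * a := by
    rcases ha.eq_or_lt with rfl | ha'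
    · rw [Real.zero_rpow (by linarith), mul_zero]
    · rw [Real.rpow_sub_one ha'.ne']; field_simp
  have eb : b ^ p = b ^ (p - 1) * b := by
    rcases hb.eq_or_lt with rfl | ha'
    · rw [Real.zero_rpow (by linarith), mul_zero]
    · rw [Real.rpow_sub_one ha'.ne']; field_simp
  rw [ea] at q1 ⊢
  rw [eb] at q2 ⊢
  nlinarith

theorem lip_mul {f g : E → ℝ} {Kf Kg : ℝ≥0} (hf : LipschitzWith Kf f) (hg : LipschitzWith Kg g) {Cf Cg : ℝ}
    (hCf : ∀ x, |f x| ≤ Cf) (hCg : ∀ x, |g x| ≤ Cg) : ∃ K, LipschitzWith K (fun x => f x * g x) := by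
  have hf0 : 0 ≤ Cf := (abs_nonneg _).trans (hCf 0)
  have hg0 : 0 ≤ Cg := (abs_nonneg _).trans (hCg 0)
  refine ⟨Cf.toNNReal * Kg + Cg.toNNReal * Kf, LipschitzWith.of_dist_le_mul fun x y => ?_⟩
  have h1 := hf.dist_le_mul x y
  have h2 := hg.dist_le_mul x y
  rw [Real.dist_eq] at *
  push_cast
  rw [Real.coe_toNNReal _ hf0, Real.coe_toNNReal _ hg0]
  calc |f x * g x - f y * g y| = |f x * (g x - g y) + g y * (f x - f y)| := by congr 1; ring
    _ ≤ |f x| * |g x - g y| + |g y| * |f x - f y| := by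
        refine (abs_add_le _ _).trans ?_
        rw [abs_mul, abs_mul]
    _ ≤ Cf * (Kg * dist x y) + Cg * (Kf * dist x y) := by
        gcongr
        · exact hCf x
        · exact hCg y
    _ = _ := by ring

theorem shift_int {ψ g : E → ℝ} (hψ : Continuous ψ) (hψ0 : ∀ x, 0 ≤ ψ x) (hψ1 : ∀ x, ψ x ≤ 1)
    {S : Set E} (hS : Bornology.IsBounded S) {Cg : ℝ} (hg1 : Measurable g) (hg2 : ∀ x, |g x| ≤ Cg)
    (hg3 : ∀ x, x ∉ S → g x = 0) (w : E) :
    Integrable (fun x => (1 - ψ x) * g x + ψ x * g (x + -w)) ∧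
    ∫ x, ((1 - ψ x) * g x + ψ x * g (x + -w)) = (∫ x, g x) + ∫ x, (ψ (x + w) - ψ x) * g x := by
  have hC0 : 0 ≤ Cg := (abs_nonneg _).trans (hg2 0)
  have ig : Integrable g := integ_bdd hg1.aestronglyMeasurable hg2 hS hg3
  have iψ : ∀ θ : E → ℝ, Continuous θ → (∀ x, |θ x| ≤ 1) → Integrable fun x => θ x * g x := by
    intro θ h1 h2
    refine integ_bdd (h1.measurable.mul hg1).aestronglyMeasurable (C := Cg) (fun x => ?_) hS fun x hx => by rw [hg3 x hx, mul_zero]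
    rw [norm_mul, Real.norm_eq_abs, Real.norm_eq_abs]
    calc _ ≤ 1 * Cg := mul_le_mul (h2 x) (hg2 x) (abs_nonneg _) zero_le_one
      _ = Cg := one_mul _
  have i1 := iψ (fun x => 1 - ψ x) (by fun_prop) fun x => by rw [abs_le]; constructor <;> linarith [hψ0 x, hψ1 x]
  have i2 := iψ (fun x => ψ (x + w)) (by fun_prop) fun x => by rw [abs_le]; constructor <;> linarith [hψ0 (x + w), hψ1 (x + w)]
  have i4 := iψ (fun x => ψ (x + w) - ψ x) (by fun_prop) fun x => by
    rw [abs_le]; constructor <;> linarith [hψ0 (x + w), hψ1 (x + w), hψ0 x, hψ1 x]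
  have i3 : Integrable fun x => ψ x * g (x + -w) := by
    have := i2.comp_add_right (-w)
    simpa only [neg_add_cancel_right] using this
  refine ⟨i1.add i3, ?_⟩
  rw [integral_add i1 i3, show (∫ x, ψ x * g (x + -w)) = ∫ x, ψ (x + w) * g x from ?_, ← integral_add i1 i2, ← integral_add ig i4]
  · refine integral_congr_ae (Eventually.of_forall fun x => ?_)
    simp only; ring
  · rw [← integral_add_right_eq_self _ w]
    simp only [add_neg_cancel_right]

theorem Dat.shape (h : Dat p lam R₀ R₁ s e u) {Ku : ℝ≥0} (hLu : LipschitzWith Ku u) {Λ : ℝ → ℝ} (hΛ0 : ∀ t, 0 ≤ Λ t)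
    (hΛ : ∀ (t : ℝ) (W : E → ℝ) (K : ℝ≥0), LipschitzWith K W → (∀ x, 0 ≤ W x) → (∀ x, x ∉ An e R₀ R₁ t → W x = 0) →
      Λ t * ∫ x, |W x| ^ p ≤ ∫ x, ‖gradient W x‖ ^ p)
    (hΛs : Λ s = lam) (hd : HasDerivAt Λ 0 s) {ψ : E → ℝ} (hψ : ContDiff ℝ 1 ψ) (hψ0 : ∀ x, 0 ≤ ψ x) (hψ1 : ∀ x, ψ x ≤ 1)
    {a b : ℝ} (ha : R₀ < a) (hb : b < R₁ - s) (hψa : ∀ x, ‖x - s • e‖ < a → ψ x = 1) (hψb : ∀ x, b < ‖x - s • e‖ → ψ x = 0) :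
    ∫ x, (⟪gradient ψ x, e⟫ * (‖gradient u x‖ ^ p - lam * u x ^ p)
      - p * (⟪flux p (gradient u x), gradient ψ x⟫ * ⟪gradient u x, e⟫)) = 0 := by
  have hp := h.hp
  have hp1 : 0 < p - 1 := by linarith
  have he := h.he
  set c := s • e with hc
  set Ω := An e R₀ R₁ s with hΩdef
  have hΩ : IsOpen Ω := isOpen_An
  have hΩb : Bornology.IsBounded Ω := bdd_An
  set U := Ω.indicator u with hU
  obtain ⟨K, hK⟩ : ∃ K, LipschitzWith K U := lip_indicator' hΩ hΩb isOpen_univ (subset_univ _) h.eig.c1.contDiffOn h.zero_frontier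
  have hUz : ∀ x, x ∉ Ω → U x = 0 := fun x hx => indicator_of_notMem hx u
  have hU0 : ∀ x, 0 ≤ U x := indicator_nonneg fun x hx => (h.pos x hx).le
  obtain ⟨C, hC⟩ := lip_bdd hK hΩb hUz
  have hC0 : 0 ≤ C := (norm_nonneg _).trans (hC 0)
  have hUC : ∀ x, U x ≤ C := fun x => (le_abs_self _).trans (hC x)
  have hae := ae_grad_ind hΩ hK fun x hx => (h.pos x hx).le
  set G := gradient U with hG
  have hGK : ∀ x, ‖G x‖ ≤ K := norm_gradient_le hK
  have hGm : Measurable G := measurable_gradient U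
  have hψcs : HasCompactSupport ψ := HasCompactSupport.intro (isCompact_closedBall c b) fun x hx => hψb x (by
    rwa [mem_closedBall, dist_eq_norm, not_le] at hx)
  obtain ⟨Kψ, hKψ⟩ := ContDiff.lipschitzWith_of_hasCompactSupport hψcs hψ one_ne_zero
  have hnc : Continuous fun x : E => ‖x - c‖ := by fun_prop
  have hshell : ∀ x, gradient ψ x ≠ 0 → a ≤ ‖x - c‖ ∧ ‖x - c‖ ≤ b := by
    intro x hx
    constructor
    · by_contra hlt
      push Not at hlt
      apply hx
      have : ψ =ᶠ[𝓝 x] fun _ => 1 := by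
        filter_upwards [(isOpen_lt hnc continuous_const).mem_nhds hlt] with y hy using hψa y hy
      rw [this.gradient_eq]; exact gradient_const x _
    · by_contra hlt
      push Not at hlt
      apply hx
      have : ψ =ᶠ[𝓝 x] fun _ => 0 := by
        filter_upwards [(isOpen_lt continuous_const hnc).mem_nhds hlt] with y hy using hψb y hy
      rw [this.gradient_eq]; exact gradient_const x _
  have hUu : ∀ x ∈ Ω, HasGradientAt U (gradient u x) x := by
    intro x hx
    refine (hg_of_contDiff h.eig.c1 x).congr_of_eventuallyEq ?_
    filter_upwards [hΩ.mem_nhds hx] with y hy using indicator_of_mem hy u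
  have hGu : ∀ x ∈ Ω, G x = gradient u x := fun x hx => (hUu x hx).gradient
  have hshΩ : ∀ x, gradient ψ x ≠ 0 → x ∈ Ω := fun x hx =>
    h.mem_shell (lt_of_lt_of_le ha (hshell x hx).1) (lt_of_le_of_lt (hshell x hx).2 hb)
  set Z : ℝ → E → E := fun t x => (1 - ψ x) • gradient u x + ψ x • gradient u (x + t • (-e)) +
    (U (x + t • (-e)) - U x) • gradient ψ x with hZ
  have hGψ := continuous_gradient hψ
  have hGuc := continuous_gradient h.eig.c1
  have hUc := hK.continuous
  have hψc := hψ.continuous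
  have hUd : ∀ (t : ℝ) (x : E), |U (x + t • (-e)) - U x| ≤ K * |t| := by
    intro t x
    have := hK.dist_le_mul (x + t • (-e)) x
    rwa [Real.dist_eq, dist_eq_norm, add_sub_cancel_left, norm_smul, norm_neg, he, mul_one, Real.norm_eq_abs] at this
  have hUd2 : ∀ (t : ℝ) (x : E), |U (x + t • (-e)) - U x| ≤ C := by
    intro t x
    have h1 := hU0 x
    have h2 := hU0 (x + t • (-e))
    have h3 := hUC x
    have h4 := hUC (x + t • (-e))
    rw [abs_le]; constructor <;> linarith
  -- the four pieces
  have dD : ∀ {g : E → ℝ} {Cg : ℝ}, Measurable g → (∀ x, |g x| ≤ Cg) → (∀ x, x ∉ closure Ω → g x = 0) →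
      HasDerivAt (fun t : ℝ => ∫ x, (ψ (x + t • e) - ψ x) * g x) (∫ x, ⟪gradient ψ x, e⟫ * g x) 0 := by
    intro g Cg hg1 hg2 hg3
    refine deriv_int hΩb.closure (Kψ * Cg) ?_ ?_ ?_ ?_
    · intro t
      exact (((by fun_prop : Continuous fun x => ψ (x + t • e) - ψ x)).measurable.mul hg1).aestronglyMeasurable
    · intro t x
      have := hKψ.dist_le_mul (x + t • e) x
      rw [Real.dist_eq, dist_eq_norm, add_sub_cancel_left, norm_smul, he, mul_one, Real.norm_eq_abs] at this
      rw [abs_mul]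
      calc _ ≤ (Kψ * |t|) * Cg := mul_le_mul this (hg2 x) (abs_nonneg _) (by positivity)
        _ = _ := by ring
    · intro t x hx
      rw [hg3 x hx, mul_zero]
    · intro x
      refine ((tendsto_shift e (hg_of_contDiff hψ x)).mul_const (g x)).congr fun t => ?_
      ring
  have dT : HasDerivAt (fun t : ℝ => ∫ x, ⟪flux p (Z t x), gradient ψ x⟫ * (U (x + t • (-e)) - U x))
      (∫ x, ⟪flux p (gradient u x), gradient ψ x⟫ * (-⟪gradient u x, e⟫)) 0 := by
    refine deriv_int (S := closedBall c b) isBounded_closedBall (((Ku + Ku + C * Kψ : ℝ) ^ (p - 1) * Kψ) * K) ?_ ?_ ?_ ?_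
    · intro t
      refine Continuous.aestronglyMeasurable ?_
      refine Continuous.mul (Continuous.inner ((continuous_flux hp).comp ?_) hGψ) (by fun_prop)
      exact (((continuous_const.sub hψc).smul hGuc).add (hψc.smul (hGuc.comp (by fun_prop)))).add
        (Continuous.smul (by fun_prop) hGψ)
    · intro t x
      have hZb : ‖Z t x‖ ≤ Ku + Ku + C * Kψ := by
        have n1 : ‖(1 - ψ x) • gradient u x‖ ≤ 1 * Ku := by
          rw [norm_smul, Real.norm_of_nonneg (by linarith [hψ1 x])]
          exact mul_le_mul (by linarith [hψ0 x]) (norm_gradient_le hLu x) (norm_nonneg _) zero_le_one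
        have n2 : ‖ψ x • gradient u (x + t • (-e))‖ ≤ 1 * Ku := by
          rw [norm_smul, Real.norm_of_nonneg (hψ0 x)]
          exact mul_le_mul (hψ1 x) (norm_gradient_le hLu _) (norm_nonneg _) zero_le_one
        have n3 : ‖(U (x + t • (-e)) - U x) • gradient ψ x‖ ≤ C * Kψ := by
          rw [norm_smul, Real.norm_eq_abs]
          exact mul_le_mul (hUd2 t x) (norm_gradient_le hKψ x) (norm_nonneg _) hC0
        have := norm_add₃_le (a := (1 - ψ x) • gradient u x) (b := ψ x • gradient u (x + t • (-e))) (c := (U (x + t • (-e)) - U x) • gradient ψ x)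
        simp only [hZ]
        linarith
      rw [abs_mul]
      calc _ ≤ ((Ku + Ku + C * Kψ : ℝ) ^ (p - 1) * Kψ) * (K * |t|) := by
            refine mul_le_mul ?_ (hUd t x) (abs_nonneg _) (by positivity)
            refine (abs_real_inner_le_norm _ _).trans ?_
            rw [norm_flux hp]
            exact mul_le_mul (Real.rpow_le_rpow (norm_nonneg _) hZb hp1.le) (norm_gradient_le hKψ x) (norm_nonneg _) (by positivity)
        _ = _ := by ring
    · intro t x hx
      have : gradient ψ x = 0 := by
        by_contra hne
        exact hx (by rw [mem_closedBall, dist_eq_norm]; exact (hshell x hne).2)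
      rw [this, inner_zero_right, zero_mul]
    · intro x
      by_cases hx : gradient ψ x = 0
      · simp only [hx, inner_zero_right, zero_mul, zero_div]; exact tendsto_const_nhds
      have l1 := tendsto_shift (-e) (hUu x (hshΩ x hx))
      rw [inner_neg_right] at l1
      have l2 : Tendsto (fun t => ⟪flux p (Z t x), gradient ψ x⟫) (𝓝[≠] 0) (𝓝 ⟪flux p (gradient u x), gradient ψ x⟫) := by
        have hcont : Continuous fun t => ⟪flux p (Z t x), gradient ψ x⟫ := by
          refine Continuous.inner ((continuous_flux hp).comp ?_) continuous_const
          refine (continuous_const.add (continuous_const.smul (hGuc.comp (by fun_prop)))).add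
            (Continuous.smul (by fun_prop) continuous_const)
        have := hcont.tendsto 0
        have hZ0 : Z 0 x = gradient u x := by simp only [hZ, zero_smul, add_zero, sub_self]; module
        rw [hZ0] at this
        exact this.mono_left nhdsWithin_le_nhds
      refine (l2.mul l1).congr fun t => ?_
      ring
  have dQ : HasDerivAt (fun t : ℝ => ∫ x, ψ x * (1 - ψ x) * (U (x + t • (-e)) ^ (p - 1) - U x ^ (p - 1)) * (U (x + t • (-e)) - U x))
      (∫ x : E, (0:ℝ)) 0 := by
    have hUp : Continuous fun x => U x ^ (p - 1) := hUc.rpow_const fun x => Or.inr hp1.le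
    have hUpC : ∀ x, 0 ≤ U x ^ (p - 1) ∧ U x ^ (p - 1) ≤ C ^ (p - 1) := fun x =>
      ⟨Real.rpow_nonneg (hU0 x) _, Real.rpow_le_rpow (hU0 x) (hUC x) hp1.le⟩
    refine deriv_int (S := closedBall c b) isBounded_closedBall (C ^ (p - 1) * K) ?_ ?_ ?_ ?_
    · intro t
      refine Continuous.aestronglyMeasurable ?_
      exact ((hψc.mul (continuous_const.sub hψc)).mul ((hUp.comp (by fun_prop)).sub hUp)).mul (by fun_prop)
    · intro t x
      rw [abs_mul, abs_mul]
      calc _ ≤ (1 * C ^ (p - 1)) * (K * |t|) := by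
            refine mul_le_mul (mul_le_mul ?_ ?_ (abs_nonneg _) zero_le_one) (hUd t x) (abs_nonneg _) (by positivity)
            · rw [abs_le]; constructor <;> nlinarith [hψ0 x, hψ1 x]
            · have h1 := hUpC x
              have h2 := hUpC (x + t • (-e))
              rw [abs_le]; constructor <;> linarith
        _ = _ := by ring
    · intro t x hx
      have : ψ x = 0 := hψb x (by rwa [mem_closedBall, dist_eq_norm, not_le] at hx)
      rw [this]; ring
    · intro x
      have l1 : Tendsto (fun t : ℝ => |ψ x * (1 - ψ x)| * |U (x + t • (-e)) ^ (p - 1) - U x ^ (p - 1)| * K) (𝓝[≠] 0) (𝓝 0) := by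
        have hcont : Continuous fun t : ℝ => |ψ x * (1 - ψ x)| * |U (x + t • (-e)) ^ (p - 1) - U x ^ (p - 1)| * K :=
          (continuous_const.mul ((hUp.comp (by fun_prop : Continuous fun t : ℝ => x + t • (-e))).sub continuous_const).abs).mul continuous_const
        have := hcont.tendsto 0
        simp only [zero_smul, add_zero, sub_self, abs_zero, mul_zero, zero_mul] at this
        exact this.mono_left nhdsWithin_le_nhds
      refine squeeze_zero_norm' ?_ l1
      filter_upwards [self_mem_nhdsWithin] with t ht
      rw [norm_div, Real.norm_eq_abs, Real.norm_eq_abs, div_le_iff₀ (abs_pos.2 ht), abs_mul, abs_mul, mul_assoc _ (K:ℝ)]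
      exact mul_le_mul_of_nonneg_left (hUd t x) (by positivity)
  have hgm : Measurable fun x => ‖G x‖ ^ p := hGm.norm.pow_const p
  have hgb : ∀ x, |‖G x‖ ^ p| ≤ (K:ℝ) ^ p := fun x => by
    rw [abs_of_nonneg (by positivity)]
    exact Real.rpow_le_rpow (norm_nonneg _) (hGK x) (by linarith)
  have hgz : ∀ x, x ∉ closure Ω → ‖G x‖ ^ p = 0 := fun x hx => by
    rw [hG, grad_zero_off hUz hx, norm_zero, Real.zero_rpow (by linarith)]
  have hum : Measurable fun x => U x ^ p := hUc.measurable.pow_const p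
  have hub : ∀ x, |U x ^ p| ≤ C ^ p := fun x => by
    rw [abs_of_nonneg (Real.rpow_nonneg (hU0 x) _)]
    exact Real.rpow_le_rpow (hU0 x) (hUC x) (by linarith)
  have huz : ∀ x, x ∉ closure Ω → U x ^ p = 0 := fun x hx => by
    rw [hUz x fun h => hx (subset_closure h), Real.zero_rpow (by linarith)]
  have dg := dD hgm hgb hgz
  have du := dD hum hub huz
  -- energy
  have energy : ∫ x, ‖G x‖ ^ p = lam * ∫ x, U x ^ p := by
    have := h.eig.weak U K hK hU0 hUz
    rw [show (∫ x, ‖G x‖ ^ p) = ∫ x, ⟪flux p (gradient u x), gradient U x⟫ from ?_, this]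
    · congr 1
      refine integral_congr_ae (Eventually.of_forall fun x => ?_)
      simp only
      by_cases hx : x ∈ Ω
      · have hup := h.pos x hx
        rw [hU, indicator_of_mem hx, Real.rpow_sub_one hup.ne']; field_simp
      · rw [hUz x hx, mul_zero, Real.zero_rpow (by linarith)]
    · refine integral_congr_ae ?_
      filter_upwards [hae] with x hx
      rw [← hG, hx]
      by_cases hxΩ : x ∈ Ω
      · rw [indicator_of_mem hxΩ, inner_flux_self hp]
      · rw [indicator_of_notMem hxΩ, inner_zero_right, norm_zero, Real.zero_rpow (by linarith)]
  have hΛd : HasDerivAt (fun t => Λ (s + t)) 0 0 := by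
    have : HasDerivAt Λ 0 (s + 0) := by rwa [add_zero]
    exact this.comp_const_add s 0
  have hH := ((dg.const_add (∫ x, ‖G x‖ ^ p)).add (dT.const_mul p)).sub
    (hΛd.mul ((du.const_add (∫ x, U x ^ p)).sub (dQ.const_mul p)))
  have hmin : IsLocalMin ((((fun t : ℝ => (∫ x, ‖G x‖ ^ p) + ∫ x, (ψ (x + t • e) - ψ x) * ‖G x‖ ^ p) +
      fun t : ℝ => p * ∫ x, ⟪flux p (Z t x), gradient ψ x⟫ * (U (x + t • (-e)) - U x)) -
      (fun t => Λ (s + t)) * ((fun t : ℝ => (∫ x, U x ^ p) + ∫ x, (ψ (x + t • e) - ψ x) * U x ^ p) -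
        fun t : ℝ => p * ∫ x, ψ x * (1 - ψ x) * (U (x + t • (-e)) ^ (p - 1) - U x ^ (p - 1)) * (U (x + t • (-e)) - U x)))) 0 := by
    have hev : ∀ᶠ t in 𝓝 (0:ℝ), |t| < min (a - R₀) (R₁ - s - b) := by
      have : Tendsto (fun t : ℝ => |t|) (𝓝 0) (𝓝 |0|) := continuous_abs.tendsto 0
      rw [abs_zero] at this
      exact this.eventually_lt_const (lt_min (by linarith) (by linarith))
    filter_upwards [hev] with t ht
    have ht1 := lt_of_lt_of_le ht (min_le_left _ _)
    have ht2 := lt_of_lt_of_le ht (min_le_right _ _)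
    simp only [Pi.add_apply, Pi.sub_apply, Pi.mul_apply, zero_smul, add_zero, sub_self, zero_mul, mul_zero, integral_zero, sub_zero]
    rw [hΛs, energy, sub_self, ← energy]
    have hte : t • (-e) = -(t • e) := smul_neg t e
    obtain ⟨ig, sg1⟩ := shift_int hψc hψ0 hψ1 hΩb.closure hgm hgb hgz (t • e)
    obtain ⟨iu, su1⟩ := shift_int hψc hψ0 hψ1 hΩb.closure hum hub huz (t • e)
    rw [← hte] at ig sg1 iu su1
    rw [← sg1, ← su1]
    set Ut : E → ℝ := fun x => U (x + t • (-e)) with hUt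
    have hKt : LipschitzWith K Ut := by
      refine LipschitzWith.of_dist_le_mul fun x y => ?_
      have := hK.dist_le_mul (x + t • (-e)) (y + t • (-e))
      rwa [dist_add_right] at this
    have hGt : ∀ x, gradient Ut x = G (x + t • (-e)) := by
      intro x
      simp only [hUt, hG, gradient, fderiv_comp_add_right]
    set W : E → ℝ := fun x => (1 - ψ x) * U x + ψ x * Ut x with hW
    have hW0 : ∀ x, 0 ≤ W x := fun x => add_nonneg (mul_nonneg (by linarith [hψ1 x]) (hU0 x)) (mul_nonneg (hψ0 x) (hU0 _))
    obtain ⟨KW, hKW⟩ : ∃ KW, LipschitzWith KW W := by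
      obtain ⟨K1, h1⟩ := lip_mul ((LipschitzWith.const (1:ℝ)).sub hKψ) hK (Cf := 1) (Cg := C)
        (fun x => by rw [abs_le]; constructor <;> linarith [hψ0 x, hψ1 x]) hC
      obtain ⟨K2, h2⟩ := lip_mul hKψ hKt (Cf := 1) (Cg := C)
        (fun x => by rw [abs_le]; constructor <;> linarith [hψ0 x, hψ1 x]) (fun x => hC _)
      exact ⟨_, h1.add h2⟩
    have hWz : ∀ x, x ∉ An e R₀ R₁ (s + t) → W x = 0 := by
      intro x hx
      simp only [hW]
      by_cases h1 : ‖x‖ < R₁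
      · have h2 : ‖x - (s + t) • e‖ ≤ R₀ := by
          by_contra h2
          push Not at h2
          exact hx ⟨h1, h2⟩
        have h3 : Ut x = 0 := hUz _ fun hm => by
          have := hm.2
          rw [show x + t • (-e) - s • e = x - (s + t) • e by module] at this
          linarith
        have h4 : ψ x = 1 := hψa x (by
          have := norm_add_le (x - (s + t) • e) (t • e)
          rw [show x - (s + t) • e + t • e = x - c by rw [hc]; module, norm_smul, he, mul_one, Real.norm_eq_abs] at this
          linarith)
        rw [h3, h4]; ring
      · push Not at h1
        have h3 : U x = 0 := hUz _ fun hm => by linarith [hm.1]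
        have h4 : ψ x = 0 := hψb x (by
          have := norm_add_le (x - c) c
          rw [sub_add_cancel, hc, norm_smul, he, mul_one, Real.norm_of_nonneg h.hs.le] at this
          linarith)
        rw [h3, h4]; ring
    have main := hΛ (s + t) W KW hKW hW0 hWz
    have iT : Integrable fun x => p * (⟪flux p (Z t x), gradient ψ x⟫ * (Ut x - U x)) := by
      refine Continuous.integrable_of_hasCompactSupport ?_ ?_
      · refine continuous_const.mul (Continuous.mul (Continuous.inner ((continuous_flux hp).comp ?_) hGψ) (by fun_prop))
        exact (((continuous_const.sub hψc).smul hGuc).add (hψc.smul (hGuc.comp (by fun_prop)))).add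
          (Continuous.smul (by fun_prop) hGψ)
      · refine HasCompactSupport.intro (isCompact_closedBall c b) fun x hx => ?_
        have : gradient ψ x = 0 := by
          by_contra hne
          exact hx (by rw [mem_closedBall, dist_eq_norm]; exact (hshell x hne).2)
        rw [this, inner_zero_right, zero_mul, mul_zero]
    have hUp : Continuous fun x => U x ^ (p - 1) := hUc.rpow_const fun x => Or.inr hp1.le
    have iQ : Integrable fun x => p * (ψ x * (1 - ψ x) * (Ut x ^ (p - 1) - U x ^ (p - 1)) * (Ut x - U x)) := by
      refine Continuous.integrable_of_hasCompactSupport ?_ ?_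
      · exact continuous_const.mul (((hψc.mul (continuous_const.sub hψc)).mul ((hUp.comp (by fun_prop)).sub hUp)).mul (by fun_prop))
      · refine HasCompactSupport.intro (isCompact_closedBall c b) fun x hx => ?_
        have : ψ x = 0 := hψb x (by rwa [mem_closedBall, dist_eq_norm, not_le] at hx)
        rw [this]; ring
    have hSb : Bornology.IsBounded (An e R₀ R₁ (s + t)) := bdd_An
    have iW : Integrable fun x => ‖gradient W x‖ ^ p := by
      refine integ_bdd ((measurable_gradient W).norm.pow_const p).aestronglyMeasurable (C := (KW:ℝ) ^ p) (fun x => ?_) hSb.closure fun x hx => ?_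
      · rw [Real.norm_of_nonneg (by positivity)]
        exact Real.rpow_le_rpow (norm_nonneg _) (norm_gradient_le hKW x) (by linarith)
      · rw [grad_zero_off hWz hx, norm_zero, Real.zero_rpow (by linarith)]
    have iWp : Integrable fun x => |W x| ^ p := by
      refine Continuous.integrable_of_hasCompactSupport (hKW.continuous.abs.rpow_const fun x => Or.inr (by linarith)) ?_
      refine HasCompactSupport.intro hSb.isCompact_closure fun x hx => ?_
      rw [hWz x fun h => hx (subset_closure h), abs_zero, Real.zero_rpow (by linarith)]
    have num : ∫ x, ‖gradient W x‖ ^ p ≤ (∫ x, ((1 - ψ x) * ‖G x‖ ^ p + ψ x * ‖G (x + t • (-e))‖ ^ p)) +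
        p * ∫ x, ⟪flux p (Z t x), gradient ψ x⟫ * (Ut x - U x) := by
      rw [← integral_const_mul, ← integral_add ig iT]
      refine integral_mono_ae iW (ig.add iT) ?_
      filter_upwards [ae_hg hK, ae_hg hKt] with x h1 h2
      rw [hGt] at h2
      have hgW : gradient W x = (1 - ψ x) • G x + ψ x • G (x + t • (-e)) + (Ut x - U x) • gradient ψ x := by
        have := (hg_add (hg_mul (hg_const_sub 1 (hg_of_contDiff hψ x)) h1) (hg_mul (hg_of_contDiff hψ x) h2)).gradient
        rw [this]; module
      have pw := pw_num hp (hψ0 x) (hψ1 x) (G x) (G (x + t • (-e))) ((Ut x - U x) • gradient ψ x)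
      rw [← hgW, real_inner_smul_right] at pw
      refine pw.trans (le_of_eq ?_)
      congr 2
      rw [mul_comm]
      by_cases hx : gradient ψ x = 0
      · rw [hx]; simp
      · congr 3
        rw [hgW]
        have hx2 : x + t • (-e) ∈ Ω := by
          have e1 : x - c = (x + t • (-e) - s • e) + t • e := by rw [hc]; module
          have e2 : x + t • (-e) - s • e = (x - c) + t • (-e) := by rw [hc]; module
          have n1 := norm_add_le (x + t • (-e) - s • e) (t • e)
          have n2 := norm_add_le (x - c) (t • (-e))
          rw [← e1, norm_smul, he, mul_one, Real.norm_eq_abs] at n1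
          rw [← e2, norm_smul, norm_neg, he, mul_one, Real.norm_eq_abs] at n2
          have := hshell x hx
          exact h.mem_shell (by linarith) (by linarith)
        rw [hGu x (hshΩ x hx), hGu _ hx2]
    have den : (∫ x, ((1 - ψ x) * U x ^ p + ψ x * U (x + t • (-e)) ^ p)) -
        p * ∫ x, ψ x * (1 - ψ x) * (Ut x ^ (p - 1) - U x ^ (p - 1)) * (Ut x - U x) ≤ ∫ x, |W x| ^ p := by
      rw [← integral_const_mul, ← integral_sub iu iQ]
      refine integral_mono (iu.sub iQ) iWp fun x => ?_
      change _ - _ ≤ |W x| ^ p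
      rw [abs_of_nonneg (hW0 x)]
      exact pw_den hp (hψ0 x) (hψ1 x) (hU0 x) (hU0 _)
    have := mul_le_mul_of_nonneg_left den (hΛ0 (s + t))
    linarith
  have key := hmin.hasDerivAt_eq_zero hH
  rw [zero_mul, add_zero, zero_add, hΛs, integral_zero, mul_zero, sub_zero] at key
  rw [← key]
  have z0 : ∀ x, x ∉ closedBall c b → gradient ψ x = 0 := fun x hx => by
    by_contra hne
    exact hx (by rw [mem_closedBall, dist_eq_norm]; exact (hshell x hne).2)
  have j1 : Integrable fun x => ⟪gradient ψ x, e⟫ * ‖gradient u x‖ ^ p := by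
    refine Continuous.integrable_of_hasCompactSupport ((hGψ.inner continuous_const).mul (hGuc.norm.rpow_const fun x => Or.inr (by linarith))) ?_
    exact HasCompactSupport.intro (isCompact_closedBall c b) fun x hx => by rw [z0 x hx, inner_zero_left, zero_mul]
  have j2 : Integrable fun x => ⟪gradient ψ x, e⟫ * u x ^ p := by
    refine Continuous.integrable_of_hasCompactSupport ((hGψ.inner continuous_const).mul (h.eig.c1.continuous.rpow_const fun x => Or.inr (by linarith))) ?_
    exact HasCompactSupport.intro (isCompact_closedBall c b) fun x hx => by rw [z0 x hx, inner_zero_left, zero_mul]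
  have j3 : Integrable fun x => ⟪flux p (gradient u x), gradient ψ x⟫ * (-⟪gradient u x, e⟫) := by
    refine Continuous.integrable_of_hasCompactSupport ((((continuous_flux hp).comp hGuc).inner hGψ).mul (hGuc.inner continuous_const).neg) ?_
    exact HasCompactSupport.intro (isCompact_closedBall c b) fun x hx => by rw [z0 x hx, inner_zero_right, zero_mul]
  have k1 : ∫ x, ⟪gradient ψ x, e⟫ * ‖G x‖ ^ p = ∫ x, ⟪gradient ψ x, e⟫ * ‖gradient u x‖ ^ p := by
    refine integral_congr_ae (Eventually.of_forall fun x => ?_)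
    simp only
    by_cases hx : gradient ψ x = 0
    · rw [hx, inner_zero_left, zero_mul, zero_mul]
    · rw [hGu x (hshΩ x hx)]
  have k2 : ∫ x, ⟪gradient ψ x, e⟫ * U x ^ p = ∫ x, ⟪gradient ψ x, e⟫ * u x ^ p := by
    refine integral_congr_ae (Eventually.of_forall fun x => ?_)
    simp only
    by_cases hx : gradient ψ x = 0
    · rw [hx, inner_zero_left, zero_mul, zero_mul]
    · rw [hU, indicator_of_mem (hshΩ x hx)]
  rw [k1, k2, ← integral_const_mul, ← integral_const_mul, ← integral_add j1 (j3.const_mul p), 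
    ← integral_sub (f := fun x => ⟪gradient ψ x, e⟫ * ‖gradient u x‖ ^ p + p * (⟪flux p (gradient u x), gradient ψ x⟫ * -⟪gradient u x, e⟫))
      (j1.add (j3.const_mul p)) (j2.const_mul lam)]
  refine integral_congr_ae (Eventually.of_forall fun x => ?_)
  simp only
  ring
end shape
end PL
end part8

section part9
open MeasureTheory Metric Set Filter
open scoped RealInnerProductSpace ENNReal Topology NNReal
namespace PL
section cut
variable {E : Type*} [NormedAddCommGroup E] [InnerProductSpace ℝ E] [FiniteDimensional ℝ E] [MeasurableSpace E] [BorelSpace E]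

theorem near_sphere {c : E} {R : ℝ} {f g : E → ℝ} (hf : Continuous f) (hg : Continuous g)
    (hlt : ∀ z, ‖z - c‖ = R → f z < g z) :
    ∃ δ, 0 < δ ∧ ∀ x, R ≤ ‖x - c‖ → ‖x - c‖ < R + δ → f x < g x := by
  have hnc : Continuous fun x : E => ‖x - c‖ := by fun_prop
  have hcl : IsClosed {x : E | R ≤ ‖x - c‖ ∧ g x ≤ f x} :=
    (isClosed_le continuous_const hnc).inter (isClosed_le hg hf)
  have hcomp : IsCompact (closedBall c (R + 1) ∩ {x : E | R ≤ ‖x - c‖ ∧ g x ≤ f x}) :=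
    (isCompact_closedBall c (R + 1)).inter_right hcl
  obtain ⟨ρ, h1, h2⟩ := hcomp.exists_forall_le' hnc.continuousOn (a := R) (fun x hx => by
    rcases hx.2.1.eq_or_lt with e1 | l1
    · exact absurd (hlt x e1.symm) (not_lt.2 hx.2.2)
    · exact l1)
  refine ⟨min 1 (ρ - R), lt_min one_pos (by linarith), fun x hx1 hx2 => ?_⟩
  by_contra hcon
  push Not at hcon
  have l1 := min_le_left 1 (ρ - R)
  have l2 := min_le_right 1 (ρ - R)
  have := h2 x ⟨by rw [mem_closedBall, dist_eq_norm]; linarith, hx1, hcon⟩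
  linarith

theorem cutoff (c : E) {a b : ℝ} (ha : 0 < a) (hab : a < b) : ∃ ψ k : E → ℝ, ContDiff ℝ 1 ψ ∧ (∀ x, 0 ≤ ψ x) ∧ (∀ x, ψ x ≤ 1) ∧
    (∀ x, ‖x - c‖ < a → ψ x = 1) ∧ (∀ x, b < ‖x - c‖ → ψ x = 0) ∧ Continuous k ∧ (∀ x, 0 ≤ k x) ∧
    (∀ x, HasGradientAt ψ (-(k x) • (x - c)) x) ∧ (∀ x y, ‖x - c‖ = ‖y - c‖ → k x = k y) ∧
    (∀ x, k x ≠ 0 → a ≤ ‖x - c‖ ∧ ‖x - c‖ ≤ b) := by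
  have hd : 0 < b ^ 2 - a ^ 2 := by nlinarith
  have hst : ContDiff ℝ 1 Real.smoothTransition := Real.smoothTransition.contDiff (n := 1)
  have hns : ContDiff ℝ 1 (fun x : E => ‖x - c‖ ^ 2) := (contDiff_id.sub contDiff_const).norm_sq ℝ
  set l : ℝ → ℝ := fun t => (b ^ 2 - t) / (b ^ 2 - a ^ 2) with hl
  have hl1 : ContDiff ℝ 1 l := (contDiff_const.sub contDiff_id).div_const _
  set ψ : E → ℝ := fun x => Real.smoothTransition (l (‖x - c‖ ^ 2)) with hψ
  set k : E → ℝ := fun x => 2 * (deriv Real.smoothTransition (l (‖x - c‖ ^ 2)) / (b ^ 2 - a ^ 2)) with hk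
  have hder : Continuous (deriv Real.smoothTransition) := hst.continuous_deriv le_rfl
  have hψ1 : ∀ x, ‖x - c‖ < a → ψ x = 1 := fun x hx => by
    refine Real.smoothTransition.one_of_one_le ?_
    rw [hl, one_le_div hd]
    nlinarith [norm_nonneg (x - c)]
  have hψ0 : ∀ x, b < ‖x - c‖ → ψ x = 0 := fun x hx => by
    refine Real.smoothTransition.zero_of_nonpos ?_
    refine div_nonpos_of_nonpos_of_nonneg ?_ hd.le
    nlinarith [norm_nonneg (x - c)]
  have hgr : ∀ x, HasGradientAt ψ (-(k x) • (x - c)) x := by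
    intro x
    have h1 : HasDerivAt (fun t => Real.smoothTransition (l t))
        (deriv Real.smoothTransition (l (‖x - c‖ ^ 2)) * (-1 / (b ^ 2 - a ^ 2))) (‖x - c‖ ^ 2) := by
      refine HasDerivAt.comp (‖x - c‖ ^ 2) (hst.differentiable one_ne_zero _).hasDerivAt ?_
      exact ((hasDerivAt_id _).const_sub _).div_const _
    have := hg_comp (hg_normsq c x) h1
    convert this using 1
    rw [smul_smul]; congr 1
    simp only [hk]; ring
  have hnc : Continuous fun x : E => ‖x - c‖ := by fun_prop
  refine ⟨ψ, k, hst.comp (hl1.comp hns), fun x => Real.smoothTransition.nonneg _, fun x => Real.smoothTransition.le_one _, hψ1, hψ0,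
    ?_, fun x => ?_, hgr, ?_, ?_⟩
  · exact continuous_const.mul ((hder.comp (hl1.continuous.comp hns.continuous)).div_const _)
  · exact mul_nonneg zero_le_two (div_nonneg Real.smoothTransition.monotone.deriv_nonneg hd.le)
  · intro x y hxy
    simp only [hk, hxy]
  · intro x hx
    have hx0 : gradient ψ x = 0 → x - c = 0 := by
      intro h0
      rw [(hgr x).gradient] at h0
      rcases smul_eq_zero.1 h0 with h1 | h1
      · exact absurd (neg_eq_zero.1 h1) hx
      · exact h1
    constructor
    · by_contra hlt
      push Not at hlt
      have h1 : 1 ≤ l (‖x - c‖ ^ 2) := by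
        rw [hl, one_le_div hd]; nlinarith [norm_nonneg (x - c)]
      apply hx
      have h2 : 1 < l (‖x - c‖ ^ 2) := by
        rw [hl, one_lt_div hd]; nlinarith [norm_nonneg (x - c)]
      have : Real.smoothTransition =ᶠ[𝓝 (l (‖x - c‖ ^ 2))] fun _ => 1 := by
        filter_upwards [lt_mem_nhds h2] with t ht using Real.smoothTransition.one_of_one_le ht.le
      simp only [hk, this.deriv_eq, deriv_const, zero_div, mul_zero]
    · by_contra hlt
      push Not at hlt
      apply hx
      have h2 : l (‖x - c‖ ^ 2) < 0 := by
        refine div_neg_of_neg_of_pos ?_ hd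
        nlinarith [norm_nonneg (x - c)]
      have : Real.smoothTransition =ᶠ[𝓝 (l (‖x - c‖ ^ 2))] fun _ => 0 := by
        filter_upwards [gt_mem_nhds h2] with t ht using Real.smoothTransition.zero_of_nonpos ht.le
      simp only [hk, this.deriv_eq, deriv_const, zero_div, mul_zero]

theorem pow_gap {p μ α β y : ℝ} (hp : 1 < p) (hμ : 0 < μ) (ha : μ ≤ α) (hb : μ ≤ β) (hy : 0 ≤ y * (β - α)) :
    μ * (|y| * |β ^ (p - 1) - α ^ (p - 1)|) ≤ y * (β ^ p - α ^ p) := by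
  have ha0 := hμ.trans_le ha
  have hb0 := hμ.trans_le hb
  have ea : α ^ p = α ^ (p - 1) * α := by rw [Real.rpow_sub_one ha0.ne']; field_simp
  have eb : β ^ p = β ^ (p - 1) * β := by rw [Real.rpow_sub_one hb0.ne']; field_simp
  have pa : 0 < α ^ (p - 1) := Real.rpow_pos_of_pos ha0 _
  have pb : 0 < β ^ (p - 1) := Real.rpow_pos_of_pos hb0 _
  have gap : ∀ a b : ℝ, μ ≤ a → a ≤ b → 0 ≤ b ^ (p - 1) - a ^ (p - 1) ∧
      μ * (b ^ (p - 1) - a ^ (p - 1)) ≤ b ^ (p - 1) * b - a ^ (p - 1) * a := by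
    intro a b h1 h2
    have h3 : a ^ (p - 1) ≤ b ^ (p - 1) := Real.rpow_le_rpow (by linarith) h2 (by linarith)
    have h4 : 0 < b ^ (p - 1) := Real.rpow_pos_of_pos (by linarith) _
    refine ⟨by linarith, ?_⟩
    nlinarith
  rw [ea, eb]
  rcases lt_trichotomy y 0 with h1 | h1 | h1
  · have : β ≤ α := by nlinarith
    obtain ⟨g1, g2⟩ := gap β α hb this
    rw [abs_of_neg h1, abs_sub_comm, abs_of_nonneg g1]
    nlinarith
  · rw [h1]; simp
  · have : α ≤ β := by nlinarith
    obtain ⟨g1, g2⟩ := gap α β ha this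
    rw [abs_of_pos h1, abs_of_nonneg g1]
    nlinarith

variable {p lam R₀ R₁ s : ℝ} {e : E} {u : E → ℝ}

theorem Dat.sgn (h : Dat p lam R₀ R₁ s e u) {z : E} (hz : ‖z - s • e‖ = R₀) (hy : 0 < ⟪e, z - s • e⟫) :
    ⟪gradient u z, z - s • e⟫ ≤ ⟪gradient (fun x => u (sg e s x)) z, z - s • e⟫ := by
  have hR := h.h0
  have he := h.he
  have hs' := h.hs'
  set c := s • e with hc
  set y := z - c with hyd
  have hz1 : c + (1:ℝ) • y = z := by simp [hyd]
  have hvE := (h.eig.refl h.he s).c1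
  have hd := hg_line (x := c) (v := y) (t := 1) (hg_sub (hg_of_contDiff hvE (c + (1:ℝ) • y)) (hg_of_contDiff h.eig.c1 (c + (1:ℝ) • y)))
  have := deriv_nonneg_right (b := (R₁ - s) / R₀) ((one_lt_div hR).2 (by linarith)) hd
    (by
      have e2 : u (sg e s z) = 0 := h.zin _ (by rw [norm_sg_sub he]; exact hz)
      simp only [hz1, h.zin z hz, e2, sub_zero]) (fun t ht => by
      have ht0 : 0 < t := zero_lt_one.trans ht.1
      have hnt : ‖c + t • y - c‖ = t * R₀ := by
        rw [add_sub_cancel_left, norm_smul, Real.norm_of_nonneg ht0.le, hz]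
      have h1 : R₀ < ‖c + t • y - c‖ := by rw [hnt]; nlinarith [ht.1]
      have h2 : ‖c + t • y - c‖ < R₁ - s := by rw [hnt]; exact (lt_div_iff₀ hR).1 ht.2
      have := h.cmp h1 (h.mem_shell h1 h2).1 (by
        rw [inner_add_right, hc, real_inner_smul_right, real_inner_smul_right, ee he]
        have := mul_pos ht0 hy
        linarith)
      linarith)
  rw [hz1, inner_sub_left] at this
  linarith

theorem Dat.sphere (h : Dat p lam R₀ R₁ s e u) : ∃ μ, 0 < μ ∧ ∀ z, ‖z - s • e‖ = R₀ → ∃ α β, μ ≤ α ∧ μ ≤ β ∧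
    gradient u z = α • (z - s • e) ∧ gradient (fun x => u (sg e s x)) z = β • (z - s • e) ∧ 0 ≤ ⟪e, z - s • e⟫ * (β - α) := by
  obtain ⟨m, hm, hm2⟩ := h.hopf
  have hR := h.h0
  have he := h.he
  refine ⟨m / R₀ ^ 2, by positivity, fun z hz => ?_⟩
  have hz2 : ‖sg e s z - s • e‖ = R₀ := by rw [norm_sg_sub he, hz]
  have gv : ⟪gradient (fun x => u (sg e s x)) z, z - s • e⟫ = ⟪gradient u (sg e s z), sg e s z - s • e⟫ := by
    rw [grad_sg he, sg_sub he, Rf_symm he]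
  refine ⟨⟪gradient u z, z - s • e⟫ / R₀ ^ 2, ⟪gradient (fun x => u (sg e s x)) z, z - s • e⟫ / R₀ ^ 2, ?_, ?_, h.grad_in hz, ?_, ?_⟩
  · have := hm2 z hz; gcongr
  · rw [gv]; have := hm2 _ hz2; gcongr
  · rw [gv, grad_sg he]
    conv_lhs => rw [h.grad_in hz2, Rf_smul]
    rw [sg_sub he, Rf_Rf he]
  · rw [← sub_div]
    have hR2 : 0 < R₀ ^ 2 := by positivity
    rw [← mul_div_assoc]
    refine div_nonneg ?_ hR2.le
    rcases lt_trichotomy ⟪e, z - s • e⟫ 0 with h1 | h1 | h1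
    · have := h.sgn hz2 (by rw [sg_sub he, inner_Rf he]; linarith)
      rw [grad_sg he, sg_sg he, ← gv, sg_sub he, Rf_inner he] at this
      nlinarith
    · rw [h1, zero_mul]
    · have := h.sgn hz h1
      nlinarith
end cut
end PL
end part9

section part10
open MeasureTheory Metric Set Filter
open scoped RealInnerProductSpace ENNReal Topology NNReal
namespace PL
section cut2
variable {E : Type*} [NormedAddCommGroup E] [InnerProductSpace ℝ E] [FiniteDimensional ℝ E] [MeasurableSpace E] [BorelSpace E]
variable {p lam R₀ R₁ s : ℝ} {e : E} {u : E → ℝ}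

/-- The quantity appearing in the domain variation. -/
noncomputable def Bq (p lam s : ℝ) (e : E) (w : E → ℝ) (x : E) : ℝ :=
  ⟪x - s • e, e⟫ * (‖gradient w x‖ ^ p - lam * w x ^ p) - p * (⟪flux p (gradient w x), x - s • e⟫ * ⟪gradient w x, e⟫)

theorem continuous_Bq (hp : 1 < p) {w : E → ℝ} (hw : ContDiff ℝ 1 w) : Continuous (Bq p lam s e w) := by
  have h1 := continuous_gradient hw
  have h2 : Continuous fun x => flux p (gradient w x) := (continuous_flux hp).comp h1
  have h3 : Continuous fun x => ‖gradient w x‖ ^ p := h1.norm.rpow_const fun x => Or.inr (by linarith)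
  have h4 : Continuous fun x => w x ^ p := hw.continuous.rpow_const fun x => Or.inr (by linarith)
  have h5 : Continuous fun x : E => x - s • e := by fun_prop
  unfold Bq
  exact ((h5.inner continuous_const).mul (h3.sub (continuous_const.mul h4))).sub
    (continuous_const.mul ((h2.inner h5).mul (h1.inner continuous_const)))

theorem Bq_sg (he : ‖e‖ = 1) (x : E) : Bq p lam s e u (sg e s x) = - Bq p lam s e (fun x => u (sg e s x)) x := by
  unfold Bq
  have hg : gradient u (sg e s x) = Rf e (gradient (fun x => u (sg e s x)) x) := by
    rw [grad_sg he, Rf_Rf he]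
  rw [hg, sg_sub he, Rf_norm he, flux_Rf he, Rf_inner he, real_inner_comm e (Rf e (x - s • e)), inner_Rf he,
    real_inner_comm e (Rf e (gradient _ x)), inner_Rf he, real_inner_comm (x - s • e) e, real_inner_comm (gradient _ x) e]
  ring

theorem Dat.cut (h : Dat p lam R₀ R₁ s e u)
    (hF : ∀ ψ : E → ℝ, ContDiff ℝ 1 ψ → (∀ x, 0 ≤ ψ x) → (∀ x, ψ x ≤ 1) → ∀ a b, R₀ < a → b < R₁ - s →
      (∀ x, ‖x - s • e‖ < a → ψ x = 1) → (∀ x, b < ‖x - s • e‖ → ψ x = 0) →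
      ∫ x, (⟪gradient ψ x, e⟫ * (‖gradient u x‖ ^ p - lam * u x ^ p)
      - p * (⟪flux p (gradient u x), gradient ψ x⟫ * ⟪gradient u x, e⟫)) = 0) {η : ℝ} (hη : 0 < η) :
    ∃ δ, 0 < δ ∧ ∀ a b, R₀ < a → a < b → b < R₀ + δ → ∃ ψ k : E → ℝ, ContDiff ℝ 1 ψ ∧ (∀ x, 0 ≤ ψ x) ∧ (∀ x, ψ x ≤ 1) ∧
    (∀ x, ‖x - s • e‖ < a → ψ x = 1) ∧ (∀ x, b < ‖x - s • e‖ → ψ x = 0) ∧ Continuous k ∧ (∀ x, 0 ≤ k x) ∧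
    (∀ x, gradient ψ x = -(k x) • (x - s • e)) ∧ (∀ x, k x ≠ 0 → a ≤ ‖x - s • e‖ ∧ ‖x - s • e‖ ≤ b) ∧
    ∫ x, k x * (|⟪e, x - s • e⟫| * ‖flux p (gradient (fun x => u (sg e s x)) x) - flux p (gradient u x)‖) ≤ η := by
  have hp := h.hp
  have he := h.he
  have hR := h.h0
  have hs' := h.hs'
  set c := s • e with hc
  set v : E → ℝ := fun x => u (sg e s x) with hv
  have hvC : ContDiff ℝ 1 v := (h.eig.refl he s).c1
  have huC := h.eig.c1
  set q : E → ℝ := fun x => Bq p lam s e u x - Bq p lam s e v x with hq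
  have hqc : Continuous q := (continuous_Bq hp huC).sub (continuous_Bq hp hvC)
  set P : E → ℝ := fun x => |⟪e, x - c⟫| * ‖flux p (gradient v x) - flux p (gradient u x)‖ with hP
  have hPc : Continuous P := by
    refine Continuous.mul (Continuous.abs (by fun_prop)) (Continuous.norm ?_)
    exact ((continuous_flux hp).comp (continuous_gradient hvC)).sub ((continuous_flux hp).comp (continuous_gradient huC))
  obtain ⟨μ, hμ, hsph⟩ := h.sphere
  set C := 1 / ((p - 1) * R₀ * μ) with hC
  have hp1 : 0 < p - 1 := by linarith
  have hC0 : 0 < C := by positivity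
  have hsphere : ∀ z, ‖z - c‖ = R₀ → P z ≤ C * q z := by
    intro z hz
    obtain ⟨α, β, h1, h2, h3, h4, h5⟩ := hsph z hz
    rw [← hc] at h3 h4 h5
    have hα := hμ.trans_le h1
    have hβ := hμ.trans_le h2
    have gap := pow_gap hp hμ h1 h2 h5
    have huz : u z = 0 := h.zin z hz
    have hvz : v z = 0 := h.zin _ (by rw [norm_sg_sub he]; exact hz)
    have hB : ∀ (w : E → ℝ) (α : ℝ), 0 < α → w z = 0 → gradient w z = α • (z - c) →
        Bq p lam s e w z = -((p - 1) * R₀ ^ p * ⟪e, z - c⟫ * α ^ p) := by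
      intro w α hα hw hg
      have ea : α ^ p = α ^ (p - 1) * α := by rw [Real.rpow_sub_one hα.ne']; field_simp
      unfold Bq
      rw [hw, hg, ← hc, norm_smul, Real.norm_of_nonneg hα.le, hz, Real.mul_rpow hα.le hR.le, flux_smul hp hα.le, real_inner_smul_left,
        inner_flux_self hp, hz, real_inner_smul_left, Real.zero_rpow (by linarith), real_inner_comm, ea]
      ring
    have hPz : P z = |⟪e, z - c⟫| * |β ^ (p - 1) - α ^ (p - 1)| * R₀ ^ (p - 1) := by
      simp only [hP]
      rw [h3, h4, flux_smul hp hα.le, flux_smul hp hβ.le, ← sub_smul, norm_smul, norm_flux hp, hz, Real.norm_eq_abs]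
      ring
    have eR : R₀ ^ p = R₀ ^ (p - 1) * R₀ := by rw [Real.rpow_sub_one hR.ne']; field_simp
    simp only [hq]
    rw [hPz, hB u α hα huz h3, hB v β hβ hvz h4, hC, eR]
    rw [one_div, inv_mul_eq_div, le_div_iff₀ (by positivity)]
    have hRp : 0 < R₀ ^ (p - 1) := by positivity
    have := mul_le_mul_of_nonneg_left gap (by positivity : 0 ≤ (p - 1) * R₀ ^ (p - 1) * R₀)
    nlinarith
  set N : ℝ := (Module.finrank ℝ E : ℝ) with hN
  set V : ℝ := volume.real (closedBall c R₁) with hV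
  set M := N * V / R₀ ^ 2 + 1 with hM
  have hM0 : 0 < M := by positivity
  obtain ⟨δ, hδ, hδ2⟩ := near_sphere (c := c) (R := R₀) (f := P) (g := fun x => C * q x + η / M) hPc (by fun_prop)
    (fun z hz => by have := hsphere z hz; have : 0 < η / M := by positivity
                    linarith)
  refine ⟨min δ (R₁ - s - R₀), lt_min hδ (by linarith), fun a b ha hab hb => ?_⟩
  obtain ⟨ψ, k, hψC, hψ0, hψ1, hψa, hψb, hkc, hk0, hg, hkr, hks⟩ := cutoff c (hR.trans ha) hab
  have hb1 : b < R₀ + δ := by linarith [min_le_left δ (R₁ - s - R₀)]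
  have hb2 : b < R₁ - s := by linarith [min_le_right δ (R₁ - s - R₀)]
  refine ⟨ψ, k, hψC, hψ0, hψ1, hψa, hψb, hkc, hk0, fun x => (hg x).gradient, hks, ?_⟩
  have hkz : ∀ x, x ∉ closedBall c b → k x = 0 := fun x hx => by
    by_contra hne
    exact hx (by rw [mem_closedBall, dist_eq_norm]; exact (hks x hne).2)
  have ik : ∀ f : E → ℝ, Continuous f → Integrable fun x => k x * f x := fun f hf =>
    (hkc.mul hf).integrable_of_hasCompactSupport (HasCompactSupport.intro (isCompact_closedBall c b) fun x hx => by simp [hkz x hx])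
  have hBu : ∫ x, k x * Bq p lam s e u x = 0 := by
    have := hF ψ hψC hψ0 hψ1 a b ha hb2 hψa hψb
    rw [← neg_eq_zero, ← integral_neg, ← this]
    refine integral_congr_ae (Eventually.of_forall fun x => ?_)
    simp only [(hg x).gradient, Bq, ← hc]
    rw [real_inner_smul_left, real_inner_smul_right]
    ring
  have hBv : ∫ x, k x * Bq p lam s e v x = 0 := by
    rw [← neg_eq_zero, ← integral_neg, ← hBu, ← int_sg he s (fun x => k x * Bq p lam s e u x)]
    refine integral_congr_ae (Eventually.of_forall fun x => ?_)
    simp only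
    rw [Bq_sg he, hkr (sg e s x) x (norm_sg_sub he s x)]
    ring
  have hqi : ∫ x, k x * q x = 0 := by
    simp only [hq, mul_sub]
    rw [integral_sub (ik _ (continuous_Bq hp huC)) (ik _ (continuous_Bq hp hvC)), hBu, hBv, sub_zero]
  have hψcs : HasCompactSupport ψ := HasCompactSupport.intro (isCompact_closedBall c b) fun x hx => hψb x (by
    rwa [mem_closedBall, dist_eq_norm, not_le] at hx)
  obtain ⟨Kψ, hKψ⟩ := ContDiff.lipschitzWith_of_hasCompactSupport hψcs hψC one_ne_zero
  have hψz : ∀ x, x ∉ closedBall c R₁ → ψ x = 0 := fun x hx => hψb x (by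
    rw [mem_closedBall, dist_eq_norm, not_le] at hx
    linarith [h.hs])
  have hki : ∫ x, k x * 1 ≤ M := by
    have eul := euler_lip hKψ (isBounded_closedBall (x := c) (r := R₁)) hψz c
    have e1 : ∫ x, ⟪gradient ψ x, x - c⟫ = - ∫ x, k x * ‖x - c‖ ^ 2 := by
      rw [← integral_neg]
      refine integral_congr_ae (Eventually.of_forall fun x => ?_)
      simp only [(hg x).gradient]
      rw [real_inner_smul_left, real_inner_self_eq_norm_sq]
      ring
    have e2 : ∫ x, ψ x ≤ V := by
      have : ∫ x, ψ x ≤ ∫ x, (closedBall c R₁).indicator (fun _ => (1:ℝ)) x := by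
        refine integral_mono (hψC.continuous.integrable_of_hasCompactSupport hψcs)
          (IntegrableOn.integrable_indicator (integrableOn_const (isCompact_closedBall c R₁).measure_lt_top.ne) measurableSet_closedBall) fun x => ?_
        by_cases hx : x ∈ closedBall c R₁
        · rw [indicator_of_mem hx]; exact hψ1 x
        · rw [indicator_of_notMem hx, hψz x hx]
      rw [integral_indicator measurableSet_closedBall] at this
      simpa [hV] using this
    have e3 : R₀ ^ 2 * ∫ x, k x * 1 ≤ ∫ x, k x * ‖x - c‖ ^ 2 := by
      rw [← integral_const_mul]
      refine integral_mono ((ik (fun _ => 1) continuous_const).const_mul _) (ik _ (by fun_prop)) fun x => ?_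
      by_cases hx : k x = 0
      · simp [hx]
      · have h1 := (hks x hx).1
        have h2 : R₀ ^ 2 ≤ ‖x - c‖ ^ 2 := pow_le_pow_left₀ hR.le (by linarith) 2
        have h3 := hk0 x
        simp only
        nlinarith
    rw [e1] at eul
    have hN0 : 0 ≤ N := by positivity
    have e4 := mul_le_mul_of_nonneg_left e2 hN0
    have e5 : ∫ x, k x * 1 ≤ N * V / R₀ ^ 2 := by
      rw [le_div_iff₀ (by positivity)]
      linarith
    linarith
  calc ∫ x, k x * P x ≤ ∫ x, (C * (k x * q x) + η / M * (k x * 1)) := by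
        refine integral_mono (ik _ hPc) (((ik _ hqc).const_mul C).add ((ik (fun _ => 1) continuous_const).const_mul _)) fun x => ?_
        by_cases hx : k x = 0
        · simp [hx]
        · have h1 := hks x hx
          have := mul_le_mul_of_nonneg_left (hδ2 x (by linarith) (by linarith)).le (hk0 x)
          simp only at this ⊢
          linarith
    _ = η / M * ∫ x, k x * 1 := by
        rw [integral_add ((ik _ hqc).const_mul C) ((ik (fun _ => 1) continuous_const).const_mul _), integral_const_mul, integral_const_mul, hqi]
        ring
    _ ≤ η / M * M := mul_le_mul_of_nonneg_left hki (by positivity)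
    _ = η := by field_simp
end cut2
end PL
end part10

section part11
open MeasureTheory Metric Set Filter
open scoped RealInnerProductSpace ENNReal Topology NNReal
namespace PL
section logest
variable {E : Type*} [NormedAddCommGroup E] [InnerProductSpace ℝ E] [FiniteDimensional ℝ E] [MeasurableSpace E] [BorelSpace E]
variable {p lam R₀ R₁ s : ℝ} {e : E} {u : E → ℝ}

theorem Dat.shell (h : Dat p lam R₀ R₁ s e u) : ∃ r₂ κ C, R₀ < r₂ ∧ r₂ ≤ R₁ - s ∧ 0 < κ ∧ 0 < C ∧
    ∀ x, R₀ < ‖x - s • e‖ → ‖x - s • e‖ < r₂ →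
    κ * ‖gradient (fun x => u (sg e s x)) x - gradient u x‖ ^ 2 ≤
      ⟪flux p (gradient (fun x => u (sg e s x)) x) - flux p (gradient u x), gradient (fun x => u (sg e s x)) x - gradient u x⟫ ∧
    ‖flux p (gradient (fun x => u (sg e s x)) x) - flux p (gradient u x)‖ ≤
      C * ‖gradient (fun x => u (sg e s x)) x - gradient u x‖ := by
  have hp := h.hp
  have he := h.he
  have hR := h.h0
  have hs' := h.hs'
  have hs := h.hs
  set c := s • e with hc
  set v : E → ℝ := fun x => u (sg e s x) with hv
  have gu := continuous_gradient h.eig.c1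
  have gv : Continuous (gradient v) := continuous_gradient (h.eig.refl he s).c1
  obtain ⟨μ, hμ, hsph⟩ := h.sphere
  have hid : Continuous fun x : E => x - c := by fun_prop
  have l0 : μ / 2 * R₀ ^ 2 < μ * R₀ ^ 2 := by
    have : 0 < μ * R₀ ^ 2 := by positivity
    linarith
  obtain ⟨δ1, hδ1, n1⟩ := near_sphere (c := c) (R := R₀) (f := fun _ => μ / 2 * R₀ ^ 2) (g := fun x => ⟪gradient u x, x - c⟫)
    continuous_const (gu.inner hid) (fun z hz => by
      obtain ⟨α, β, h1, h2, h3, h4, h5⟩ := hsph z hz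
      rw [h3, real_inner_smul_left, real_inner_self_eq_norm_sq, hz]
      have := mul_le_mul_of_nonneg_right h1 (sq_nonneg R₀)
      linarith)
  obtain ⟨δ2, hδ2, n2⟩ := near_sphere (c := c) (R := R₀) (f := fun _ => μ / 2 * R₀ ^ 2) (g := fun x => ⟪gradient v x, x - c⟫)
    continuous_const (gv.inner hid) (fun z hz => by
      obtain ⟨α, β, h1, h2, h3, h4, h5⟩ := hsph z hz
      rw [h4, real_inner_smul_left, real_inner_self_eq_norm_sq, hz]
      have := mul_le_mul_of_nonneg_right h2 (sq_nonneg R₀)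
      linarith)
  have hR1 : 0 < R₁ := by linarith
  set m := μ / 2 * R₀ ^ 2 / R₁ with hm
  have hm0 : 0 < m := by positivity
  obtain ⟨M1, hM1⟩ := (isCompact_closedBall c R₁).exists_bound_of_continuousOn gu.continuousOn
  obtain ⟨M2, hM2⟩ := (isCompact_closedBall c R₁).exists_bound_of_continuousOn gv.continuousOn
  set M := max m (max M1 M2) with hM
  obtain ⟨κ, C, hκ, hC, hell⟩ := ellip (E := E) hp hm0 (le_max_left m (max M1 M2))
  refine ⟨min (R₁ - s) (min (R₀ + δ1) (R₀ + δ2)), κ, C, lt_min (by linarith) (lt_min (by linarith) (by linarith)),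
    min_le_left _ _, hκ, hC, fun x hx1 hx2 => ?_⟩
  rw [lt_min_iff, lt_min_iff] at hx2
  obtain ⟨a1, a2, a3⟩ := hx2
  have hr : 0 < ‖x - c‖ := hR.trans hx1
  have hball : x ∈ closedBall c R₁ := by rw [mem_closedBall, dist_eq_norm]; linarith
  have key : ∀ a : E, μ / 2 * R₀ ^ 2 < ⟪a, x - c⟫ → m ≤ ⟪a, (‖x - c‖)⁻¹ • (x - c)⟫ := by
    intro a ha
    rw [real_inner_smul_right, hm, inv_mul_eq_div]
    have h1 : 0 < μ / 2 * R₀ ^ 2 := by positivity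
    exact div_le_div₀ (by linarith) ha.le hr (by linarith)
  refine hell ((‖x - c‖)⁻¹ • (x - c)) _ _ ?_ (key _ (n2 x hx1.le a3)) (key _ (n1 x hx1.le a2))
    ((hM2 x hball).trans ((le_max_right _ _).trans (le_max_right _ _)))
    ((hM1 x hball).trans ((le_max_left _ _).trans (le_max_right _ _)))
  rw [norm_smul, norm_inv, norm_norm, inv_mul_cancel₀ hr.ne']

/-- Half shell. -/
def Sh (e : E) (R₀ r₁ s : ℝ) : Set E := {x | R₀ < ‖x - s • e‖ ∧ ‖x - s • e‖ < r₁ ∧ s < ⟪e, x⟫}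

/-- Weight function. -/
noncomputable def et (e : E) (r₁ s : ℝ) (x : E) : ℝ := (⟪e, x⟫ - s) * (r₁ ^ 2 - ‖x - s • e‖ ^ 2)

theorem isOpen_Sh {r₁ : ℝ} : IsOpen (Sh e R₀ r₁ s) :=
  (isOpen_lt continuous_const (by fun_prop : Continuous fun x : E => ‖x - s • e‖)).inter
   ((isOpen_lt (by fun_prop : Continuous fun x : E => ‖x - s • e‖) continuous_const).inter
    (isOpen_lt continuous_const (by fun_prop : Continuous fun x : E => ⟪e, x⟫)))

theorem bdd_Sh {r₁ : ℝ} : Bornology.IsBounded (Sh e R₀ r₁ s) :=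
  isBounded_ball.subset (fun x hx => by rw [mem_ball, dist_eq_norm]; exact hx.2.1 : Sh e R₀ r₁ s ⊆ ball (s • e) r₁)

theorem closure_Sh {r₁ : ℝ} {x : E} (hx : x ∈ closure (Sh e R₀ r₁ s)) : R₀ ≤ ‖x - s • e‖ ∧ ‖x - s • e‖ ≤ r₁ ∧ s ≤ ⟪e, x⟫ := by
  have : IsClosed {x : E | R₀ ≤ ‖x - s • e‖ ∧ ‖x - s • e‖ ≤ r₁ ∧ s ≤ ⟪e, x⟫} :=
    (isClosed_le continuous_const (by fun_prop : Continuous fun x : E => ‖x - s • e‖)).inter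
     ((isClosed_le (by fun_prop : Continuous fun x : E => ‖x - s • e‖) continuous_const).inter
      (isClosed_le continuous_const (by fun_prop : Continuous fun x : E => ⟪e, x⟫)))
  have hsub : Sh e R₀ r₁ s ⊆ {x : E | R₀ ≤ ‖x - s • e‖ ∧ ‖x - s • e‖ ≤ r₁ ∧ s ≤ ⟪e, x⟫} :=
    fun y hy => ⟨hy.1.le, hy.2.1.le, hy.2.2.le⟩
  exact closure_minimal hsub this hx

theorem frontier_Sh {r₁ : ℝ} {x : E} (hx : x ∈ frontier (Sh e R₀ r₁ s)) :
    ‖x - s • e‖ = R₀ ∨ ‖x - s • e‖ = r₁ ∨ ⟪e, x⟫ = s := by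
  rw [isOpen_Sh.frontier_eq] at hx
  obtain ⟨c1, c2, c3⟩ := closure_Sh hx.1
  by_contra hcon
  push Not at hcon
  exact hx.2 ⟨lt_of_le_of_ne c1 (Ne.symm hcon.1), lt_of_le_of_ne c2 hcon.2.1, lt_of_le_of_ne c3 (Ne.symm hcon.2.2)⟩

theorem et_zero {r₁ : ℝ} {x : E} (hx : ‖x - s • e‖ = r₁ ∨ ⟪e, x⟫ = s) : et e r₁ s x = 0 := by
  unfold et
  rcases hx with h | h
  · rw [h, sub_self, mul_zero]
  · rw [h, sub_self, zero_mul]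

theorem contDiff_et {r₁ : ℝ} : ContDiff ℝ 1 (et e r₁ s) :=
  ((contDiff_const.inner ℝ contDiff_id).sub contDiff_const).mul (contDiff_const.sub ((contDiff_id.sub contDiff_const).norm_sq ℝ))

theorem hg_et {r₁ : ℝ} (x : E) : HasGradientAt (et e r₁ s)
    ((⟪e, x⟫ - s) • (-((2:ℝ) • (x - s • e))) + (r₁ ^ 2 - ‖x - s • e‖ ^ 2) • e) x :=
  hg_mul (hg_inner e x s) (hg_const_sub _ (hg_normsq _ x))

theorem et_bd (he : ‖e‖ = 1) {r₁ : ℝ} {x : E} (hx : x ∈ Sh e R₀ r₁ s) :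
    0 < et e r₁ s x ∧ ⟪e, x⟫ - s ≤ r₁ ∧ et e r₁ s x ≤ (⟪e, x⟫ - s) * r₁ ^ 2 ∧ ‖gradient (et e r₁ s) x‖ ≤ 3 * r₁ ^ 2 := by
  obtain ⟨h1, h2, h3⟩ := hx
  have hr0 := norm_nonneg (x - s • e)
  have hr1 : 0 ≤ r₁ := by linarith
  have hy : ⟪e, x⟫ - s ≤ ‖x - s • e‖ := by
    rw [← inner_sub_c he]
    have := real_inner_le_norm e (x - s • e)
    rwa [he, one_mul] at this
  have hq : 0 < r₁ ^ 2 - ‖x - s • e‖ ^ 2 := by nlinarith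
  have hy0 : 0 < ⟪e, x⟫ - s := by linarith
  refine ⟨mul_pos hy0 hq, by linarith, ?_, ?_⟩
  · refine mul_le_mul_of_nonneg_left ?_ hy0.le
    nlinarith
  · rw [(hg_et x).gradient]
    refine (norm_add_le _ _).trans ?_
    rw [norm_smul, norm_neg, norm_smul, norm_smul, he, Real.norm_of_nonneg hy0.le, Real.norm_of_nonneg hq.le,
      Real.norm_of_nonneg zero_le_two]
    have : (⟪e, x⟫ - s) * ‖x - s • e‖ ≤ r₁ * r₁ := by gcongr; linarith
    nlinarith

theorem Dat.w_nonneg (h : Dat p lam R₀ R₁ s e u) {r₁ : ℝ} (hr1 : r₁ < R₁ - s) {x : E} (hx : x ∈ Sh e R₀ r₁ s) :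
    u x ≤ u (sg e s x) := by
  exact h.cmp hx.1 (h.mem_shell hx.1 (hx.2.1.trans hr1)).1 hx.2.2

theorem Dat.key (h : Dat p lam R₀ R₁ s e u)
    (hF : ∀ ψ : E → ℝ, ContDiff ℝ 1 ψ → (∀ x, 0 ≤ ψ x) → (∀ x, ψ x ≤ 1) → ∀ a b, R₀ < a → b < R₁ - s →
      (∀ x, ‖x - s • e‖ < a → ψ x = 1) → (∀ x, b < ‖x - s • e‖ → ψ x = 0) →
      ∫ x, (⟪gradient ψ x, e⟫ * (‖gradient u x‖ ^ p - lam * u x ^ p)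
      - p * (⟪flux p (gradient u x), gradient ψ x⟫ * ⟪gradient u x, e⟫)) = 0) {r₁ : ℝ} (hr : R₀ < r₁) (hr1 : r₁ < R₁ - s)
    {δ : ℝ} (hδ : 0 < δ) :
    0 ≤ ∫ x in Sh e R₀ r₁ s, ⟪flux p (gradient (fun x => u (sg e s x)) x) - flux p (gradient u x),
      gradient (fun x => et e r₁ s x ^ 2 * (u (sg e s x) - u x + δ)⁻¹) x⟫ := by
  have hp := h.hp
  have he := h.he
  have hR := h.h0
  have hr10 : 0 < r₁ := hR.trans hr
  set c := s • e with hc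
  set v : E → ℝ := fun x => u (sg e s x) with hv
  have hvE := h.eig.refl he s
  have hvC : ContDiff ℝ 1 v := hvE.c1
  have huC := h.eig.c1
  set S := Sh e R₀ r₁ s with hS
  have hSo : IsOpen S := isOpen_Sh
  have hSb : Bornology.IsBounded S := bdd_Sh
  have hSA : S ⊆ An e R₀ R₁ s := fun x hx => h.mem_shell hx.1 (hx.2.1.trans hr1)
  have hSA2 : S ⊆ sg e s ⁻¹' An e R₀ R₁ s := fun x hx => h.sg_mem hx.1 (le_of_lt (hSA hx).1) hx.2.2
  set dA : E → E := fun x => flux p (gradient v x) - flux p (gradient u x) with hdA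
  have hAu : Continuous fun x => flux p (gradient u x) := (continuous_flux hp).comp (continuous_gradient huC)
  have hAv : Continuous fun x => flux p (gradient v x) := (continuous_flux hp).comp (continuous_gradient hvC)
  have hdAc : Continuous dA := hAv.sub hAu
  have hwC : ContDiff ℝ 1 (fun x => v x - u x + δ) := (hvC.sub huC).add contDiff_const
  have hwn : ∀ x ∈ S, 0 ≤ v x - u x := fun x hx => sub_nonneg.2 (h.w_nonneg hr1 hx)
  set V : Set E := {x | 0 < v x - u x + δ} with hV
  have hVo : IsOpen V := isOpen_lt continuous_const hwC.continuous
  have hSV : closure S ⊆ V := fun x hx => by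
    have : 0 ≤ v x - u x := closure_minimal (fun y hy => hwn y hy) (isClosed_le continuous_const (hvC.sub huC).continuous) hx
    change 0 < v x - u x + δ
    linarith
  set φ : E → ℝ := fun x => et e r₁ s x ^ 2 * (v x - u x + δ)⁻¹ with hφ
  have hφC : ContDiffOn ℝ 1 φ V := (contDiff_et.pow 2).contDiffOn.mul (hwC.contDiffOn.inv fun x hx => ne_of_gt hx)
  have hφ0 : ∀ x ∈ S, 0 ≤ φ x := fun x hx => by
    have := hwn x hx
    simp only [hφ]
    positivity
  set Cφ := r₁ ^ 5 * δ⁻¹ with hCφ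
  have hCφ0 : 0 < Cφ := by positivity
  have hφ1 : ∀ x ∈ S, φ x ≤ Cφ * (⟪e, x⟫ - s) := fun x hx => by
    obtain ⟨b1, b2, b3, b4⟩ := et_bd he hx
    have hw := hwn x hx
    have hy : 0 < ⟪e, x⟫ - s := by linarith [hx.2.2]
    have a1 : et e r₁ s x ^ 2 ≤ r₁ ^ 5 * (⟪e, x⟫ - s) := by
      calc et e r₁ s x ^ 2 ≤ ((⟪e, x⟫ - s) * r₁ ^ 2) ^ 2 := pow_le_pow_left₀ b1.le b3 2
        _ = (⟪e, x⟫ - s) * (⟪e, x⟫ - s) * r₁ ^ 4 := by ring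
        _ ≤ r₁ * (⟪e, x⟫ - s) * r₁ ^ 4 := by gcongr
        _ = _ := by ring
    calc φ x ≤ r₁ ^ 5 * (⟪e, x⟫ - s) * δ⁻¹ := by
          simp only [hφ]
          gcongr
          linarith
      _ = _ := by simp only [hCφ]; ring
  have hex : ∀ n : ℕ, ∃ ψ k : E → ℝ, ContDiff ℝ 1 ψ ∧ (∀ x, 0 ≤ ψ x) ∧ (∀ x, ψ x ≤ 1) ∧
    (∃ a, R₀ < a ∧ ∀ x, ‖x - c‖ < a → ψ x = 1) ∧ (∀ x, R₀ + 1 / ((n:ℝ) + 1) < ‖x - c‖ → ψ x = 0) ∧ Continuous k ∧ (∀ x, 0 ≤ k x) ∧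
    (∀ x, gradient ψ x = -(k x) • (x - c)) ∧ (∀ x, x ∉ closedBall c (R₀ + 1 / ((n:ℝ) + 1)) → k x = 0) ∧
    ∫ x, k x * (|⟪e, x - c⟫| * ‖dA x‖) ≤ 1 / ((n:ℝ) + 1) := by
    intro n
    have hn : (0:ℝ) < 1 / ((n:ℝ) + 1) := by positivity
    obtain ⟨d, hd, hcut⟩ := h.cut hF hn
    set d' := min d (1 / ((n:ℝ) + 1)) with hd'
    have hd'0 : 0 < d' := lt_min hd hn
    have l1 : d' ≤ d := min_le_left _ _
    have l2 : d' ≤ 1 / ((n:ℝ) + 1) := min_le_right _ _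
    obtain ⟨ψ, k, h1, h2, h3, h4, h5, h6, h7, h8, h9, h10⟩ := hcut (R₀ + d' / 3) (R₀ + d' / 2) (by linarith) (by linarith) (by linarith)
    refine ⟨ψ, k, h1, h2, h3, ⟨_, by linarith, h4⟩, fun x hx => h5 x (by linarith), h6, h7, h8, fun x hx => ?_, h10⟩
    by_contra hne
    refine hx ?_
    rw [mem_closedBall, dist_eq_norm]
    have := (h9 x hne).2
    linarith
  choose ψ k hψC hψ0 hψ1 hψa hψb hkc hk0 hgψ hkz hki using hex
  set g : E → ℝ := fun x => ⟪dA x, gradient φ x⟫ with hg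
  have hgc : ContinuousOn g (closure S) := hdAc.continuousOn.inner (𝕜 := ℝ) ((grad_contOn hVo hφC).mono hSV)
  obtain ⟨Cg, hCg⟩ := hSb.isCompact_closure.exists_bound_of_continuousOn hgc
  have hlim : Tendsto (fun n => ∫ x in S, (1 - ψ n x) * g x) atTop (𝓝 (∫ x in S, g x)) := by
    refine dct_on hSo hSb Cg (Eventually.of_forall fun n => ?_) (Eventually.of_forall fun n x hx => ?_) fun x hx => ?_
    · exact (continuous_const.sub (hψC n).continuous).continuousOn.mul (hgc.mono subset_closure)
    · rw [norm_mul]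
      have h1 : ‖1 - ψ n x‖ ≤ 1 := by
        rw [Real.norm_eq_abs, abs_le]; constructor <;> linarith [hψ0 n x, hψ1 n x]
      have := hCg x (subset_closure hx)
      have := norm_nonneg (g x)
      nlinarith
    · have hx1 : R₀ < ‖x - c‖ := hx.1
      have ht : Tendsto (fun n : ℕ => R₀ + 1 / ((n:ℝ) + 1)) atTop (𝓝 (R₀ + 0)) :=
        tendsto_const_nhds.add tendsto_one_div_add_atTop_nhds_zero_nat
      rw [add_zero] at ht
      refine tendsto_const_nhds.congr' ?_
      filter_upwards [ht.eventually_lt_const hx1] with n hn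
      rw [hψb n x hn, sub_zero, one_mul]
  have hlow : ∀ n : ℕ, -(Cφ * r₁) * (1 / ((n:ℝ) + 1)) ≤ ∫ x in S, (1 - ψ n x) * g x := by
    intro n
    set f : E → ℝ := fun x => (1 - ψ n x) * φ x with hf
    have hfC : ContDiffOn ℝ 1 f V := (contDiff_const.sub (hψC n)).contDiffOn.mul hφC
    have hf0 : ∀ x ∈ S, 0 ≤ f x := fun x hx => mul_nonneg (by linarith [hψ1 n x]) (hφ0 x hx)
    have hfz : ∀ x ∈ frontier S, f x = 0 := by
      intro x hx
      simp only [hf]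
      rcases frontier_Sh hx with h1 | h1
      · obtain ⟨a, ha, ha2⟩ := hψa n
        rw [ha2 x (by rw [hc, h1]; exact ha), sub_self, zero_mul]
      · simp only [hφ]
        rw [et_zero h1]; ring
    have tu := h.eig.test hSo hSA hSb hVo hSV hfC hfz hf0
    have tv := hvE.test hSo hSA2 hSb hVo hSV hfC hfz hf0
    have gfc : ContinuousOn (gradient f) (closure S) := (grad_contOn hVo hfC).mono hSV
    have fc : ContinuousOn f (closure S) := hfC.continuousOn.mono hSV
    have iu : IntegrableOn (fun x => ⟪flux p (gradient u x), gradient f x⟫) S := int_on hSb (hAu.continuousOn.inner (𝕜 := ℝ) gfc)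
    have iv : IntegrableOn (fun x => ⟪flux p (gradient v x), gradient f x⟫) S := int_on hSb (hAv.continuousOn.inner (𝕜 := ℝ) gfc)
    have hp1 : 0 ≤ p - 1 := by linarith
    have iu2 : IntegrableOn (fun x => u x ^ (p - 1) * f x) S :=
      int_on hSb ((huC.continuous.rpow_const fun x => Or.inr hp1).continuousOn.mul fc)
    have iv2 : IntegrableOn (fun x => v x ^ (p - 1) * f x) S :=
      int_on hSb ((hvC.continuous.rpow_const fun x => Or.inr hp1).continuousOn.mul fc)
    have hmain : 0 ≤ ∫ x in S, ⟪dA x, gradient f x⟫ := by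
      have e1 : ∫ x in S, ⟪dA x, gradient f x⟫ =
          lam * (∫ x in S, v x ^ (p - 1) * f x) - lam * ∫ x in S, u x ^ (p - 1) * f x := by
        rw [← tu, ← tv, ← integral_sub iv iu]
        refine setIntegral_congr_fun hSo.measurableSet fun x _ => ?_
        simp only [hdA, inner_sub_left]
      rw [e1, ← mul_sub]
      refine mul_nonneg h.hl (sub_nonneg.2 ?_)
      refine setIntegral_mono_on iu2 iv2 hSo.measurableSet fun x hx => ?_
      have := hf0 x hx
      have h1 := (h.pos x (hSA hx)).le
      have h2 := hwn x hx
      gcongr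
      linarith
    have hgr : ∀ x ∈ S, ⟪dA x, gradient f x⟫ = (1 - ψ n x) * g x + φ x * (k n x * ⟪dA x, x - c⟫) := by
      intro x hx
      have d1 : HasGradientAt φ (gradient φ x) x :=
        ((hφC.differentiableOn one_ne_zero).differentiableAt (hVo.mem_nhds (hSV (subset_closure hx)))).hasGradientAt
      have d2 := hg_mul (hg_const_sub 1 (hg_of_contDiff (hψC n) x)) d1
      rw [d2.gradient, inner_add_right, real_inner_smul_right, real_inner_smul_right, hgψ, inner_neg_right, real_inner_smul_right]
      simp only [hg]
      ring
    have kint : Integrable fun x => k n x * (|⟪e, x - c⟫| * ‖dA x‖) := by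
      refine Continuous.integrable_of_hasCompactSupport ?_ (HasCompactSupport.intro (isCompact_closedBall c (R₀ + 1 / ((n:ℝ) + 1)))
        fun x hx => by simp [hkz n x hx])
      exact (hkc n).mul ((by fun_prop : Continuous fun x : E => |⟪e, x - c⟫|).mul hdAc.norm)
    have hb2 : ∫ x in S, k n x * (|⟪e, x - c⟫| * ‖dA x‖) ≤ 1 / ((n:ℝ) + 1) :=
      (setIntegral_le_integral kint (Eventually.of_forall fun x => mul_nonneg (hk0 n x) (by positivity))).trans (hki n)
    have i1 : IntegrableOn (fun x => (1 - ψ n x) * g x) S :=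
      int_on hSb ((continuous_const.sub (hψC n).continuous).continuousOn.mul hgc)
    have hle : ∫ x in S, ⟪dA x, gradient f x⟫ ≤
        ∫ x in S, ((1 - ψ n x) * g x + Cφ * r₁ * (k n x * (|⟪e, x - c⟫| * ‖dA x‖))) := by
      refine setIntegral_mono_on (int_on hSb (hdAc.continuousOn.inner (𝕜 := ℝ) gfc)) (i1.add (kint.integrableOn.const_mul _))
        hSo.measurableSet fun x hx => ?_
      rw [hgr x hx]
      have hy : 0 < ⟪e, x⟫ - s := by linarith [hx.2.2]
      have hxr : ‖x - c‖ ≤ r₁ := hx.2.1.le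
      rw [show ⟪e, x - c⟫ = ⟪e, x⟫ - s from inner_sub_c he x, abs_of_pos hy]
      have s1 : ⟪dA x, x - c⟫ ≤ ‖dA x‖ * r₁ := (real_inner_le_norm _ _).trans (by gcongr)
      have hk := hk0 n x
      have s2 : φ x * (k n x * ⟪dA x, x - c⟫) ≤ (Cφ * (⟪e, x⟫ - s)) * (k n x * (‖dA x‖ * r₁)) := by
        refine (mul_le_mul_of_nonneg_left (mul_le_mul_of_nonneg_left s1 hk) (hφ0 x hx)).trans ?_
        exact mul_le_mul_of_nonneg_right (hφ1 x hx) (by positivity)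
      linarith
    rw [integral_add i1 (kint.integrableOn.const_mul _), integral_const_mul] at hle
    have := mul_le_mul_of_nonneg_left hb2 (by positivity : 0 ≤ Cφ * r₁)
    linarith
  have ht0 : Tendsto (fun n : ℕ => -(Cφ * r₁) * (1 / ((n:ℝ) + 1))) atTop (𝓝 (-(Cφ * r₁) * 0)) :=
    tendsto_const_nhds.mul tendsto_one_div_add_atTop_nhds_zero_nat
  rw [mul_zero] at ht0
  exact le_of_tendsto_of_tendsto' ht0 hlim hlow
end logest
end PL
end part11

section part12
open MeasureTheory Metric Set Filter
open scoped RealInnerProductSpace ENNReal Topology NNReal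
namespace PL
section fin
variable {E : Type*} [NormedAddCommGroup E] [InnerProductSpace ℝ E] [FiniteDimensional ℝ E] [MeasurableSpace E] [BorelSpace E]
variable {p lam R₀ R₁ s : ℝ} {e : E} {u : E → ℝ}

theorem log_lower {W w δ : ℝ} (hW : 0 < W) (hw : 0 ≤ w) (hwW : w ≤ W) (hδ : 0 < δ) :
    w / W * Real.log (1 + W / δ) ≤ Real.log (w + δ) - Real.log δ := by
  have h1 : (1 + W / δ) ^ (w / W) ≤ 1 + w / W * (W / δ) :=
    rpow_one_add_le_one_add_mul_self (by have : 0 < W / δ := by positivity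
                                         linarith) (by positivity) ((div_le_one hW).2 hwW)
  rw [← Real.log_rpow (by positivity), ← Real.log_div (by positivity) hδ.ne']
  refine Real.log_le_log (by positivity) (h1.trans (le_of_eq ?_))
  field_simp
  ring

theorem pt_est {a D g y : E} {η ι L κ C G r₁ r y₁ N : ℝ} (hη : 0 ≤ η) (hι : 0 ≤ ι) (hL : 0 ≤ L) (hκ : 0 < κ) (hC : 0 ≤ C)
    (E1 : κ * ‖D‖ ^ 2 ≤ ⟪a, D⟫) (E2 : ‖a‖ ≤ C * ‖D‖) (hg : ‖g‖ ≤ G) (hy : ‖y‖ ≤ r₁)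
    (hgy : ⟪g, y⟫ = η - 2 * r ^ 2 * y₁) (hη3 : η ≤ r₁ ^ 3) (P5 : (N + 3) * η ^ 2 ≤ 4 * r ^ 2 * (η * y₁)) :
    η ^ 2 * L ≤ (4 * C ^ 2 * G ^ 2 / κ ^ 2 + r₁ ^ 8) - (2 / κ) * ⟪a, (η ^ 2) • ((-ι ^ 2) • D) + ι • ((2 * η) • g)⟫
      - N * (η ^ 2 * L) - ⟪(η ^ 2) • (ι • D) + L • ((2 * η) • g), y⟫ := by
  have hr10 : 0 ≤ r₁ := (norm_nonneg _).trans hy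
  set Z := η * (‖D‖ * ι) with hZ
  have hZ0 : 0 ≤ Z := by positivity
  have P1 : ⟪a, (η ^ 2) • ((-ι ^ 2) • D) + ι • ((2 * η) • g)⟫ ≤ 2 * C * G * Z - κ * Z ^ 2 := by
    rw [inner_add_right, real_inner_smul_right, real_inner_smul_right, real_inner_smul_right, real_inner_smul_right]
    have s1 : ⟪a, g⟫ ≤ (C * ‖D‖) * G := (real_inner_le_norm _ _).trans (by gcongr)
    have s2 := mul_le_mul_of_nonneg_left s1 (by positivity : 0 ≤ ι * (2 * η))
    have s3 := mul_le_mul_of_nonneg_left E1 (by positivity : 0 ≤ η ^ 2 * ι ^ 2)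
    have t2 : ι * (2 * η) * (C * ‖D‖ * G) = 2 * C * G * Z := by rw [hZ]; ring
    have t3 : η ^ 2 * ι ^ 2 * (κ * ‖D‖ ^ 2) = κ * Z ^ 2 := by rw [hZ]; ring
    rw [t2] at s2
    rw [t3] at s3
    linarith
  have P2 : ⟪(η ^ 2) • (ι • D) + L • ((2 * η) • g), y⟫ ≤ η * (Z * r₁) + L * (2 * η * (η - 2 * r ^ 2 * y₁)) := by
    rw [inner_add_left, real_inner_smul_left, real_inner_smul_left, real_inner_smul_left, real_inner_smul_left, hgy]
    have s1 : ⟪D, y⟫ ≤ ‖D‖ * r₁ := (real_inner_le_norm _ _).trans (by gcongr)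
    have s2 := mul_le_mul_of_nonneg_left s1 (by positivity : 0 ≤ η ^ 2 * ι)
    have t2 : η ^ 2 * ι * (‖D‖ * r₁) = η * (Z * r₁) := by rw [hZ]; ring
    rw [t2] at s2
    linarith
  set Φ := ⟪a, (η ^ 2) • ((-ι ^ 2) • D) + ι • ((2 * η) • g)⟫
  set Ψ := ⟪(η ^ 2) • (ι • D) + L • ((2 * η) • g), y⟫
  clear_value Z Φ Ψ
  have P3 : Z ^ 2 ≤ 4 * C ^ 2 * G ^ 2 / κ ^ 2 - 2 / κ * Φ := by
    have s1 := mul_le_mul_of_nonneg_left P1 (by positivity : 0 ≤ 2 / κ)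
    have s2 : 2 / κ * (2 * C * G * Z - κ * Z ^ 2) = 2 * ((2 * C * G / κ) * Z) - 2 * Z ^ 2 := by field_simp
    have s3 : 4 * C ^ 2 * G ^ 2 / κ ^ 2 = (2 * C * G / κ) ^ 2 := by rw [div_pow]; ring
    rw [s3]
    have := sq_nonneg (2 * C * G / κ - Z)
    have : (2 * C * G / κ - Z) ^ 2 = (2 * C * G / κ) ^ 2 - 2 * ((2 * C * G / κ) * Z) + Z ^ 2 := by ring
    linarith
  have P4 : η * (Z * r₁) ≤ Z ^ 2 + r₁ ^ 8 := by
    have s1 : η * r₁ ≤ r₁ ^ 4 := (mul_le_mul_of_nonneg_right hη3 hr10).trans (le_of_eq (by ring))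
    have s2 : Z * (η * r₁) ≤ Z * r₁ ^ 4 := mul_le_mul_of_nonneg_left s1 hZ0
    have s3 : r₁ ^ 8 = (r₁ ^ 4) ^ 2 := by ring
    rw [s3]
    nlinarith [sq_nonneg (Z - r₁ ^ 4), sq_nonneg Z, sq_nonneg (r₁ ^ 4)]
  have P6 := mul_le_mul_of_nonneg_left P5 hL
  linarith

set_option maxHeartbeats 1000000 in
theorem Dat.vanish (h : Dat p lam R₀ R₁ s e u)
    (hF : ∀ ψ : E → ℝ, ContDiff ℝ 1 ψ → (∀ x, 0 ≤ ψ x) → (∀ x, ψ x ≤ 1) → ∀ a b, R₀ < a → b < R₁ - s →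
      (∀ x, ‖x - s • e‖ < a → ψ x = 1) → (∀ x, b < ‖x - s • e‖ → ψ x = 0) →
      ∫ x, (⟪gradient ψ x, e⟫ * (‖gradient u x‖ ^ p - lam * u x ^ p)
      - p * (⟪flux p (gradient u x), gradient ψ x⟫ * ⟪gradient u x, e⟫)) = 0) :
    ∃ r₁, R₀ < r₁ ∧ r₁ < R₁ - s ∧ ∀ x ∈ Sh e R₀ r₁ s, u (sg e s x) = u x := by
  have hp := h.hp
  have he := h.he
  have hR := h.h0
  set c := s • e with hc
  set v : E → ℝ := fun x => u (sg e s x) with hv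
  have hvC : ContDiff ℝ 1 v := (h.eig.refl he s).c1
  have huC := h.eig.c1
  obtain ⟨r₂, κ, C, hr2, hr2', hκ, hC, hell⟩ := h.shell
  rw [← hc, ← hv] at hell
  set N : ℝ := (Module.finrank ℝ E : ℝ) with hN
  have hN0 : 0 ≤ N := by positivity
  obtain ⟨r₁, hr, hr12, hrN⟩ : ∃ r₁, R₀ < r₁ ∧ r₁ < r₂ ∧ (N + 3) * (r₁ ^ 2 - R₀ ^ 2) ≤ 4 * R₀ ^ 2 := by
    have hcont : Continuous fun r : ℝ => (N + 3) * (r ^ 2 - R₀ ^ 2) := by fun_prop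
    have h1 : ∀ᶠ r in 𝓝[>] R₀, (N + 3) * (r ^ 2 - R₀ ^ 2) < 4 * R₀ ^ 2 :=
      nhdsWithin_le_nhds (hcont.continuousAt.eventually_lt continuousAt_const (by simp only [sub_self, mul_zero]; positivity))
    obtain ⟨r, ha, hb⟩ := (h1.and (Ioo_mem_nhdsGT hr2)).exists
    exact ⟨r, hb.1, hb.2, ha.le⟩
  have hr1 : r₁ < R₁ - s := by linarith
  have hr10 : 0 < r₁ := hR.trans hr
  refine ⟨r₁, hr, hr1, ?_⟩
  set S := Sh e R₀ r₁ s with hS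
  have hSo : IsOpen S := isOpen_Sh
  have hSb : Bornology.IsBounded S := bdd_Sh
  set w : E → ℝ := fun x => v x - u x with hw
  have hwC : ContDiff ℝ 1 w := hvC.sub huC
  have hwn : ∀ x ∈ S, 0 ≤ w x := fun x hx => sub_nonneg.2 (h.w_nonneg hr1 hx)
  have hwn' : ∀ x ∈ closure S, 0 ≤ w x := fun x hx =>
    closure_minimal (fun y hy => hwn y hy) (isClosed_le continuous_const hwC.continuous) hx
  obtain ⟨W0, hW0⟩ := hSb.isCompact_closure.exists_bound_of_continuousOn hwC.continuous.continuousOn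
  set W := max W0 1 with hWdef
  have hW : 0 < W := lt_max_of_lt_right one_pos
  have hwW : ∀ x ∈ S, w x ≤ W := fun x hx =>
    (le_abs_self _).trans ((hW0 x (subset_closure hx)).trans (le_max_left _ _))
  set η : E → ℝ := et e r₁ s with hη
  have hηC : ContDiff ℝ 1 η := contDiff_et
  set G := 3 * r₁ ^ 2 with hG
  set B := 4 * C ^ 2 * G ^ 2 / κ ^ 2 + r₁ ^ 8 with hB
  set dA : E → E := fun x => flux p (gradient v x) - flux p (gradient u x) with hdA
  have hAu : Continuous fun x => flux p (gradient u x) := (continuous_flux hp).comp (continuous_gradient huC)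
  have hAv : Continuous fun x => flux p (gradient v x) := (continuous_flux hp).comp (continuous_gradient hvC)
  have hdAc : Continuous dA := hAv.sub hAu
  have hgw : ∀ x, HasGradientAt w (gradient v x - gradient u x) x := fun x =>
    hg_sub (hg_of_contDiff hvC x) (hg_of_contDiff huC x)
  have main : ∀ δ : ℝ, 0 < δ → ∫ x in S, η x ^ 2 * (Real.log (w x + δ) - Real.log δ) ≤ B * volume.real S := by
    intro δ hδ
    have hkey := h.key hF hr hr1 hδ
    have hwC' : ContDiff ℝ 1 (fun x => w x + δ) := hwC.add contDiff_const
    set V : Set E := {x | 0 < w x + δ} with hV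
    have hVo : IsOpen V := isOpen_lt continuous_const hwC'.continuous
    have hSV : closure S ⊆ V := fun x hx => by
      have := hwn' x hx
      change 0 < w x + δ
      linarith
    set φ : E → ℝ := fun x => η x ^ 2 * (w x + δ)⁻¹ with hφ
    have hφC : ContDiffOn ℝ 1 φ V := (hηC.pow 2).contDiffOn.mul (hwC'.contDiffOn.inv fun x hx => ne_of_gt hx)
    change 0 ≤ ∫ x in S, ⟪dA x, gradient φ x⟫ at hkey
    set f : E → ℝ := fun x => η x ^ 2 * (Real.log (w x + δ) - Real.log δ) with hf
    have hfC : ContDiffOn ℝ 1 f V := (hηC.pow 2).contDiffOn.mul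
      ((hwC'.contDiffOn.log fun x hx => ne_of_gt hx).sub contDiffOn_const)
    have hL0 : ∀ x ∈ S, 0 ≤ Real.log (w x + δ) - Real.log δ := fun x hx => by
      have := Real.log_le_log hδ (by linarith [hwn x hx] : δ ≤ w x + δ)
      linarith
    have hf0 : ∀ x ∈ S, 0 ≤ f x := fun x hx => mul_nonneg (sq_nonneg _) (hL0 x hx)
    have hfz : ∀ x ∈ frontier S, f x = 0 := by
      intro x hx
      simp only [hf]
      rcases frontier_Sh hx with h1 | h1
      · have hw0 : w x = 0 := by
          simp only [hw, hv]
          rw [h.zin x h1, h.zin _ (by rw [norm_sg_sub he]; exact h1), sub_self]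
        rw [hw0, zero_add, sub_self, mul_zero]
      · simp only [hη]
        rw [et_zero h1]; ring
    have eul := euler hSo hSb hVo hSV hfC hfz hf0 c
    rw [← hN] at eul
    have gfc : ContinuousOn (gradient f) (closure S) := (grad_contOn hVo hfC).mono hSV
    have fi : IntegrableOn f S := int_on hSb (hfC.continuousOn.mono hSV)
    have gi : IntegrableOn (fun x => ⟪gradient f x, x - c⟫) S := int_on hSb (gfc.inner (𝕜 := ℝ) (by fun_prop))
    have φi : IntegrableOn (fun x => ⟪dA x, gradient φ x⟫) S :=
      int_on hSb (hdAc.continuousOn.inner (𝕜 := ℝ) ((grad_contOn hVo hφC).mono hSV))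
    have ci : IntegrableOn (fun _ : E => B) S := integrableOn_const hSb.measure_lt_top.ne
    have pt : ∀ x ∈ S, f x ≤ B - (2 / κ) * ⟪dA x, gradient φ x⟫ - N * f x - ⟪gradient f x, x - c⟫ := by
      intro x hx
      obtain ⟨b1, b2, b3, b4⟩ := et_bd he hx
      rw [← hη] at b1 b3 b4
      obtain ⟨E1, E2⟩ := hell x hx.1 (hx.2.1.trans hr12)
      change κ * ‖gradient v x - gradient u x‖ ^ 2 ≤ ⟪dA x, gradient v x - gradient u x⟫ at E1
      change ‖dA x‖ ≤ C * ‖gradient v x - gradient u x‖ at E2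
      set D := gradient v x - gradient u x with hD
      have hwδ : 0 < w x + δ := hSV (subset_closure hx)
      set ι := (w x + δ)⁻¹ with hι
      have hι0 : 0 < ι := inv_pos.2 hwδ
      have hηg : HasGradientAt η (gradient η x) x := hg_of_contDiff hηC x
      have hη2 : HasGradientAt (fun x => η x ^ 2) ((2 * η x) • gradient η x) x := by
        have := hg_comp hηg (hasDerivAt_pow 2 (η x))
        simpa using this
      have hwδg : HasGradientAt (fun x => w x + δ) D x := hg_add_const δ (hgw x)
      have gφ : gradient φ x = (η x ^ 2) • ((-ι ^ 2) • D) + ι • ((2 * η x) • gradient η x) := by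
        have hinv : HasDerivAt (fun t : ℝ => t⁻¹) (-ι ^ 2) (w x + δ) := by
          have := hasDerivAt_inv hwδ.ne'
          rw [hι, inv_pow]
          exact this
        exact (hg_mul hη2 (hg_comp hwδg hinv)).gradient
      have gf : gradient f x = (η x ^ 2) • (ι • D) + (Real.log (w x + δ) - Real.log δ) • ((2 * η x) • gradient η x) := by
        have hlog : HasDerivAt (fun t : ℝ => Real.log t - Real.log δ) ι (w x + δ) :=
          (Real.hasDerivAt_log hwδ.ne').sub_const _
        exact (hg_mul hη2 (hg_comp hwδg hlog)).gradient
      set L := Real.log (w x + δ) - Real.log δ with hL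
      have hLx : 0 ≤ L := hL0 x hx
      have hfx : f x = η x ^ 2 * L := rfl
      set r := ‖x - c‖ with hrdef
      have hrR : R₀ < r := hx.1
      have hrr : r < r₁ := hx.2.1
      set y₁ := ⟪e, x⟫ - s with hy1
      have hy0 : 0 < y₁ := sub_pos.2 hx.2.2
      set q := r₁ ^ 2 - r ^ 2 with hq
      have hq0 : 0 < q := by rw [hq]; nlinarith
      have hηx : η x = y₁ * q := rfl
      have hηy : ⟪gradient η x, x - c⟫ = η x - 2 * r ^ 2 * y₁ := by
        have hgg : gradient η x = _ := (hg_et x).gradient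
        rw [hgg, inner_add_left, real_inner_smul_left, inner_neg_left, real_inner_smul_left, real_inner_smul_left, ← hc,
          real_inner_self_eq_norm_sq, ← hrdef, hc, inner_sub_c he, ← hy1, ← hq, hηx]
        ring
      have P5 : (N + 3) * η x ^ 2 ≤ 4 * r ^ 2 * (η x * y₁) := by
        have s1 : (N + 3) * q ≤ 4 * r ^ 2 := by
          have : R₀ ^ 2 ≤ r ^ 2 := pow_le_pow_left₀ hR.le hrR.le 2
          have : (N + 3) * q ≤ (N + 3) * (r₁ ^ 2 - R₀ ^ 2) := by rw [hq]; gcongr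
          linarith
        have s2 := mul_le_mul_of_nonneg_right s1 (by positivity : 0 ≤ y₁ ^ 2 * q)
        calc (N + 3) * η x ^ 2 = (N + 3) * q * (y₁ ^ 2 * q) := by rw [hηx]; ring
          _ ≤ 4 * r ^ 2 * (y₁ ^ 2 * q) := s2
          _ = _ := by rw [hηx]; ring
      have s0 : η x ≤ r₁ ^ 3 := b3.trans ((mul_le_mul_of_nonneg_right b2 (sq_nonneg r₁)).trans (le_of_eq (by ring)))
      rw [hfx, hB, gφ, gf]
      exact pt_est b1.le hι0.le hLx hκ hC.le E1 E2 b4 hrr.le hηy s0 P5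
    have i1 : IntegrableOn (fun x => B - (2 / κ) * ⟪dA x, gradient φ x⟫) S := ci.sub (φi.const_mul (2 / κ))
    have i2 : IntegrableOn (fun x => B - (2 / κ) * ⟪dA x, gradient φ x⟫ - N * f x) S := i1.sub (fi.const_mul N)
    have i3 : IntegrableOn (fun x => B - (2 / κ) * ⟪dA x, gradient φ x⟫ - N * f x - ⟪gradient f x, x - c⟫) S := i2.sub gi
    have hintg := setIntegral_mono_on fi i3 hSo.measurableSet pt
    rw [integral_sub i2 gi, integral_sub i1 (fi.const_mul N), integral_sub ci (φi.const_mul (2 / κ)),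
      integral_const_mul, integral_const_mul, eul, setIntegral_const, smul_eq_mul] at hintg
    have := mul_nonneg (by positivity : 0 ≤ 2 / κ) hkey
    linarith
  have hηw : IntegrableOn (fun x => η x ^ 2 * w x) S :=
    int_on hSb ((hηC.continuous.pow 2).mul hwC.continuous).continuousOn
  have hbound : ∀ δ : ℝ, 0 < δ → Real.log (1 + W / δ) * ∫ x in S, η x ^ 2 * w x ≤ W * (B * volume.real S) := by
    intro δ hδ
    have h1 := main δ hδ
    have h2 : ∫ x in S, (Real.log (1 + W / δ) / W) * (η x ^ 2 * w x) ≤ ∫ x in S, η x ^ 2 * (Real.log (w x + δ) - Real.log δ) := by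
      refine setIntegral_mono_on (hηw.const_mul _) ?_ hSo.measurableSet fun x hx => ?_
      · refine int_on hSb ((hηC.continuous.pow 2).continuousOn.mul (ContinuousOn.sub (ContinuousOn.log ?_ ?_) continuousOn_const))
        · exact (hwC.continuous.add continuous_const).continuousOn
        · intro x hx
          have := hwn' x hx
          positivity
      · have := mul_le_mul_of_nonneg_left (log_lower hW (hwn x hx) (hwW x hx) hδ) (sq_nonneg (η x))
        refine le_trans (le_of_eq ?_) this
        ring
    rw [integral_const_mul, div_mul_eq_mul_div] at h2
    have := (div_le_iff₀ hW).1 (h2.trans h1)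
    linarith
  have hI0 : ∫ x in S, η x ^ 2 * w x ≤ 0 := by
    by_contra hcon
    push Not at hcon
    set I := ∫ x in S, η x ^ 2 * w x with hI
    set T := W * (B * volume.real S) with hT
    have hT1 : 0 < Real.exp (|T| / I + 1) - 1 := by
      have := Real.add_one_le_exp (|T| / I + 1)
      have : 0 ≤ |T| / I := by positivity
      linarith
    have := hbound (W / (Real.exp (|T| / I + 1) - 1)) (by positivity)
    rw [div_div_cancel₀ hW.ne', add_sub_cancel, Real.log_exp, add_mul, div_mul_cancel₀ _ hcon.ne', one_mul] at this
    linarith [le_abs_self T]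
  have hz := zero_of_int hSo ((hηC.continuous.pow 2).mul hwC.continuous).continuousOn
    (fun x hx => mul_nonneg (sq_nonneg _) (hwn x hx)) hηw hI0
  intro x hx
  have h1 := hz x hx
  have h2 := (et_bd he hx).1
  have h3 : w x = 0 := by
    rcases mul_eq_zero.1 h1 with h | h
    · exact absurd h (pow_pos h2 2).ne'
    · exact h
  simp only [hw, hv] at h3
  linarith

theorem Dat.final (h : Dat p lam R₀ R₁ s e u)
    (hF : ∀ ψ : E → ℝ, ContDiff ℝ 1 ψ → (∀ x, 0 ≤ ψ x) → (∀ x, ψ x ≤ 1) → ∀ a b, R₀ < a → b < R₁ - s →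
      (∀ x, ‖x - s • e‖ < a → ψ x = 1) → (∀ x, b < ‖x - s • e‖ → ψ x = 0) →
      ∫ x, (⟪gradient ψ x, e⟫ * (‖gradient u x‖ ^ p - lam * u x ^ p)
      - p * (⟪flux p (gradient u x), gradient ψ x⟫ * ⟪gradient u x, e⟫)) = 0) :
    ∃ r₁, R₀ < r₁ ∧ r₁ < R₁ - s ∧ ∀ x, R₀ < ‖x - s • e‖ → ‖x - s • e‖ < r₁ → u x = u (sg e s x) := by
  obtain ⟨r₁, h1, h2, h3⟩ := h.vanish hF
  refine ⟨r₁, h1, h2, fun x hx1 hx2 => ?_⟩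
  rcases lt_trichotomy s ⟪e, x⟫ with hlt | heq | hgt
  · exact (h3 x ⟨hx1, hx2, hlt⟩).symm
  · simp [sg, ← heq]
  · have := h3 (sg e s x) ⟨by rwa [norm_sg_sub h.he], by rwa [norm_sg_sub h.he], by
      have := inner_sg h.he s x
      linarith⟩
    rwa [sg_sg h.he] at this
end fin
end PL
end part12

section part13
open MeasureTheory Metric Set Filter
open scoped RealInnerProductSpace ENNReal Topology NNReal
namespace PL
section asm

theorem norm_e1 {N : ℕ} (hN : 2 ≤ N) : ‖e1 N‖ = 1 := by
  have : e1 N = EuclideanSpace.single (⟨0, Nat.lt_of_lt_of_le Nat.two_pos hN⟩ : Fin N) (1:ℝ) := by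
    ext i
    simp [e1, Fin.ext_iff, Pi.single_apply]
  rw [this]
  simp

theorem inner_e1 {N : ℕ} (hN : 2 ≤ N) (x : EuclideanSpace ℝ (Fin N)) : ⟪e1 N, x⟫ = x ⟨0, Nat.lt_of_lt_of_le Nat.two_pos hN⟩ := by
  have : e1 N = EuclideanSpace.single (⟨0, Nat.lt_of_lt_of_le Nat.two_pos hN⟩ : Fin N) (1:ℝ) := by
    ext i
    simp [e1, Fin.ext_iff, Pi.single_apply]
  rw [this, EuclideanSpace.inner_single_left]
  simp

theorem Om_eq {N : ℕ} {R₀ R₁ : ℝ} (h0 : 0 < R₀) (t : ℝ) : Om N R₀ R₁ t = An (e1 N) R₀ R₁ t := by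
  ext x
  simp only [Om, An, closure_ball (t • e1 N) h0.ne', mem_diff, mem_ball, dist_zero_right, mem_closedBall, dist_eq_norm, not_le, mem_setOf_eq, sub_zero]

/-- Cutting off a function outside a neighbourhood of a compact set. -/
theorem extend {E : Type*} [NormedAddCommGroup E] [InnerProductSpace ℝ E] [FiniteDimensional ℝ E] {K V : Set E} (hK : IsCompact K)
    (hV : IsOpen V) (hKV : K ⊆ V) {u : E → ℝ} (hu : ContDiffOn ℝ 1 u V) :
    ∃ U : E → ℝ, ContDiff ℝ 1 U ∧ (∃ L, LipschitzWith L U) ∧ ∃ O, IsOpen O ∧ K ⊆ O ∧ ∀ x ∈ O, U x = u x := by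
  obtain ⟨K1, hK1, hKK1, hK1V⟩ := exists_compact_between hK hV hKV
  obtain ⟨K2, hK2, hK12, hK2V⟩ := exists_compact_between hK1 hV hK1V
  obtain ⟨χ, hχ⟩ : ∃ f : E → ℝ, ContDiff ℝ 1 f ∧ (∀ x, x ∉ interior K2 → f x = 0) ∧ ∀ x ∈ K1, f x = 1 := by
    obtain ⟨f, h1, h2, h3, h4⟩ := exists_contMDiff_support_eq_eq_one_iff (n := 1) (modelWithCornersSelf ℝ E) (isOpen_interior (s := K2)) hK1.isClosed hK12
    refine ⟨f, h1.contDiff, fun x hx => ?_, fun x hx => (h4 x).1 hx⟩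
    rw [← h3] at hx
    simpa using hx
  obtain ⟨hχC, hχ0, hχ1⟩ := hχ
  have hz : ∀ x, x ∉ K2 → χ x * u x = 0 := fun x hx => by rw [hχ0 x fun h => hx (interior_subset h), zero_mul]
  have hC : ContDiff ℝ 1 fun x => χ x * u x := by
    rw [contDiff_iff_contDiffAt]
    intro x
    by_cases hx : x ∈ V
    · exact (hχC.contDiffAt).mul (hu.contDiffAt (hV.mem_nhds hx))
    · have : (fun x => χ x * u x) =ᶠ[𝓝 x] fun _ => 0 := by
        filter_upwards [hK2.isClosed.isOpen_compl.mem_nhds fun h => hx (hK2V h)] with y hy using hz y hy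
      exact contDiffAt_const.congr_of_eventuallyEq this
  refine ⟨_, hC, ContDiff.lipschitzWith_of_hasCompactSupport (HasCompactSupport.intro hK2 hz) hC one_ne_zero, interior K1,
    isOpen_interior, hKK1, fun x hx => ?_⟩
  rw [hχ1 x (interior_subset hx), one_mul]

theorem main (N : ℕ) (hN : 2 ≤ N) (R₀ R₁ : ℝ) (hR₀ : 0 < R₀) (hR : R₀ < R₁)
    (p : ℝ) (hp : 1 < p) (s : ℝ) (hs : 0 < s) (hs' : s < R₁ - R₀)
    (u : EuclideanSpace ℝ (Fin N) → ℝ)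
    (hu : IsFirstEigenfunction p (Om N R₀ R₁ s) (lam1 p (Om N R₀ R₁ s)) u)
    (hd : HasDerivAt (fun t : ℝ => lam1 p (Om N R₀ R₁ t)) 0 s) :
    ∃ r₀ ∈ Set.Ioo R₀ (R₁ - s), ∀ x : EuclideanSpace ℝ (Fin N),
      R₀ < ‖x - s • e1 N‖ → ‖x - s • e1 N‖ < r₀ →
      u x = u (x - (2 * (x ⟨0, Nat.lt_of_lt_of_le Nat.two_pos hN⟩ - s)) • e1 N) := by
  have he := norm_e1 hN
  have hOm : ∀ t, Om N R₀ R₁ t = An (e1 N) R₀ R₁ t := fun t => Om_eq hR₀ t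
  simp only [hOm] at hu hd
  set e := e1 N with hedef
  set lam := lam1 p (An e R₀ R₁ s) with hlam
  obtain ⟨⟨V, hV, hVc, huV⟩, hpos, hfr, hweak⟩ := hu
  have hbd : Bornology.IsBounded (An e R₀ R₁ s) := bdd_An
  obtain ⟨U, hUC, ⟨L, hL⟩, O, hO, hKO, hUu⟩ := extend hbd.isCompact_closure hV hVc huV
  have hgU : ∀ x ∈ O, gradient U x = gradient u x := fun x hx => by
    have : U =ᶠ[𝓝 x] u := by filter_upwards [hO.mem_nhds hx] with y hy using hUu y hy
    unfold gradient
    rw [this.fderiv_eq]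
  have hAO : An e R₀ R₁ s ⊆ O := subset_closure.trans hKO
  have hUA : ∀ x ∈ An e R₀ R₁ s, U x = u x := fun x hx => hUu x (hAO hx)
  have hmem : ∀ x : EuclideanSpace ℝ (Fin N), R₀ < ‖x - s • e‖ → ‖x - s • e‖ < R₁ - s → x ∈ An e R₀ R₁ s := by
    intro x h1 h2
    refine ⟨?_, h1⟩
    have := norm_add_le (x - s • e) (s • e)
    rw [sub_add_cancel, norm_smul, he, Real.norm_of_nonneg hs.le] at this
    linarith
  have hfz : ∀ x ∈ closure (An e R₀ R₁ s), x ∉ An e R₀ R₁ s → U x = 0 := fun x h1 h2 => by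
    rw [hUu x (hKO h1)]
    refine hfr x ?_
    rw [isOpen_An.frontier_eq]
    exact ⟨h1, h2⟩
  have hD : Dat p lam R₀ R₁ s e U := by
    refine ⟨hp, lam1_nonneg _, hR₀, hs, hs', he, ⟨hUC, fun W K hW h0 hz => ?_⟩, fun x hx => ?_, fun x hx => ?_, fun x hx => ?_⟩
    · refine lemB hp isOpen_An hbd hUC (fun φ h1 h2 h3 => ?_) hW h0 hz
      have := hweak φ h1 h2 h3
      rw [setIntegral_congr_fun isOpen_An.measurableSet (fun x hx => by simp only [hgU x (hAO hx)]; rfl), this]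
      congr 1
      exact setIntegral_congr_fun isOpen_An.measurableSet (fun x hx => by simp only [hUA x hx])
    · rw [hUA x hx]; exact hpos x hx
    · refine hfz x ?_ fun h => absurd h.2 (by rw [hx]; exact lt_irrefl _)
      have hc : Continuous fun t : ℝ => s • e + t • (x - s • e) := by fun_prop
      have h1 : s • e + (1:ℝ) • (x - s • e) = x := by simp
      have ht : Tendsto (fun t : ℝ => s • e + t • (x - s • e)) (𝓝[>] 1) (𝓝 x) := by
        have := hc.tendsto 1
        rw [h1] at this
        exact this.mono_left nhdsWithin_le_nhds
      refine mem_closure_of_tendsto ht ?_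
      have hb : (1:ℝ) < (R₁ - s) / R₀ := by rw [one_lt_div hR₀]; linarith
      filter_upwards [Ioo_mem_nhdsGT hb] with t ht
      have ht0 : 0 < t := zero_lt_one.trans ht.1
      have hn : ‖s • e + t • (x - s • e) - s • e‖ = t * R₀ := by
        rw [add_sub_cancel_left, norm_smul, hx, Real.norm_of_nonneg ht0.le]
      refine hmem _ ?_ ?_
      · rw [hn]; nlinarith [ht.1]
      · rw [hn]; exact (lt_div_iff₀ hR₀).1 ht.2
    · refine hfz x ?_ fun h => absurd h.1 (by rw [hx]; exact lt_irrefl _)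
      have hR1 : 0 < R₁ := by linarith
      have hc : Continuous fun t : ℝ => t • x := by fun_prop
      have ht : Tendsto (fun t : ℝ => t • x) (𝓝[<] 1) (𝓝 x) := by
        have := hc.tendsto 1
        rw [one_smul] at this
        exact this.mono_left nhdsWithin_le_nhds
      refine mem_closure_of_tendsto ht ?_
      have hb : (R₀ + s) / R₁ < 1 := by rw [div_lt_one hR1]; linarith
      filter_upwards [Ioo_mem_nhdsLT hb] with t ht
      have ht0 : 0 < t := lt_trans (by positivity) ht.1
      have hn : ‖t • x‖ = t * R₁ := by
        rw [norm_smul, hx, Real.norm_of_nonneg ht0.le]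
      refine ⟨?_, ?_⟩
      · rw [hn]; nlinarith [ht.2]
      · have h1 := norm_sub_norm_le (t • x) (s • e)
        rw [hn, norm_smul, he, Real.norm_of_nonneg hs.le] at h1
        have := (div_lt_iff₀ hR1).1 ht.1
        linarith
  obtain ⟨r₁, h1, h2, h3⟩ := hD.final (fun ψ a1 a2 a3 a b a4 a5 a6 a7 =>
    hD.shape hL (fun t => lam1_nonneg (p := p) (An e R₀ R₁ t)) (fun t W K b1 b2 b3 => lemA hp isOpen_An bdd_An b1 b2 b3) rfl hd
      a1 a2 a3 a4 a5 a6 a7)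
  refine ⟨r₁, ⟨h1, h2⟩, fun x hx1 hx2 => ?_⟩
  have h4 := h3 x hx1 hx2
  rw [hUA x (hmem x hx1 (hx2.trans h2)), hUA (sg e s x) (hmem _ (by rwa [norm_sg_sub he]) (by rw [norm_sg_sub he]; linarith))] at h4
  rw [h4, sg, inner_e1 hN]
end asm
end PL
end part13

theorem stmt13 (N : ℕ) (hN : 2 ≤ N) (R₀ R₁ : ℝ) (hR₀ : 0 < R₀) (hR : R₀ < R₁)
    (p : ℝ) (hp : 1 < p) (s : ℝ) (hs : 0 < s) (hs' : s < R₁ - R₀)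
    (u : EuclideanSpace ℝ (Fin N) → ℝ)
    (hu : IsFirstEigenfunction p (Om N R₀ R₁ s) (lam1 p (Om N R₀ R₁ s)) u)
    (hd : HasDerivAt (fun t : ℝ => lam1 p (Om N R₀ R₁ t)) 0 s) :
    ∃ r₀ ∈ Set.Ioo R₀ (R₁ - s), ∀ x : EuclideanSpace ℝ (Fin N),
      R₀ < ‖x - s • e1 N‖ → ‖x - s • e1 N‖ < r₀ →
      u x = u (x - (2 * (x ⟨0, by omega⟩ - s)) • e1 N) := by
  exact PL.main N hN R₀ R₁ hR₀ hR p hp s hs hs' u hu hd
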